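/- arXiv:1310.0301 — 13 statements merged into one kernel-verified Lean document; each statement's English description precedes it below -/
import Mathlib

section
/- Let δ > -1 and let P_N(x,a) be the joint distribution of the once-reinforced reflected walk (satisfying the combined recursion (2.5) with initial condition P_1(x,a) = δ_{x,1}δ_{a,1}), with 0 ≤ P_N(x,a) ≤ 1 and P_N(x,a) = 0 for x > a. Then for every 0 < λ < 1, every real u, and every integer a ≥ 1, the double generating function P̃̃(λ,u,a) := Σ_{N≥1} Σ_{x=0}^{a} λ^N u^x P_N(x,a) satisfies the functional equation P̃̃(λ,u,a)·(2u − λu² − λ) − 2λu²·δ_{a,1} = λ(u² − 1)·P̃(λ,0,a) + λ u^a·(δ/(2+δ) − u²)·P̃(λ,a,a) + (2λ/(2+δ))·u^{a+1}·P̃(λ,a−1,a−1)·(1 − δ_{a,1}), where P̃(λ,x,a) := Σ_{N≥1} λ^N P_N(x,a). -/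
open Real Filter Topology MeasureTheory

/-- Weighted partial sums of a sequence solving a sourced nearest-neighbour recursion on the
half-line. -/
theorem sum_pow_mul_of_nearest_neighbour (lam u : ℝ) (f s : ℕ → ℝ) (n : ℕ)
    (h0 : f 0 = s 0 + lam / 2 * f 1)
    (hs : ∀ x < n, f (x + 1) = s (x + 1) + lam / 2 * (f x + f (x + 2))) :
    (∑ x ∈ Finset.range (n + 1), u ^ x * f x) * (2 * u - lam * u ^ 2 - lam)
      = 2 * u * (∑ x ∈ Finset.range (n + 1), u ^ x * s x)
        - lam * f 0 - lam * u ^ (n + 2) * f n + lam * u ^ (n + 1) * f (n + 1) := by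
  induction n with
  | zero =>
    simp only [zero_add, Finset.sum_range_one, pow_zero, one_mul, pow_one]
    linear_combination 2 * u * h0
  | succ n ih =>
    have ih := ih fun x hx => hs x (by omega)
    rw [Finset.sum_range_succ, Finset.sum_range_succ (fun x => u ^ x * s x), add_mul, ih]
    linear_combination 2 * u * u ^ (n + 1) * hs n (by omega)

theorem summable_pow_succ_mul_of_mem_unitInterval {lam : ℝ} (hlam0 : 0 < lam) (hlam1 : lam < 1)
    {p : ℕ → ℝ} (hp : ∀ N, 0 ≤ p N ∧ p N ≤ 1) :
    Summable fun N : ℕ => lam ^ (N + 1) * p N := by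
  refine Summable.of_nonneg_of_le (fun N => mul_nonneg (by positivity) (hp N).1)
    (fun N => mul_le_of_le_one_right (by positivity) (hp N).2) ?_
  exact (summable_nat_add_iff 1).2 (summable_geometric_of_lt_one hlam0.le hlam1)

/-- A sequence satisfying a four-term linear recursion in time passes it on to its generating
function. -/
theorem tsum_pow_succ_mul_of_recursion (lam c₁ c₂ c₃ c₄ : ℝ) (p p₁ p₂ p₃ p₄ : ℕ → ℝ)
    (h : Summable fun N : ℕ => lam ^ (N + 1) * p N)
    (h₁ : Summable fun N : ℕ => lam ^ (N + 1) * p₁ N)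
    (h₂ : Summable fun N : ℕ => lam ^ (N + 1) * p₂ N)
    (h₃ : Summable fun N : ℕ => lam ^ (N + 1) * p₃ N)
    (h₄ : Summable fun N : ℕ => lam ^ (N + 1) * p₄ N)
    (hp : ∀ N, p (N + 1) = c₁ * p₁ N + c₂ * p₂ N + c₃ * p₃ N + c₄ * p₄ N) :
    ∑' N : ℕ, lam ^ (N + 1) * p N
      = lam * p 0 + lam * (c₁ * (∑' N : ℕ, lam ^ (N + 1) * p₁ N)
        + c₂ * (∑' N : ℕ, lam ^ (N + 1) * p₂ N) + c₃ * (∑' N : ℕ, lam ^ (N + 1) * p₃ N)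
        + c₄ * (∑' N : ℕ, lam ^ (N + 1) * p₄ N)) := by
  have hsum := ((((h₁.hasSum.mul_left c₁).add (h₂.hasSum.mul_left c₂)).add
    (h₃.hasSum.mul_left c₃)).add (h₄.hasSum.mul_left c₄)).mul_left lam
  rw [h.tsum_eq_zero_add, ← hsum.tsum_eq]
  congr 1
  · simp
  · refine tsum_congr fun N => ?_
    rw [hp]
    ring

/-- Functional equation (3) for the double generating function of the
once-reinforced reflected random walk on the half-line. -/
theorem stmt_0 (δ : ℝ) (hδ : δ > -1) (P : ℕ → ℤ → ℕ → ℝ)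
    (hinit : ∀ (x : ℤ) (a : ℕ), P 1 x a = if x = 1 ∧ a = 1 then 1 else 0)
    (hneg : ∀ (N : ℕ) (x : ℤ) (a : ℕ), x < 0 → P N x a = 0)
    (hbdd : ∀ (N : ℕ) (x : ℤ) (a : ℕ), 0 ≤ P N x a ∧ P N x a ≤ 1)
    (hsupp : ∀ (N : ℕ) (x : ℤ) (a : ℕ), (a : ℤ) < x → P N x a = 0)
    (hrec : ∀ (N : ℕ), 1 ≤ N → ∀ (x : ℤ), 0 ≤ x → ∀ (a : ℕ), 1 ≤ a →
      P (N + 1) x a =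
        (1 / 2) * (1 + (if x = 1 then (1 : ℝ) else 0)
            - (if x = (a : ℤ) + 1 then (1 : ℝ) else 0)) * P N (x - 1) a
        + (1 / 2) * P N (x + 1) a
        + (1 / (2 + δ)) * P N ((a : ℤ) - 1) (a - 1) * (if x = (a : ℤ) then (1 : ℝ) else 0)
            * (1 - if a = 1 then (1 : ℝ) else 0)
        + (δ / (2 * (2 + δ))) * P N (a : ℤ) a * (if x = (a : ℤ) - 1 then (1 : ℝ) else 0))
    (lam : ℝ) (hlam0 : 0 < lam) (hlam1 : lam < 1) (u : ℝ) (a : ℕ) (ha : 1 ≤ a) :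
    (∑ x ∈ Finset.range (a + 1), u ^ x * ∑' N : ℕ, lam ^ (N + 1) * P (N + 1) (x : ℤ) a)
        * (2 * u - lam * u ^ 2 - lam)
      - 2 * lam * u ^ 2 * (if a = 1 then (1 : ℝ) else 0)
    = lam * (u ^ 2 - 1) * (∑' N : ℕ, lam ^ (N + 1) * P (N + 1) 0 a)
      + lam * u ^ a * (δ / (2 + δ) - u ^ 2) * (∑' N : ℕ, lam ^ (N + 1) * P (N + 1) (a : ℤ) a)
      + (2 * lam / (2 + δ)) * u ^ (a + 1)
          * (∑' N : ℕ, lam ^ (N + 1) * P (N + 1) ((a : ℤ) - 1) (a - 1))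
          * (1 - if a = 1 then (1 : ℝ) else 0) := by
  obtain ⟨k, rfl⟩ : ∃ k, a = k + 1 := ⟨a - 1, by omega⟩
  set F : ℤ → ℕ → ℝ := fun x b => ∑' N : ℕ, lam ^ (N + 1) * P (N + 1) x b with hF
  have hsummable (x : ℤ) (b : ℕ) : Summable fun N : ℕ => lam ^ (N + 1) * P (N + 1) x b :=
    summable_pow_succ_mul_of_mem_unitInterval hlam0 hlam1 fun N => hbdd (N + 1) x b
  have hFneg : F (-1) (k + 1) = 0 := by
    simp [hF, hneg _ (-1) _ (by norm_num)]
  have hFtop : F ((k + 1 + 1 : ℕ) : ℤ) (k + 1) = 0 :=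
    (tsum_congr fun N => by rw [hsupp _ _ _ (by push_cast; omega), mul_zero]).trans tsum_zero
  set e : ℝ := if k + 1 = 1 then 1 else 0 with he
  set G : ℝ := F ((k + 1 : ℕ) : ℤ) (k + 1) with hG
  set H : ℝ := F (((k + 1 : ℕ) : ℤ) - 1) (k + 1 - 1) with hH
  have hFrec (x : ℕ) : F x (k + 1)
      = lam * (if (x : ℤ) = 1 ∧ k + 1 = 1 then 1 else 0) + lam * (
        (1 / 2) * (1 + (if (x : ℤ) = 1 then (1 : ℝ) else 0)
          - (if (x : ℤ) = ((k + 1 : ℕ) : ℤ) + 1 then (1 : ℝ) else 0)) * F (x - 1) (k + 1)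
        + (1 / 2) * F (x + 1) (k + 1)
        + (1 / (2 + δ)) * (if (x : ℤ) = ((k + 1 : ℕ) : ℤ) then (1 : ℝ) else 0) * (1 - e) * H
        + (δ / (2 * (2 + δ))) * (if (x : ℤ) = ((k + 1 : ℕ) : ℤ) - 1 then (1 : ℝ) else 0) * G) := by
    rw [← hinit]
    refine tsum_pow_succ_mul_of_recursion lam _ _ _ _ (fun N => P (N + 1) x (k + 1)) _ _ _ _
      (hsummable _ _) (hsummable _ _) (hsummable _ _) (hsummable _ _) (hsummable _ _) fun N => ?_
    rw [hrec (N + 1) (by omega) x (by omega) (k + 1) ha]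
    ring
  let s : ℕ → ℝ := fun x =>
    (if x = 1 then lam * e + lam / 2 * F 0 (k + 1) else 0)
      + (if x = k + 1 then lam / (2 + δ) * (1 - e) * H else 0)
      + (if x = k then lam * δ / (2 * (2 + δ)) * G else 0)
  have key := sum_pow_mul_of_nearest_neighbour lam u (fun x : ℕ => F x (k + 1)) s (k + 1)
    (by
      have h := hFrec 0
      simp only [Nat.cast_zero, zero_sub, hFneg, zero_add] at h
      rw [Nat.cast_zero, Nat.cast_one, h]
      have h1 : ((0 : ℤ) = ((k + 1 : ℕ) : ℤ)) ↔ False := by simp; omega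
      have h2 : ((0 : ℤ) = ((k + 1 : ℕ) : ℤ) - 1) ↔ 0 = k := by push_cast; omega
      simp only [s, h1, h2]
      simp
      split_ifs <;> ring)
    (by
      intro x hx
      have h := hFrec (x + 1)
      have h0 : (((x + 1 : ℕ) : ℤ) = 1) ↔ x = 0 := by push_cast; omega
      have h1 : (((x + 1 : ℕ) : ℤ) = ((k + 1 : ℕ) : ℤ)) ↔ x = k := by push_cast; omega
      have h2 : (((x + 1 : ℕ) : ℤ) = ((k + 1 : ℕ) : ℤ) - 1) ↔ x + 1 = k := by push_cast; omega
      have h3 : (((x + 1 : ℕ) : ℤ) = ((k + 1 : ℕ) : ℤ) + 1) ↔ False := by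
        simp only [iff_false]; push_cast; omega
      have h4 : ((x + 1 : ℕ) : ℤ) - 1 = (x : ℤ) := by push_cast; ring
      have h5 : ((x + 1 : ℕ) : ℤ) + 1 = ((x + 2 : ℕ) : ℤ) := by push_cast; ring
      simp only [h0, h1, h2, h3, h4, h5] at h
      simp only [h, s, he, add_eq_right, Nat.add_right_cancel_iff]
      rcases eq_or_ne x 0 with rfl | hx0
      · simp
        split_ifs <;> ring
      · simp [hx0]
        split_ifs <;> ring)
  have hsum : ∑ x ∈ Finset.range (k + 1 + 1), u ^ x * s x
      = u * (lam * e + lam / 2 * F 0 (k + 1))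
        + u ^ (k + 1) * (lam / (2 + δ) * (1 - e) * H)
        + u ^ k * (lam * δ / (2 * (2 + δ)) * G) := by
    simp only [s, mul_add, mul_ite, mul_zero, Finset.sum_add_distrib, Finset.sum_ite_eq',
      Finset.mem_range]
    simp
  rw [hsum, hFtop] at key
  have hδ2 : 2 + δ ≠ 0 := by linarith
  rw [key]
  simp only [Nat.cast_zero, ← hG]
  field_simp
  ring
end

section
/- Let δ > -1 and let P_N(x,a) be the joint distribution of the once-reinforced reflected walk (satisfying the combined recursion (2.5) with initial condition P_1(x,a) = δ_{x,1}δ_{a,1}), with 0 ≤ P_N(x,a) ≤ 1 and P_N(x,a) = 0 for x > a. Then for every 0 < λ < 1, the generating function P̃(λ,1,1) := Σ_{N≥1} λ^N P_N(1,1) equals λ / (1 − λ²(1+δ)/(2+δ)). -/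
open Real Filter Topology MeasureTheory

/-- The generating function at the starting site: P̃(λ,1,1) = λ/(1 − λ²(1+δ)/(2+δ)). -/
theorem stmt_1 (δ : ℝ) (hδ : δ > -1) (P : ℕ → ℤ → ℕ → ℝ)
    (hinit : ∀ (x : ℤ) (a : ℕ), P 1 x a = if x = 1 ∧ a = 1 then 1 else 0)
    (hneg : ∀ (N : ℕ) (x : ℤ) (a : ℕ), x < 0 → P N x a = 0)
    (hbdd : ∀ (N : ℕ) (x : ℤ) (a : ℕ), 0 ≤ P N x a ∧ P N x a ≤ 1)
    (hsupp : ∀ (N : ℕ) (x : ℤ) (a : ℕ), (a : ℤ) < x → P N x a = 0)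
    (hrec : ∀ (N : ℕ), 1 ≤ N → ∀ (x : ℤ), 0 ≤ x → ∀ (a : ℕ), 1 ≤ a →
      P (N + 1) x a =
        (1 / 2) * (1 + (if x = 1 then (1 : ℝ) else 0)
            - (if x = (a : ℤ) + 1 then (1 : ℝ) else 0)) * P N (x - 1) a
        + (1 / 2) * P N (x + 1) a
        + (1 / (2 + δ)) * P N ((a : ℤ) - 1) (a - 1) * (if x = (a : ℤ) then (1 : ℝ) else 0)
            * (1 - if a = 1 then (1 : ℝ) else 0)
        + (δ / (2 * (2 + δ))) * P N (a : ℤ) a * (if x = (a : ℤ) - 1 then (1 : ℝ) else 0))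
    (lam : ℝ) (hlam0 : 0 < lam) (hlam1 : lam < 1) :
    (∑' N : ℕ, lam ^ (N + 1) * P (N + 1) 1 1)
      = lam / (1 - lam ^ 2 * (1 + δ) / (2 + δ)) := by
  obtain ⟨q, hq⟩ : ∃ q : ℝ, q = (1 + δ) / (2 + δ) := ⟨_, rfl⟩
  have hδ2 : 0 < 2 + δ := by linarith
  have hq0 : 0 ≤ q := hq ▸ div_nonneg (by linarith : 0 ≤ 1 + δ) hδ2.le
  have hq1 : q ≤ 1 := by rw [hq, div_le_one hδ2]; linarith
  have return_step : ∀ N, 1 ≤ N → P (N + 1) 1 1 = P N 0 1 := by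
    intro N hN
    rw [hrec N hN 1 (by norm_num) 1 le_rfl]
    have h2 : P N 2 1 = 0 := hsupp N 2 1 (by norm_num)
    norm_num [h2]
  have origin_step : ∀ N, 1 ≤ N → P (N + 1) 0 1 = q * P N 1 1 := by
    intro N hN
    rw [hrec N hN 0 le_rfl 1 le_rfl]
    have h2 : P N (-1) 1 = 0 := hneg N (-1) 1 (by norm_num)
    simp [h2, hq]
    field_simp
    ring
  have odd_time : ∀ k : ℕ, P (2 * k + 1) 1 1 = q ^ k := by
    intro k
    induction k with
    | zero => simp [hinit]
    | succ k ih =>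
      rw [show 2 * (k + 1) + 1 = (2 * k + 1 + 1) + 1 by lia, return_step _ (by omega),
        origin_step _ (by omega), ih, pow_succ']
  have even_time : ∀ k : ℕ, P (2 * k + 1 + 1) 1 1 = 0 := by
    intro k
    rw [return_step _ (by omega)]
    induction k with
    | zero => simp [hinit]
    | succ k ih =>
      rw [show 2 * (k + 1) + 1 = (2 * k + 1 + 1) + 1 by lia, origin_step _ (by omega),
        return_step _ (by omega), ih, mul_zero]
  have hr0 : 0 ≤ lam ^ 2 * q := by positivity
  have hr1 : lam ^ 2 * q < 1 := by nlinarith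
  have hsum : HasSum (fun N : ℕ => lam ^ (N + 1) * P (N + 1) 1 1)
      (lam * (1 - lam ^ 2 * q)⁻¹ + 0) := by
    refine HasSum.even_add_odd ?_ ?_
    · have hterm : ∀ k : ℕ, lam ^ (2 * k + 1) * P (2 * k + 1) 1 1 = lam * (lam ^ 2 * q) ^ k := by
        intro k
        rw [odd_time]
        ring
      simpa only [hterm] using (hasSum_geometric_of_lt_one hr0 hr1).mul_left lam
    · simp [even_time]
  rw [hsum.tsum_eq, add_zero, mul_div_assoc, ← hq, div_eq_mul_inv]
end

section
/- Let δ > -1 and let P_N(x,a) be the joint distribution of the once-reinforced reflected walk (satisfying the combined recursion (2.5) with initial condition P_1(x,a) = δ_{x,1}δ_{a,1}), with 0 ≤ P_N(x,a) ≤ 1 and P_N(x,a) = 0 for x > a. For 0 < λ < 1 set θ := (1 − √(1 − λ²))/λ. Then for every integer a ≥ 1, P̃(λ,a,a) := Σ_{N≥1} λ^N P_N(a,a) satisfies the product formula P̃(λ,a,a) = (2θ/(2+δ))^{a−1} · P̃(λ,1,1) · Π_{i=2}^{a} (1 + θ^{2i}) / (1 + θ^{2i+2} − (δ/(2+δ))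 θ² (1 + θ^{2i−2})). -/
open Real Filter Topology MeasureTheory

/-- A sequence obeying the recursion `u n + u (n + 2) = (θ + θ⁻¹) u (n + 1)` up to index `b`, with
the reflecting initial condition, is a multiple of `θ ^ n + θ ^ (-n)`. -/
lemma pow_mul_eq_of_reflected_recursion {lam θ A : ℝ} (hlam : lam * (1 + θ ^ 2) = 2 * θ)
    (hlam0 : lam ≠ 0) {b : ℕ} {f : ℕ → ℝ} (h0 : f 0 = 2 * A) (h1 : A = lam / 2 * f 1)
    (hf : ∀ n, n + 2 ≤ b → f (n + 1) = lam / 2 * (f n + f (n + 2))) :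
    ∀ n, (n ≤ b → θ ^ n * f n = A * (1 + θ ^ (2 * n))) ∧
      (n + 1 ≤ b → θ ^ (n + 1) * f (n + 1) = A * (1 + θ ^ (2 * (n + 1)))) := by
  intro n
  induction n with
  | zero =>
    refine ⟨fun _ => by simp [h0]; ring, fun _ => ?_⟩
    apply mul_left_cancel₀ hlam0
    linear_combination (-2 * θ) * h1 - A * hlam
  | succ n ih =>
    refine ⟨ih.2, fun hn => ?_⟩
    have e0 := ih.1 (by omega)
    have e1 := ih.2 (by omega)
    have e2 := hf n hn
    apply mul_left_cancel₀ hlam0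
    linear_combination 2 * θ * e1 - lam * θ ^ 2 * e0 - 2 * θ ^ (n + 2) * e2
      - A * (1 + θ ^ (2 * (n + 1))) * hlam

/-- The denominators of the product formula are positive. -/
lemma denom_pos {d θ : ℝ} (hd : d < 1) (hθ0 : 0 < θ) (hθ1 : θ < 1) {b : ℕ} (hb : 2 ≤ b) :
    0 < 1 + θ ^ (2 * b + 2) - d * θ ^ 2 * (1 + θ ^ (2 * b - 2)) := by
  obtain ⟨k, rfl⟩ := Nat.exists_eq_add_of_le hb
  have e : 2 * (2 + k) - 2 = 2 * k + 2 := by omega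
  rw [e]
  have h1 : θ ^ 2 < 1 := pow_lt_one₀ hθ0.le hθ1 (by norm_num)
  have h2 : θ ^ (2 * (2 + k)) < 1 := pow_lt_one₀ hθ0.le hθ1 (by omega)
  have h3 : 0 < θ ^ 2 * (1 + θ ^ (2 * k + 2)) := by positivity
  have h4 := mul_pos (sub_pos.2 h1) (sub_pos.2 h2)
  have h5 := mul_pos (sub_pos.2 hd) h3
  have e2 : θ ^ (2 * (2 + k) + 2) = θ ^ 2 * θ ^ (2 * (2 + k)) := by ring
  have e3 : θ ^ (2 * (2 + k)) = θ ^ 2 * θ ^ (2 * k + 2) := by ring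
  rw [e2]
  rw [e3] at h4 ⊢
  nlinarith

/-- Product formula (6) for P̃(λ,a,a) of the once-reinforced reflected walk. -/
theorem stmt_2 (δ : ℝ) (hδ : δ > -1) (P : ℕ → ℤ → ℕ → ℝ)
    (hinit : ∀ (x : ℤ) (a : ℕ), P 1 x a = if x = 1 ∧ a = 1 then 1 else 0)
    (hneg : ∀ (N : ℕ) (x : ℤ) (a : ℕ), x < 0 → P N x a = 0)
    (hbdd : ∀ (N : ℕ) (x : ℤ) (a : ℕ), 0 ≤ P N x a ∧ P N x a ≤ 1)
    (hsupp : ∀ (N : ℕ) (x : ℤ) (a : ℕ), (a : ℤ) < x → P N x a = 0)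
    (hrec : ∀ (N : ℕ), 1 ≤ N → ∀ (x : ℤ), 0 ≤ x → ∀ (a : ℕ), 1 ≤ a →
      P (N + 1) x a =
        (1 / 2) * (1 + (if x = 1 then (1 : ℝ) else 0)
            - (if x = (a : ℤ) + 1 then (1 : ℝ) else 0)) * P N (x - 1) a
        + (1 / 2) * P N (x + 1) a
        + (1 / (2 + δ)) * P N ((a : ℤ) - 1) (a - 1) * (if x = (a : ℤ) then (1 : ℝ) else 0)
            * (1 - if a = 1 then (1 : ℝ) else 0)
        + (δ / (2 * (2 + δ))) * P N (a : ℤ) a * (if x = (a : ℤ) - 1 then (1 : ℝ) else 0))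
    (lam : ℝ) (hlam0 : 0 < lam) (hlam1 : lam < 1)
    (θ : ℝ) (hθ : θ = (1 - Real.sqrt (1 - lam ^ 2)) / lam)
    (a : ℕ) (ha : 1 ≤ a) :
    (∑' N : ℕ, lam ^ (N + 1) * P (N + 1) (a : ℤ) a)
      = (2 * θ / (2 + δ)) ^ (a - 1) * (∑' N : ℕ, lam ^ (N + 1) * P (N + 1) 1 1)
        * ∏ i ∈ Finset.Icc 2 a,
            (1 + θ ^ (2 * i))
              / (1 + θ ^ (2 * i + 2) - (δ / (2 + δ)) * θ ^ 2 * (1 + θ ^ (2 * i - 2))) := by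
  have hsum : ∀ (x : ℤ) (b : ℕ), Summable fun N : ℕ => lam ^ (N + 1) * P (N + 1) x b := by
    intro x b
    have hgeo : Summable fun N : ℕ => lam ^ (N + 1) :=
      (summable_nat_add_iff 1).2 (summable_geometric_of_lt_one hlam0.le hlam1)
    refine Summable.of_nonneg_of_le
      (fun N => mul_nonneg (by positivity) (hbdd _ _ _).1) (fun N => ?_) hgeo
    exact mul_le_of_le_one_right (by positivity) (hbdd _ _ _).2
  obtain ⟨g, hg⟩ : ∃ g : ℤ → ℕ → ℝ,
      ∀ x b, g x b = ∑' N : ℕ, lam ^ (N + 1) * P (N + 1) x b := ⟨_, fun _ _ => rfl⟩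
  have hgrec : ∀ b : ℕ, 2 ≤ b → ∀ x : ℤ, 0 ≤ x → g x b = lam *
      ((1 / 2) * (1 + (if x = 1 then (1 : ℝ) else 0)
            - (if x = (b : ℤ) + 1 then (1 : ℝ) else 0)) * g (x - 1) b
        + (1 / 2) * g (x + 1) b
        + (1 / (2 + δ)) * (if x = (b : ℤ) then (1 : ℝ) else 0) * g ((b : ℤ) - 1) (b - 1)
        + (δ / (2 * (2 + δ))) * (if x = (b : ℤ) - 1 then (1 : ℝ) else 0) * g b b) := by
    intro b hb x hx
    have hb1 : b ≠ 1 := by omega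
    have key := ((((hsum (x - 1) b).hasSum.mul_left
        ((1 / 2) * (1 + (if x = 1 then (1 : ℝ) else 0)
            - (if x = (b : ℤ) + 1 then (1 : ℝ) else 0)))).add
        ((hsum (x + 1) b).hasSum.mul_left (1 / 2))).add
        ((hsum ((b : ℤ) - 1) (b - 1)).hasSum.mul_left
          ((1 / (2 + δ)) * (if x = (b : ℤ) then (1 : ℝ) else 0)))).add
        ((hsum b b).hasSum.mul_left
          ((δ / (2 * (2 + δ))) * (if x = (b : ℤ) - 1 then (1 : ℝ) else 0)))
    simp only [← hg] at key
    rw [← (key.mul_left lam).tsum_eq, hg, (hsum x b).tsum_eq_zero_add, hinit,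
      if_neg (fun h => hb1 h.2), mul_zero, zero_add]
    refine tsum_congr fun N => ?_
    rw [hrec (N + 1) (by omega) x hx b (by omega), if_neg hb1]
    ring
  have hs := Real.sq_sqrt (show 0 ≤ 1 - lam ^ 2 by nlinarith)
  have hs0 : 0 < √(1 - lam ^ 2) := Real.sqrt_pos.2 (by nlinarith)
  have hθl : lam * θ = 1 - √(1 - lam ^ 2) := by rw [hθ]; field_simp
  have hs1 : √(1 - lam ^ 2) < 1 := by nlinarith
  have hθ0 : 0 < θ := by
    rw [hθ]
    exact div_pos (by linarith) hlam0
  have hquad : lam * (1 + θ ^ 2) = 2 * θ := by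
    apply mul_left_cancel₀ hlam0.ne'
    linear_combination (lam * θ - 1 - √(1 - lam ^ 2)) * hθl + hs
  have hθ1 : θ < 1 := by nlinarith [sq_nonneg (θ - 1), sq_nonneg (1 - lam)]
  have h2δ : 0 < 2 + δ := by linarith
  have hd : δ / (2 + δ) < 1 := by rw [div_lt_one h2δ]; linarith
  have hstep : ∀ b : ℕ, 2 ≤ b → g b b = 2 * θ / (2 + δ) * g ((b : ℤ) - 1) (b - 1) *
      ((1 + θ ^ (2 * b))
        / (1 + θ ^ (2 * b + 2) - (δ / (2 + δ)) * θ ^ 2 * (1 + θ ^ (2 * b - 2)))) := by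
    intro b hb
    have hneg' : g (-1) b = 0 := by
      rw [hg]; simp [hneg _ (-1) b (by norm_num)]
    have htop : g ((b : ℤ) + 1) b = 0 := by
      rw [hg]; simp [hsupp _ ((b : ℤ) + 1) b (by omega)]
    obtain ⟨f, hf⟩ : ∃ f : ℕ → ℝ, ∀ n, f n = if n = 0 then 2 * g 0 b else
      if n = b then (1 + δ / (2 + δ)) * g b b else g n b := ⟨_, fun _ => rfl⟩
    have hfg : ∀ n, 1 ≤ n → n < b → f n = g n b := fun n h1 h2 => by
      rw [hf, if_neg (by omega), if_neg (by omega)]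
    have hfb : f b = (1 + δ / (2 + δ)) * g b b := by
      rw [hf, if_neg (by omega), if_pos rfl]
    have hf0 : f 0 = 2 * g 0 b := by rw [hf, if_pos rfl]
    have h1 : g 0 b = lam / 2 * f 1 := by
      have h := hgrec b hb 0 le_rfl
      rw [if_neg (by omega), if_neg (by omega), if_neg (by omega), if_neg (by omega)] at h
      rw [hfg 1 le_rfl (by omega), h]
      norm_num [hneg']
      ring
    have hfrec : ∀ n, n + 2 ≤ b → f (n + 1) = lam / 2 * (f n + f (n + 2)) := by
      intro n hn
      have h := hgrec b hb (n + 1) (by omega)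
      rw [if_neg (show ¬ (n + 1 : ℤ) = b + 1 by omega),
        if_neg (show ¬ (n + 1 : ℤ) = b by omega)] at h
      have hlow : (1 + if (n + 1 : ℤ) = 1 then (1 : ℝ) else 0) * g ((n : ℤ) + 1 - 1) b = f n := by
        rcases Nat.eq_zero_or_pos n with rfl | h0
        · rw [hf0]; norm_num
        · rw [if_neg (by omega), hfg n h0 (by omega)]; norm_num
      have hup : g ((n : ℤ) + 1 + 1) b
          + δ / (2 + δ) * (if (n + 1 : ℤ) = b - 1 then (1 : ℝ) else 0) * g b b = f (n + 2) := by
        rcases hn.eq_or_lt with rfl | h0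
        · rw [hfb, if_pos (by push_cast; ring)]; push_cast; ring_nf
        · rw [if_neg (by omega), hfg _ (by omega) h0]; push_cast; ring_nf
      rw [hfg _ (by omega) (by omega), ← hlow, ← hup]
      push_cast
      rw [h]
      field_simp
      ring
    obtain ⟨k, rfl⟩ := Nat.exists_eq_add_of_le' hb
    obtain ⟨hA, hB⟩ := pow_mul_eq_of_reflected_recursion hquad hlam0.ne' hf0 h1 hfrec (k + 1)
    replace hA := hA (by omega)
    replace hB := hB le_rfl
    rw [hfg _ (by omega) (by omega)] at hA
    rw [hfb] at hB
    have hlast := hgrec (k + 2) hb (k + 2 : ℕ) (by omega)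
    rw [htop, if_neg (by omega), if_neg (by omega), if_pos rfl, if_neg (by omega)] at hlast
    have hcast : ((k + 2 : ℕ) : ℤ) - 1 = (k + 1 : ℕ) := by push_cast; ring
    rw [hcast] at hlast ⊢
    have hD := denom_pos hd hθ0 hθ1 hb
    rw [← mul_div_assoc, eq_div_iff hD.ne']
    have he : 2 * (k + 2) - 2 = 2 * (k + 1) := by omega
    rw [he]
    -- eliminate `lam` and the amplitude `g 0 b`
    have hAB : (1 + θ ^ (2 * (k + 2))) * g (k + 1 : ℕ) (k + 2)
        = θ * (1 + δ / (2 + δ)) * (1 + θ ^ (2 * (k + 1))) * g (k + 2 : ℕ) (k + 2) := by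
      apply mul_left_cancel₀ (pow_pos hθ0 (k + 1)).ne'
      linear_combination (1 + θ ^ (2 * (k + 2))) * hA - (1 + θ ^ (2 * (k + 1))) * hB
    generalize g (k + 2 : ℕ) (k + 2) = G at *
    generalize g (k + 1 : ℕ) (k + 2) = G' at *
    generalize g (k + 1 : ℕ) (k + 2 - 1) = H at *
    have hlast' : (1 + θ ^ 2) * G = θ * G' + 2 * θ / (2 + δ) * H := by
      linear_combination (1 + θ ^ 2) * hlast + (G' / 2 + 1 / (2 + δ) * H) * hquad
    linear_combination (1 + θ ^ (2 * (k + 2))) * hlast' + θ * hAB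
  simp only [← hg]
  induction a, ha using Nat.le_induction with
  | base => simp
  | succ n hn ih =>
    rw [hstep (n + 1) (by omega), Finset.prod_Icc_succ_top (by omega)]
    have hcast : ((n + 1 : ℕ) : ℤ) - 1 = n := by push_cast; ring
    rw [hcast, Nat.add_sub_cancel, ih]
    obtain ⟨m, rfl⟩ := Nat.exists_eq_add_of_le' hn
    rw [Nat.add_sub_cancel, pow_succ]
    ring
end

section
/- Let δ > -1 and let P_N(x,a) be the joint distribution of the once-reinforced reflected walk (satisfying the combined recursion (2.5) with initial condition P_1(x,a) = δ_{x,1}δ_{a,1}), with 0 ≤ P_N(x,a) ≤ 1 and P_N(x,a) = 0 for x > a. For 0 < λ < 1 set θ := (1 − √(1 − λ²))/λ. Then for every integer a ≥ 1, P̃(λ,0,a) := Σ_{N≥1} λ^N P_N(0,a) satisfies P̃(λ,0,a) = (2θ²/(1 − θ²))·δ_{a,1} + (θ^a/(1 − θ²))·(δ/(2+δ) − θ²)·P̃(λ,a,a) + (θ^{a+1}/(1 − θ²))·(2/(2+δ))·P̃(λ,a−1,a−1)·(1 − δ_{a,1}), where P̃(λ,x,a) := Σ_{N≥1} λ^N P_N(x,a).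 -/
open Real Filter Topology MeasureTheory

/-- Weighted telescoping for a second order recursion whose characteristic root is `θ`. -/
theorem weighted_telescope (θ : ℝ) (G s : ℕ → ℝ) (a : ℕ)
    (h0 : (θ ^ 2 + 1) * G 0 = θ * (G 1 + s 0))
    (hs : ∀ n < a, (θ ^ 2 + 1) * G (n + 1) = θ * (G n + G (n + 2) + s (n + 1))) :
    θ ^ (a + 2) * G a - θ ^ (a + 1) * G (a + 1)
      = -G 0 + ∑ x ∈ Finset.range (a + 1), θ ^ (x + 1) * s x := by
  induction a with
  | zero => simp; linear_combination h0
  | succ n ih =>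
    rw [Finset.sum_range_succ]
    have h1 := ih fun m hm => hs m (by omega)
    have h2 := hs n (by omega)
    linear_combination h1 + θ ^ (n + 1) * h2

/-- Weighted sums of bounded nonnegative sequences converge. -/
theorem summable_pow_mul_of_bounded {l : ℝ} (hl0 : 0 < l) (hl1 : l < 1) (f : ℕ → ℝ)
    (hf : ∀ N, 0 ≤ f N ∧ f N ≤ 1) : Summable fun N => l ^ (N + 1) * f (N + 1) := by
  refine Summable.of_nonneg_of_le (fun N => mul_nonneg (by positivity) (hf _).1) (fun N => ?_)
    ((summable_geometric_of_lt_one hl0.le hl1).mul_left l)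
  have := mul_le_mul_of_nonneg_left (hf (N + 1)).2 (show 0 ≤ l ^ (N + 1) by positivity)
  rw [pow_succ'] at *
  simpa using this

/-- The smaller root of `2u - λu² - λ = 0` lies in `(0, 1)`. -/
theorem smaller_root_spec {l θ : ℝ} (hl0 : 0 < l) (hl1 : l < 1)
    (hθ : θ = (1 - Real.sqrt (1 - l ^ 2)) / l) :
    0 < θ ∧ θ < 1 ∧ l * (θ ^ 2 + 1) = 2 * θ := by
  have hsq : Real.sqrt (1 - l ^ 2) ^ 2 = 1 - l ^ 2 := Real.sq_sqrt (by nlinarith)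
  have hlθ : l * θ = 1 - Real.sqrt (1 - l ^ 2) := by rw [hθ]; field_simp
  have hs1 : Real.sqrt (1 - l ^ 2) < 1 := by
    rw [Real.sqrt_lt' one_pos]; nlinarith
  have hs2 : 1 - l < Real.sqrt (1 - l ^ 2) := Real.lt_sqrt_of_sq_lt (by nlinarith)
  refine ⟨?_, ?_, ?_⟩
  · rw [hθ]; exact div_pos (by linarith) hl0
  · rw [hθ, div_lt_one hl0]; linarith
  · have h : l * (l * (θ ^ 2 + 1)) = l * (2 * θ) := by
      have : Real.sqrt (1 - l ^ 2) = 1 - l * θ := by linarith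
      rw [this] at hsq
      linarith
    exact mul_left_cancel₀ hl0.ne' h

/-- Formula (7) for P̃(λ,0,a) of the once-reinforced reflected walk. -/
theorem stmt_3 (δ : ℝ) (hδ : δ > -1) (P : ℕ → ℤ → ℕ → ℝ)
    (hinit : ∀ (x : ℤ) (a : ℕ), P 1 x a = if x = 1 ∧ a = 1 then 1 else 0)
    (hneg : ∀ (N : ℕ) (x : ℤ) (a : ℕ), x < 0 → P N x a = 0)
    (hbdd : ∀ (N : ℕ) (x : ℤ) (a : ℕ), 0 ≤ P N x a ∧ P N x a ≤ 1)
    (hsupp : ∀ (N : ℕ) (x : ℤ) (a : ℕ), (a : ℤ) < x → P N x a = 0)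
    (hrec : ∀ (N : ℕ), 1 ≤ N → ∀ (x : ℤ), 0 ≤ x → ∀ (a : ℕ), 1 ≤ a →
      P (N + 1) x a =
        (1 / 2) * (1 + (if x = 1 then (1 : ℝ) else 0)
            - (if x = (a : ℤ) + 1 then (1 : ℝ) else 0)) * P N (x - 1) a
        + (1 / 2) * P N (x + 1) a
        + (1 / (2 + δ)) * P N ((a : ℤ) - 1) (a - 1) * (if x = (a : ℤ) then (1 : ℝ) else 0)
            * (1 - if a = 1 then (1 : ℝ) else 0)
        + (δ / (2 * (2 + δ))) * P N (a : ℤ) a * (if x = (a : ℤ) - 1 then (1 : ℝ) else 0))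
    (lam : ℝ) (hlam0 : 0 < lam) (hlam1 : lam < 1)
    (θ : ℝ) (hθ : θ = (1 - Real.sqrt (1 - lam ^ 2)) / lam)
    (a : ℕ) (ha : 1 ≤ a) :
    (∑' N : ℕ, lam ^ (N + 1) * P (N + 1) 0 a)
      = (2 * θ ^ 2 / (1 - θ ^ 2)) * (if a = 1 then (1 : ℝ) else 0)
        + (θ ^ a / (1 - θ ^ 2)) * (δ / (2 + δ) - θ ^ 2)
            * (∑' N : ℕ, lam ^ (N + 1) * P (N + 1) (a : ℤ) a)
        + (θ ^ (a + 1) / (1 - θ ^ 2)) * (2 / (2 + δ))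
            * (∑' N : ℕ, lam ^ (N + 1) * P (N + 1) ((a : ℤ) - 1) (a - 1))
            * (1 - if a = 1 then (1 : ℝ) else 0) := by
  obtain ⟨hθ0, hθ1, hroot⟩ := smaller_root_spec hlam0 hlam1 hθ
  have hδ2 : 2 + δ ≠ 0 := by linarith
  have hden : 1 - θ ^ 2 ≠ 0 := by nlinarith
  have hsum (x : ℤ) (b : ℕ) : Summable fun N : ℕ => lam ^ (N + 1) * P (N + 1) x b :=
    summable_pow_mul_of_bounded hlam0 hlam1 (fun N => P N x b) fun N => hbdd N x b
  set g : ℤ → ℕ → ℝ := fun x b => ∑' N : ℕ, lam ^ (N + 1) * P (N + 1) x b with hg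
  have hgen (x : ℤ) (hx : 0 ≤ x) : g x a = lam * P 1 x a + lam * (
        (1 / 2) * (1 + (if x = 1 then (1 : ℝ) else 0)
            - (if x = (a : ℤ) + 1 then (1 : ℝ) else 0)) * g (x - 1) a
        + (1 / 2) * g (x + 1) a
        + (1 / (2 + δ)) * g ((a : ℤ) - 1) (a - 1) * (if x = (a : ℤ) then (1 : ℝ) else 0)
            * (1 - if a = 1 then (1 : ℝ) else 0)
        + (δ / (2 * (2 + δ))) * g (a : ℤ) a * (if x = (a : ℤ) - 1 then (1 : ℝ) else 0)) := by
    have h := (((((((hsum (x - 1) a).hasSum.mul_left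
        ((1 / 2) * (1 + (if x = 1 then (1 : ℝ) else 0)
            - (if x = (a : ℤ) + 1 then (1 : ℝ) else 0)))).add
        ((hsum (x + 1) a).hasSum.mul_left (1 / 2))).add
        ((((hsum ((a : ℤ) - 1) (a - 1)).hasSum.mul_left (1 / (2 + δ))).mul_right
          (if x = (a : ℤ) then (1 : ℝ) else 0)).mul_right
          (1 - if a = 1 then (1 : ℝ) else 0))).add
        (((hsum a a).hasSum.mul_left (δ / (2 * (2 + δ)))).mul_right
          (if x = (a : ℤ) - 1 then (1 : ℝ) else 0)))).mul_left lam).tsum_eq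
    calc g x a = lam * P 1 x a + ∑' N : ℕ, lam ^ (N + 2) * P (N + 2) x a := by
          simpa [hg] using (hsum x a).tsum_eq_zero_add
      _ = _ := by
          rw [← h]
          congr 1
          refine tsum_congr fun N => ?_
          rw [hrec (N + 1) (by omega) x hx a ha]
          ring
  have hgneg : g (-1) a = 0 := by simp [hg, hneg _ (-1) a (by norm_num)]
  have hgtop : g ((a : ℤ) + 1) a = 0 := by
    simp [hg, hsupp _ ((a : ℤ) + 1) a (by omega)]
  let s : ℕ → ℝ := fun n =>
    (if n = 1 then g 0 a + 2 * (if a = 1 then 1 else 0) else 0)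
    + (if n = a then 2 / (2 + δ) * g ((a : ℤ) - 1) (a - 1) * (1 - if a = 1 then (1 : ℝ) else 0)
        else 0)
    + (if n = a - 1 then δ / (2 + δ) * g a a else 0)
  have hstep (n : ℕ) (hn : n ≤ a) :
      (θ ^ 2 + 1) * g n a = θ * (g ((n : ℤ) - 1) a + g ((n : ℤ) + 1) a + s n) := by
    have h := hgen n (by omega)
    have e1 : ((n : ℤ) = 1) ↔ n = 1 := by omega
    have e2 : ((n : ℤ) = (a : ℤ) + 1) ↔ False := iff_of_false (by omega) id
    have e3 : ((n : ℤ) = (a : ℤ)) ↔ n = a := by omega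
    have e4 : ((n : ℤ) = (a : ℤ) - 1) ↔ n = a - 1 := by omega
    simp only [hinit, e1, e2, e3, e4, if_false] at h
    have h' : 2 * g n a = lam * (g ((n : ℤ) - 1) a + g ((n : ℤ) + 1) a + s n) := by
      rw [h]
      simp only [s]
      by_cases hn1 : n = 1
      · subst hn1
        simp only [true_and, if_true, Nat.cast_one, sub_self]
        split_ifs <;> field_simp <;> ring
      · simp only [hn1, false_and, if_false]
        split_ifs <;> field_simp <;> ring
    refine mul_left_cancel₀ hlam0.ne' ?_
    linear_combination g n a * hroot + θ * h'
  have htel := weighted_telescope θ (fun n => g n a) s a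
    (by simpa [hgneg] using hstep 0 (by omega))
    (fun n hn => by
      have h := hstep (n + 1) hn
      push_cast at h ⊢
      rw [h]
      congr 4; ring)
  have hsource : ∑ x ∈ Finset.range (a + 1), θ ^ (x + 1) * s x
      = θ ^ 2 * (g 0 a + 2 * (if a = 1 then 1 else 0))
        + θ ^ (a + 1) * (2 / (2 + δ) * g ((a : ℤ) - 1) (a - 1)
          * (1 - if a = 1 then (1 : ℝ) else 0))
        + θ ^ a * (δ / (2 + δ) * g a a) := by
    simp only [s, mul_add, Finset.sum_add_distrib, mul_ite, mul_zero, Finset.sum_ite_eq',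
      Finset.mem_range]
    rw [if_pos (show 1 < a + 1 by omega), if_pos (show a < a + 1 by omega),
      if_pos (show a - 1 < a + 1 by omega), Nat.sub_add_cancel ha]
  rw [hsource] at htel
  push_cast at htel
  rw [hgtop] at htel
  change g 0 a = _ + _ * g a a + _ * g ((a : ℤ) - 1) (a - 1) * _
  refine mul_left_cancel₀ hden ?_
  have hmul (u : ℝ) : (1 - θ ^ 2) * (u / (1 - θ ^ 2)) = u := mul_div_cancel₀ u hden
  linear_combination htel - (if a = 1 then (1 : ℝ) else 0) * hmul (2 * θ ^ 2)
    - (δ / (2 + δ) - θ ^ 2) * g a a * hmul (θ ^ a)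
    - 2 / (2 + δ) * g ((a : ℤ) - 1) (a - 1) * (1 - if a = 1 then (1 : ℝ) else 0)
      * hmul (θ ^ (a + 1))
end

section
/- Let δ > -1 and define F(s,y,b) := (2+δ)·cosh(y√(2s))·(cosh(b√(2s)))^{−(2+δ/2)} for s > 0 and real y, b with b > 0. Then F satisfies the oblique-reflection boundary condition at the diagonal and the Neumann condition at the origin: for all s > 0 and b > 0, (1 + δ/4)·∂F/∂y(s,y,b)|_{y=b} + (1/2)·∂F/∂b(s,y,b)|_{y=b} = 0, and ∂F/∂y(s,y,b)|_{y=0} = 0. -/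
open Real Filter Topology MeasureTheory

lemma hasDerivAt_cosh_mul_const (k x : ℝ) :
    HasDerivAt (fun y : ℝ => Real.cosh (y * k)) (Real.sinh (x * k) * k) x := by
  simpa using ((hasDerivAt_id x).mul_const k).cosh

lemma hasDerivAt_cosh_mul_const_rpow (k p x : ℝ) :
    HasDerivAt (fun y : ℝ => Real.cosh (y * k) ^ p)
      (Real.sinh (x * k) * k * p * Real.cosh (x * k) ^ (p - 1)) x :=
  (hasDerivAt_cosh_mul_const k x).rpow_const (Or.inl (Real.cosh_pos _).ne')

/-- Oblique-reflection boundary condition at the diagonal y = b, and the Neumann condition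
at the origin, for F(s,y,b) = (2+δ)·cosh(y√(2s))·(cosh(b√(2s)))^{−(2+δ/2)}. -/
theorem stmt_5 (δ : ℝ) (hδ : δ > -1)
    (F : ℝ → ℝ → ℝ → ℝ)
    (hF : ∀ s y b : ℝ, F s y b =
      (2 + δ) * Real.cosh (y * Real.sqrt (2 * s))
        * Real.cosh (b * Real.sqrt (2 * s)) ^ (-(2 + δ / 2)))
    (s b : ℝ) (hs : 0 < s) (hb : 0 < b) :
    (1 + δ / 4) * deriv (fun y : ℝ => F s y b) b
        + (1 / 2) * deriv (fun b' : ℝ => F s b b') b = 0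
    ∧ deriv (fun y : ℝ => F s y b) 0 = 0 := by
  simp only [hF]
  set k := Real.sqrt (2 * s)
  have hy (x : ℝ) := (((hasDerivAt_cosh_mul_const k x).const_mul (2 + δ)).mul_const
    (Real.cosh (b * k) ^ (-(2 + δ / 2)))).deriv
  have hb' := ((hasDerivAt_cosh_mul_const_rpow k (-(2 + δ / 2)) b).const_mul
    ((2 + δ) * Real.cosh (b * k))).deriv
  have hc : Real.cosh (b * k) ≠ 0 := (Real.cosh_pos _).ne'
  refine ⟨?_, by rw [hy]; simp⟩
  rw [hy, hb', Real.rpow_sub_one hc]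
  field_simp
  ring
end

section
/- Let δ > -2 and define Q_δ(t,b) := 2^{1+δ/2} · √(2/(πt)) · Σ_{j=0}^{∞} (−1)^j · (Γ(j + 1 + δ/2)/(Γ(1 + δ/2)·j!)) · (2j + 1 + δ/2) · e^{−(b²/(2t))·(2j+1+δ/2)²} for t > 0, b > 0. Then for every s > 0 and b > 0, ∫₀^∞ e^{−st} Q_δ(t,b) dt = (2+δ)/√(2s) · sinh(b√(2s)) · (cosh(b√(2s)))^{−(2+δ/2)}. -/
open Real Filter Topology MeasureTheory

/-- The unnormalised error function `y ↦ ∫ v in 0..y, exp (-v ^ 2)`. -/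
noncomputable def gaussPrimitive (y : ℝ) : ℝ := ∫ v in (0 : ℝ)..y, Real.exp (-v ^ 2)

lemma hasDerivAt_gaussPrimitive (y : ℝ) :
    HasDerivAt gaussPrimitive (Real.exp (-y ^ 2)) y := by
  have hc : Continuous fun v : ℝ => Real.exp (-v ^ 2) := by fun_prop
  exact intervalIntegral.integral_hasDerivAt_right (hc.intervalIntegrable _ _)
    hc.stronglyMeasurable.stronglyMeasurableAtFilter hc.continuousAt

lemma gaussPrimitive_neg (y : ℝ) : gaussPrimitive (-y) = -gaussPrimitive y := by
  have h := intervalIntegral.integral_comp_neg (a := 0) (b := y)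
    (fun v : ℝ => Real.exp (-v ^ 2))
  simp only [neg_sq, neg_zero] at h
  rw [gaussPrimitive, gaussPrimitive, h, intervalIntegral.integral_symm]

lemma tendsto_gaussPrimitive_atTop : Tendsto gaussPrimitive atTop (𝓝 (√π / 2)) := by
  have hi := (integrable_exp_neg_mul_sq (b := 1) one_pos).integrableOn (s := Set.Ioi 0)
  have h := intervalIntegral_tendsto_integral_Ioi (0 : ℝ) hi tendsto_id
  rw [integral_gaussian_Ioi] at h
  change Tendsto (fun y : ℝ => ∫ v in (0 : ℝ)..y, Real.exp (-v ^ 2)) _ _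
  simpa using h

lemma tendsto_gaussPrimitive_atBot : Tendsto gaussPrimitive atBot (𝓝 (-(√π / 2))) := by
  have h := (tendsto_gaussPrimitive_atTop.comp tendsto_neg_atBot_atTop).neg
  refine h.congr fun y => ?_
  simp [gaussPrimitive_neg]

/-- A primitive of `t ↦ α * (exp (-(α ^ 2 * t + β ^ 2 / t)) / √t)` on `(0, ∞)`. -/
noncomputable def besselPrimitive (α β t : ℝ) : ℝ :=
  Real.exp (2 * α * β) * gaussPrimitive (α * √t + β / √t)
    + Real.exp (-(2 * α * β)) * gaussPrimitive (α * √t - β / √t)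

lemma hasDerivAt_besselPrimitive (α β : ℝ) {t : ℝ} (ht : 0 < t) :
    HasDerivAt (besselPrimitive α β)
      (α * (Real.exp (-(α ^ 2 * t + β ^ 2 / t)) / √t)) t := by
  have hr : 0 < √t := Real.sqrt_pos.2 ht
  have hsq : √t ^ 2 = t := Real.sq_sqrt ht.le
  have hd : HasDerivAt (fun t : ℝ => √t) (1 / (2 * √t)) t := Real.hasDerivAt_sqrt ht.ne'
  have h1 := hd.const_mul α
  have h2 := (hasDerivAt_const t β).div hd hr.ne'
  have e1 : Real.exp (2 * α * β) * Real.exp (-(α * √t + β / √t) ^ 2)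
      = Real.exp (-(α ^ 2 * t + β ^ 2 / t)) := by
    rw [← Real.exp_add]
    congr 1
    rw [← hsq, Real.sqrt_sq hr.le]
    field_simp
    ring
  have e2 : Real.exp (-(2 * α * β)) * Real.exp (-(α * √t - β / √t) ^ 2)
      = Real.exp (-(α ^ 2 * t + β ^ 2 / t)) := by
    rw [← Real.exp_add]
    congr 1
    rw [← hsq, Real.sqrt_sq hr.le]
    field_simp
    ring
  have hp := ((hasDerivAt_gaussPrimitive (α * √t + β / √t)).comp t (h1.add h2)).const_mul
    (Real.exp (2 * α * β))
  have hm := ((hasDerivAt_gaussPrimitive (α * √t - β / √t)).comp t (h1.sub h2)).const_mul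
    (Real.exp (-(2 * α * β)))
  refine (hp.add hm).congr_deriv ?_
  rw [← mul_assoc, ← mul_assoc, e1, e2]
  field_simp
  ring

lemma tendsto_besselPrimitive_atTop {α : ℝ} (hα : 0 < α) (β : ℝ) :
    Tendsto (besselPrimitive α β) atTop
      (𝓝 (Real.exp (2 * α * β) * (√π / 2) + Real.exp (-(2 * α * β)) * (√π / 2))) := by
  have h1 : Tendsto (fun t : ℝ => α * √t) atTop atTop :=
    Real.tendsto_sqrt_atTop.const_mul_atTop hα
  have h2 : Tendsto (fun t : ℝ => β / √t) atTop (𝓝 0) :=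
    Real.tendsto_sqrt_atTop.const_div_atTop β
  have h3 : Tendsto (fun t : ℝ => -(β / √t)) atTop (𝓝 0) := by simpa using h2.neg
  have hm := tendsto_gaussPrimitive_atTop.comp (h1.atTop_add h3)
  have hp := tendsto_gaussPrimitive_atTop.comp (h1.atTop_add h2)
  simp only [← sub_eq_add_neg] at hm
  exact (hp.const_mul _).add (hm.const_mul _)

lemma tendsto_besselPrimitive_zero (α : ℝ) {β : ℝ} (hβ : 0 < β) :
    Tendsto (besselPrimitive α β) (𝓝[>] 0)
      (𝓝 (Real.exp (2 * α * β) * (√π / 2) + Real.exp (-(2 * α * β)) * (-(√π / 2)))) := by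
  have h0 : Tendsto (fun t : ℝ => √t) (𝓝[>] 0) (𝓝 0) :=
    (Real.continuous_sqrt.tendsto' 0 0 Real.sqrt_zero).mono_left nhdsWithin_le_nhds
  have h0' : Tendsto (fun t : ℝ => √t) (𝓝[>] 0) (𝓝[>] 0) :=
    tendsto_nhdsWithin_iff.2 ⟨h0, by
      filter_upwards [self_mem_nhdsWithin] with t ht using Real.sqrt_pos.2 ht⟩
  have h1 : Tendsto (fun t : ℝ => α * √t) (𝓝[>] 0) (𝓝 0) := by simpa using h0.const_mul α
  have h2 : Tendsto (fun t : ℝ => β / √t) (𝓝[>] 0) atTop := by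
    simpa [div_eq_mul_inv] using (tendsto_inv_nhdsGT_zero.comp h0').const_mul_atTop hβ
  have hp := tendsto_gaussPrimitive_atTop.comp (h1.add_atTop h2)
  have hm := tendsto_gaussPrimitive_atBot.comp
    (h1.add_atBot (tendsto_neg_atTop_atBot.comp h2))
  simp only [Function.comp_def, ← sub_eq_add_neg] at hm
  exact (hp.const_mul _).add (hm.const_mul _)

lemma integrableOn_and_integral_exp_div_sqrt {α β : ℝ} (hα : 0 < α) (hβ : 0 < β) :
    IntegrableOn (fun t : ℝ => Real.exp (-(α ^ 2 * t + β ^ 2 / t)) / √t) (Set.Ioi 0) ∧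
      ∫ t in Set.Ioi (0 : ℝ), Real.exp (-(α ^ 2 * t + β ^ 2 / t)) / √t
        = √π / α * Real.exp (-(2 * α * β)) := by
  set c := Real.exp (2 * α * β) * (√π / 2) + Real.exp (-(2 * α * β)) * (-(√π / 2)) with hc
  have hcont : ContinuousWithinAt (Function.update (besselPrimitive α β) 0 c) (Set.Ici 0) 0 := by
    rw [continuousWithinAt_update_same, Set.Ici_sdiff_left]
    exact tendsto_besselPrimitive_zero α hβ
  have hderiv : ∀ t ∈ Set.Ioi (0 : ℝ), HasDerivAt (Function.update (besselPrimitive α β) 0 c)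
      (α * (Real.exp (-(α ^ 2 * t + β ^ 2 / t)) / √t)) t := fun t ht =>
    (hasDerivAt_besselPrimitive α β ht).congr_of_eventuallyEq <| by
      filter_upwards [eventually_ne_nhds (Set.mem_Ioi.1 ht).ne'] with x hx
      exact Function.update_of_ne hx _ _
  have hpos : ∀ t ∈ Set.Ioi (0 : ℝ),
      0 ≤ α * (Real.exp (-(α ^ 2 * t + β ^ 2 / t)) / √t) := fun t _ => by positivity
  have hlim := (tendsto_besselPrimitive_atTop hα β).congr' (f₂ :=
      Function.update (besselPrimitive α β) 0 c) <| by
    filter_upwards [eventually_ne_atTop 0] with x hx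
    exact (Function.update_of_ne hx _ _).symm
  have hint := integrableOn_Ioi_deriv_of_nonneg hcont hderiv hpos hlim
  have hval := integral_Ioi_of_hasDerivAt_of_nonneg hcont hderiv hpos hlim
  refine ⟨?_, ?_⟩
  · refine (hint.const_mul α⁻¹).congr (ae_of_all _ fun t => ?_)
    exact inv_mul_cancel_left₀ hα.ne' _
  · rw [integral_const_mul, Function.update_self, hc] at hval
    rw [div_mul_eq_mul_div, eq_div_iff hα.ne', mul_comm _ α, hval]
    ring

lemma Gamma_natCast_add {a : ℝ} (ha : 0 < a) (n : ℕ) :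
    Real.Gamma (n + a) = (ascPochhammer ℝ n).eval a * Real.Gamma a := by
  induction n with
  | zero => simp
  | succ n ih =>
    have h : (n : ℝ) + a ≠ 0 := by positivity
    rw [ascPochhammer_succ_eval, Nat.cast_succ, add_right_comm, Real.Gamma_add_one h, ih]
    ring

lemma choose_eq_Gamma_div {a : ℝ} (ha : 0 < a) (n : ℕ) :
    Ring.choose (a + n - 1) n = Real.Gamma (n + a) / (Real.Gamma a * n.factorial) := by
  have hG := (Real.Gamma_pos_of_pos ha).ne'
  have hn : (n.factorial : ℝ) ≠ 0 := by positivity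
  have h := Ring.factorial_nsmul_multichoose_eq_ascPochhammer a n
  rw [Polynomial.ascPochhammer_smeval_eq_eval, nsmul_eq_mul] at h
  rw [← Ring.multichoose_eq, Gamma_natCast_add ha, ← h]
  field_simp

lemma hasSum_Gamma_div_mul_pow {a y : ℝ} (ha : 0 < a) (hy : |y| < 1) :
    HasSum (fun n : ℕ => Real.Gamma (n + a) / (Real.Gamma a * n.factorial) * y ^ n)
      ((1 - y) ^ (-a)) := by
  have h := (Real.one_div_one_sub_rpow_hasFPowerSeriesOnBall_zero a).hasSum (y := y)
    (by simpa [enorm_eq_nnnorm, ← NNReal.coe_lt_coe] using hy)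
  have hy' : 0 ≤ 1 - y := by linarith [(abs_lt.1 hy).2]
  simpa [FormalMultilinearSeries.ofScalars_apply_eq, choose_eq_Gamma_div ha, one_div,
    Real.rpow_neg hy', mul_comm (y ^ _)] using h

lemma hasSum_Gamma_div_mul_linear_mul_pow {a y : ℝ} (ha : 0 < a) (hy : |y| < 1) :
    HasSum (fun n : ℕ => Real.Gamma (n + a) / (Real.Gamma a * n.factorial) * (2 * n + a) * y ^ n)
      (a * (1 + y) * (1 - y) ^ (-(a + 1))) := by
  have hy' : 0 < 1 - y := by linarith [(abs_lt.1 hy).2]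
  have hG := (Real.Gamma_pos_of_pos ha).ne'
  have h0 := (hasSum_Gamma_div_mul_pow ha hy).mul_left a
  have h1 := (hasSum_Gamma_div_mul_pow (add_pos ha one_pos) hy).mul_left (a * y)
  have h2 : HasSum
      (fun n : ℕ => Real.Gamma (n + a) / (Real.Gamma a * n.factorial) * n * y ^ n)
      (a * y * (1 - y) ^ (-(a + 1))) := by
    rw [← hasSum_nat_add_iff' 1]
    simp only [Finset.range_one, Finset.sum_singleton, Nat.cast_zero, mul_zero, zero_mul, sub_zero]
    refine h1.congr_fun fun n => ?_
    have hn : (n.factorial : ℝ) ≠ 0 := by positivity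
    have hn' : (n : ℝ) + 1 ≠ 0 := by positivity
    rw [Real.Gamma_add_one ha.ne', Nat.factorial_succ]
    push_cast
    rw [show (n : ℝ) + 1 + a = n + (a + 1) by ring, pow_succ']
    field_simp
  have e : (1 - y) ^ (-a) = (1 - y) * (1 - y) ^ (-(a + 1)) := by
    rw [← Real.rpow_one_add' hy'.le (by linarith)]
    congr 1
    ring
  have h3 := (h2.mul_left 2).add h0
  rw [show a * (1 + y) * (1 - y) ^ (-(a + 1))
      = 2 * (a * y * (1 - y) ^ (-(a + 1))) + a * (1 - y) ^ (-a) by rw [e]; ring]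
  exact h3.congr_fun fun n => by ring

lemma sinh_mul_cosh_rpow_eq (a x : ℝ) :
    Real.exp (-(a * x)) * (a * (1 + -Real.exp (-(2 * x))) * (1 - -Real.exp (-(2 * x))) ^ (-(a + 1)))
      = 2 ^ (-a) * a * (Real.sinh x * Real.cosh x ^ (-(a + 1))) := by
  have hc : 0 < Real.cosh x := Real.cosh_pos x
  have e2 : 1 - -Real.exp (-(2 * x)) = 2 * (Real.exp (-x) * Real.cosh x) := by
    rw [Real.cosh_eq, show -(2 * x) = -x + -x by ring, Real.exp_add, Real.exp_neg]
    field_simp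
    ring
  have e1 : 1 + -Real.exp (-(2 * x)) = 2 * (Real.exp (-x) * Real.sinh x) := by
    rw [Real.sinh_eq, show -(2 * x) = -x + -x by ring, Real.exp_add, Real.exp_neg]
    field_simp
    ring
  have e3 : Real.exp (-x) ^ (-(a + 1)) = Real.exp (a * x) * Real.exp x := by
    rw [← Real.exp_mul, ← Real.exp_add]
    congr 1
    ring
  have e4 : (2 : ℝ) ^ (-(a + 1)) = 2 ^ (-a) / 2 := by
    rw [neg_add, ← sub_eq_add_neg, Real.rpow_sub_one two_ne_zero]
  rw [e1, e2, Real.mul_rpow zero_le_two (by positivity), Real.mul_rpow (by positivity) hc.le,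
    e3, e4, Real.exp_neg, Real.exp_neg]
  field_simp

/-- The series (16) for the maximum-marginal Q_δ(t,b) has Laplace transform (14):
∫₀^∞ e^{−st} Q_δ(t,b) dt = (2+δ)/√(2s)·sinh(b√(2s))·(cosh(b√(2s)))^{−(2+δ/2)}. -/
theorem stmt_10 (δ : ℝ) (hδ : δ > -2)
    (Q : ℝ → ℝ → ℝ)
    (hQ : ∀ t b : ℝ, 0 < t → 0 < b → Q t b =
      (2 : ℝ) ^ (1 + δ / 2) * Real.sqrt (2 / (π * t)) * ∑' j : ℕ, (-1 : ℝ) ^ j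
        * (Real.Gamma (j + 1 + δ / 2) / (Real.Gamma (1 + δ / 2) * (Nat.factorial j)))
        * (2 * j + 1 + δ / 2)
        * Real.exp (-(b ^ 2 / (2 * t)) * (2 * j + 1 + δ / 2) ^ 2))
    (s b : ℝ) (hs : 0 < s) (hb : 0 < b) :
    (∫ t in Set.Ioi (0 : ℝ), Real.exp (-s * t) * Q t b)
      = (2 + δ) / Real.sqrt (2 * s) * Real.sinh (b * Real.sqrt (2 * s))
          * Real.cosh (b * Real.sqrt (2 * s)) ^ (-(2 + δ / 2)) := by
  have ha : 0 < 1 + δ / 2 := by linarith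
  set a := 1 + δ / 2 with had
  set r := √(2 * s) with hr
  have hr0 : 0 < r := Real.sqrt_pos.2 (by positivity)
  have hx : 0 < b * r := mul_pos hb hr0
  set C : ℕ → ℝ := fun j => Real.Gamma (j + a) / (Real.Gamma a * j.factorial) with hC
  have hC0 : ∀ j, 0 < C j := fun j =>
    div_pos (Real.Gamma_pos_of_pos (by positivity))
      (mul_pos (Real.Gamma_pos_of_pos ha) (by positivity))
  set K : ℝ := 2 ^ a * √(2 / π) with hK
  have hK0 : 0 < K := by positivity
  set c : ℕ → ℝ := fun j => K * ((-1) ^ j * C j * (2 * j + a)) with hcdef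
  set g : ℕ → ℝ → ℝ := fun j t =>
    Real.exp (-(√s ^ 2 * t + (b * (2 * j + a) / √2) ^ 2 / t)) / √t with hg
  have hs' : 0 < √s := Real.sqrt_pos.2 hs
  have hrs : r = √2 * √s := Real.sqrt_mul zero_le_two s
  have h2 : √(2 : ℝ) ^ 2 = 2 := Real.sq_sqrt zero_le_two
  have hint : ∀ j : ℕ, IntegrableOn (g j) (Set.Ioi 0) ∧
      ∫ t in Set.Ioi (0 : ℝ), g j t
        = √π / √s * (Real.exp (-(a * (b * r))) * Real.exp (-(2 * (b * r))) ^ j) := fun j => by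
    obtain ⟨h₁, h₂⟩ := integrableOn_and_integral_exp_div_sqrt hs'
      (β := b * (2 * j + a) / √2) (by positivity)
    refine ⟨h₁, h₂.trans ?_⟩
    rw [← Real.exp_nat_mul, ← Real.exp_add, hrs]
    congr 2
    field_simp
    rw [h2]
    ring
  have hQs : ∀ t ∈ Set.Ioi (0 : ℝ), Real.exp (-s * t) * Q t b = ∑' j, c j * g j t := by
    intro t ht
    have ht' : 0 < t := ht
    have e : √(2 / (π * t)) = √(2 / π) / √t := by
      rw [← div_div, Real.sqrt_div (by positivity)]
    rw [hQ t b ht' hb, e, ← tsum_mul_left, ← tsum_mul_left]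
    refine tsum_congr fun j => ?_
    have e' : Real.exp (-(√s ^ 2 * t + (b * (2 * j + a) / √2) ^ 2 / t))
        = Real.exp (-s * t) * Real.exp (-(b ^ 2 / (2 * t)) * (2 * j + 1 + δ / 2) ^ 2) := by
      rw [← Real.exp_add, Real.sq_sqrt hs.le, div_pow, h2, had]
      congr 1
      field_simp
      ring
    simp only [hg, hcdef, hC, hK]
    rw [e', add_assoc (j : ℝ), add_assoc (2 * (j : ℝ)), ← had]
    ring
  have hexp : Real.exp (-(2 * (b * r))) < 1 := Real.exp_lt_one_iff.2 (by linarith)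
  have hy : |-Real.exp (-(2 * (b * r)))| < 1 := by
    rwa [abs_neg, abs_of_pos (Real.exp_pos _)]
  have hy' : |Real.exp (-(2 * (b * r)))| < 1 := by rwa [abs_of_pos (Real.exp_pos _)]
  set M : ℝ := K * (√π / √s) * Real.exp (-(a * (b * r))) with hM
  have hsum := hasSum_integral_of_summable_integral_norm
    (μ := volume.restrict (Set.Ioi (0 : ℝ))) (F := fun j t => c j * g j t)
    (fun j => (hint j).1.const_mul (c j)) (by
      refine ((hasSum_Gamma_div_mul_linear_mul_pow ha hy').summable.mul_left M).congr fun j => ?_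
      have hn : ∀ t, ‖c j * g j t‖ = |c j| * g j t := fun t => by
        rw [norm_mul, Real.norm_eq_abs, Real.norm_eq_abs,
          abs_of_nonneg (show 0 ≤ g j t by positivity)]
      have hcj : |c j| = K * (C j * (2 * j + a)) := by
        simp only [hcdef, abs_mul, abs_pow, abs_neg, abs_one, one_pow, one_mul]
        rw [abs_of_pos hK0, abs_of_pos (hC0 j), abs_of_pos (by positivity : 0 < 2 * (j : ℝ) + a)]
      simp only [hn]
      rw [integral_const_mul, (hint j).2, hcj]
      ring)
  have hval := (hasSum_Gamma_div_mul_linear_mul_pow ha hy).mul_left M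
  rw [setIntegral_congr_fun measurableSet_Ioi hQs]
  refine (hsum.unique (hval.congr_fun fun j => ?_)).trans ?_
  · rw [integral_const_mul, (hint j).2, neg_pow (Real.exp _)]
    ring
  · rw [hM, mul_assoc (K * _), sinh_mul_cosh_rpow_eq, hK, hrs, Real.rpow_neg zero_le_two,
      Real.sqrt_div zero_le_two, show 2 + δ / 2 = a + 1 by rw [had]; ring,
      show 2 + δ = 2 * a by rw [had]; ring]
    have hπ : 0 < √π := Real.sqrt_pos.2 Real.pi_pos
    field_simp
    rw [h2]
end

section
/- Let δ > -2 and define Q_δ(t,b) := 2^{1+δ/2} · √(2/(πt)) · Σ_{j=0}^{∞} (−1)^j · (Γ(j + 1 + δ/2)/(Γ(1 + δ/2)·j!)) · (2j + 1 + δ/2) · e^{−(b²/(2t))·(2j+1+δ/2)²} for t > 0, b > 0. Then for every t > 0 and every natural number k, the k-th moment of the maximum satisfies ∫₀^∞ b^k · Q_δ(t,b) db = (2+δ) · t^{k/2} · 2^{−(k+2)/2} / Γ(k/2 + 1) · ∫₀^∞ x^k · sinh x · (cosh x)^{−(2+δ/2)} dx. -/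
open Real Filter Topology MeasureTheory

/-- The generalized binomial coefficient `Γ(j + a) / (Γ(a) j!)`. -/
noncomputable def gammaBinom (a : ℝ) (j : ℕ) : ℝ :=
  Real.Gamma (j + a) / (Real.Gamma a * (Nat.factorial j))

lemma gammaBinom_zero {a : ℝ} (ha : 0 < a) : gammaBinom a 0 = 1 := by
  simp [gammaBinom, (Real.Gamma_pos_of_pos ha).ne']

lemma gammaBinom_succ {a : ℝ} (ha : 0 < a) (j : ℕ) :
    gammaBinom a (j + 1) = gammaBinom a j * ((a + j) / (j + 1)) := by
  have h1 : ((j + 1 : ℕ) : ℝ) + a = (j + a) + 1 := by push_cast; ring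
  have h2 : (j : ℝ) + a ≠ 0 := by positivity
  have := (Real.Gamma_pos_of_pos ha).ne'
  rw [gammaBinom, gammaBinom, h1, Real.Gamma_add_one h2, Nat.factorial_succ]
  push_cast
  field_simp
  ring

lemma gammaBinom_nonneg {a : ℝ} (ha : 0 < a) (j : ℕ) : 0 ≤ gammaBinom a j := by
  have := Real.Gamma_pos_of_pos ha
  have := Real.Gamma_pos_of_pos (show (0 : ℝ) < j + a by positivity)
  unfold gammaBinom
  positivity

lemma ringChoose_neg_eq_gammaBinom {a : ℝ} (ha : 0 < a) (j : ℕ) :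
    Ring.choose (-a) j = (-1) ^ j * gammaBinom a j := by
  induction j with
  | zero => simp [gammaBinom_zero ha]
  | succ j ih =>
    have h : Ring.choose (-a) (j + 1) = Ring.choose (-a) j * ((-a - j) / (j + 1)) := by
      simp only [Ring.choose_eq_smul, descPochhammer_succ_right, Polynomial.smeval_mul,
        Nat.factorial_succ, smul_eq_mul]
      simp [Polynomial.smeval_natCast]
      field_simp
    rw [h, ih, gammaBinom_succ ha]
    ring

lemma hasSum_gammaBinom {a : ℝ} (ha : 0 < a) {w : ℂ} (hw : ‖w‖ < 1) :
    HasSum (fun j : ℕ => (((-1) ^ j * gammaBinom a j : ℝ) : ℂ) * w ^ j)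
      ((1 + w) ^ (-(a : ℂ))) := by
  have h := (Complex.one_add_cpow_hasFPowerSeriesOnBall_zero (a := -(a : ℂ))).hasSum
    (y := w) (by simpa [enorm_eq_nnnorm, ← NNReal.coe_lt_coe] using hw)
  simp only [zero_add] at h
  convert! h using 2 with j
  rw [← ringChoose_neg_eq_gammaBinom ha, binomialSeries_apply, Complex.ofReal_choose]
  simp

/-- The weighted coefficient `Γ(j + a) / (Γ(a) j!) * (2 j + a)`. -/
noncomputable def wCoeff (a : ℝ) (j : ℕ) : ℝ := gammaBinom a j * (2 * j + a)

lemma wCoeff_nonneg {a : ℝ} (ha : 0 < a) (j : ℕ) : 0 ≤ wCoeff a j :=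
  mul_nonneg (gammaBinom_nonneg ha j) (by positivity)

lemma gammaBinom_add_one {a : ℝ} (ha : 0 < a) (j : ℕ) :
    a * gammaBinom (a + 1) j = gammaBinom a j * (a + j) := by
  have h2 : (j : ℝ) + a ≠ 0 := by positivity
  have := (Real.Gamma_pos_of_pos ha).ne'
  rw [gammaBinom, gammaBinom, ← add_assoc, Real.Gamma_add_one h2, Real.Gamma_add_one ha.ne']
  field_simp
  ring

lemma wCoeff_succ {a : ℝ} (ha : 0 < a) (j : ℕ) :
    wCoeff a (j + 1) = a * (gammaBinom (a + 1) (j + 1) + gammaBinom (a + 1) j) := by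
  have e := gammaBinom_add_one ha (j + 1)
  have e' := gammaBinom_add_one ha j
  have s := gammaBinom_succ ha j
  have : gammaBinom a (j + 1) * (j + 1) = gammaBinom a j * (a + j) := by rw [s]; field_simp
  rw [wCoeff, mul_add a, e, e', ← this]
  push_cast
  ring

lemma hasSum_wCoeff {a : ℝ} (ha : 0 < a) {w : ℂ} (hw : ‖w‖ < 1) :
    HasSum (fun j : ℕ => (((-1) ^ j * wCoeff a j : ℝ) : ℂ) * w ^ j)
      (a * (1 - w) * (1 + w) ^ (-((a + 1 : ℝ) : ℂ))) := by
  have h := hasSum_gammaBinom (show 0 < a + 1 by positivity) hw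
  set S := (1 + w) ^ (-((a + 1 : ℝ) : ℂ))
  have h1 := ((hasSum_nat_add_iff' 1).2 h).mul_left (a : ℂ)
  have h2 := h.mul_left (-(a * w) : ℂ)
  rw [← hasSum_nat_add_iff' 1]
  convert! h1.add h2 using 1
  · ext j
    rw [wCoeff_succ ha]
    push_cast
    ring
  · simp [wCoeff, gammaBinom_zero ha, gammaBinom_zero (show 0 < a + 1 by positivity)]
    ring

lemma summable_wCoeff {a : ℝ} (ha : 0 < a) {r : ℝ} (h0 : 0 ≤ r) (h1 : r < 1) :
    Summable (fun j : ℕ => wCoeff a j * r ^ j) := by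
  have := (hasSum_wCoeff ha (w := (r : ℂ)) (by simpa [abs_of_nonneg h0])).summable.norm
  refine this.congr fun j => ?_
  simp [abs_of_nonneg h0, abs_of_nonneg (wCoeff_nonneg ha j)]

lemma summable_wCoeff_mul_exp {a : ℝ} (ha : 0 < a) {x : ℝ} (hx : 0 < x) :
    Summable (fun j : ℕ => wCoeff a j * rexp (-(2 * j + a) * x)) := by
  refine ((summable_wCoeff ha (exp_pos (-2 * x)).le
    (by rw [exp_lt_one_iff]; linarith)).mul_right (rexp (-a * x))).congr fun j => ?_
  rw [← Real.exp_nat_mul, mul_assoc, ← Real.exp_add]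
  ring_nf

lemma hasSum_wCoeff_mul_exp {a : ℝ} (ha : 0 < a) {x : ℝ} (hx : 0 < x) :
    HasSum (fun j : ℕ => (-1) ^ j * wCoeff a j * rexp (-(2 * j + a) * x))
      (a * 2 ^ (-a) * (Real.sinh x * Real.cosh x ^ (-(a + 1)))) := by
  have hw : ‖((rexp (-2 * x) : ℝ) : ℂ)‖ < 1 := by
    rw [Complex.norm_real, Real.norm_of_nonneg (exp_pos _).le, exp_lt_one_iff]; linarith
  have h := hasSum_wCoeff ha hw
  have hpos : 0 < 1 + rexp (-2 * x) := by positivity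
  have h' : HasSum (fun j : ℕ => (-1) ^ j * wCoeff a j * rexp (-2 * x) ^ j)
      (a * (1 - rexp (-2 * x)) * (1 + rexp (-2 * x)) ^ (-(a + 1))) := by
    rw [← Complex.hasSum_ofReal]
    convert! h using 1
    · ext j; push_cast; ring
    · rw [Complex.ofReal_mul, Complex.ofReal_cpow hpos.le]; push_cast; ring
  convert! h'.mul_right (rexp (-a * x)) using 1
  · ext j
    rw [← Real.exp_nat_mul, mul_assoc _ (rexp _) (rexp _), ← Real.exp_add]
    ring_nf
  · have hc : Real.cosh x = rexp x / 2 * (1 + rexp (-2 * x)) := by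
      rw [Real.cosh_eq, show -x = x + -2 * x by ring, Real.exp_add]; ring
    have hs : Real.sinh x = rexp x / 2 * (1 - rexp (-2 * x)) := by
      rw [Real.sinh_eq, show -x = x + -2 * x by ring, Real.exp_add]; ring
    rw [hc, hs, Real.mul_rpow (by positivity) hpos.le, Real.div_rpow (by positivity) (by positivity),
      ← Real.exp_mul, show x * -(a + 1) = -a * x - x by ring, Real.exp_sub,
      show -(a + 1) = -a - 1 by ring, Real.rpow_sub_one (by norm_num : (2 : ℝ) ≠ 0)]
    field_simp

lemma rpow_le_mul_exp {p u c : ℝ} (hp : 0 < p) (hc : 0 < c) (hu : 0 ≤ u) :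
    u ^ p ≤ (p / c) ^ p * rexp (c * u) := by
  have h : u ≤ p / c * rexp (c * u / p) := by
    have := Real.add_one_le_exp (c * u / p)
    calc u = p / c * (c * u / p) := by field_simp
      _ ≤ _ := by gcongr; linarith
  calc u ^ p ≤ (p / c * rexp (c * u / p)) ^ p := Real.rpow_le_rpow hu h hp.le
    _ = _ := by
      rw [Real.mul_rpow (by positivity) (by positivity), ← Real.exp_mul, div_mul_cancel₀ _ hp.ne']

lemma exp_mul_norm_one_add_rpow_le {p : ℝ} (hp : 0 < p) {s : ℝ} (hs : 0 < s) (hs1 : s ≤ 1)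
    (y : ℝ) :
    rexp (-(y ^ 2 / (2 * s))) * ‖1 + Complex.exp (-2 * s + 2 * y * Complex.I)‖ ^ (-p)
      ≤ (1 + (p / 32⁻¹) ^ p) * rexp (-(y ^ 2 / (4 * s))) := by
  have hE : rexp (-(y ^ 2 / (2 * s))) = rexp (-(y ^ 2 / (4 * s))) * rexp (-(y ^ 2 / (4 * s))) := by
    rw [← Real.exp_add]; congr 1; field_simp; ring
  set E := rexp (-(y ^ 2 / (4 * s))) with hEdef
  have hE0 : 0 < E := exp_pos _
  have hE1 : E ≤ 1 := by
    rw [hEdef, exp_le_one_iff, neg_nonpos]; positivity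
  set w := Complex.exp (-2 * s + 2 * y * Complex.I)
  suffices E * ‖1 + w‖ ^ (-p) ≤ 1 + (p / 32⁻¹) ^ p by
    rw [hE, mul_assoc, mul_comm]
    gcongr
  rcases le_total |y| (1 / 2) with hy | hy
  · have hre : 0 ≤ w.re := by
      have : w.re = rexp (-2 * s) * Real.cos (2 * y) := by simp [w, Complex.exp_re]
      rw [this]
      refine mul_nonneg (exp_pos _).le (Real.cos_pos_of_le_one ?_).le
      rw [abs_mul, abs_two]; linarith
    have h1 : 1 ≤ ‖1 + w‖ := by
      refine le_trans ?_ (Complex.re_le_norm _)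
      simpa using hre
    have h2 : ‖1 + w‖ ^ (-p) ≤ 1 := Real.rpow_le_one_of_one_le_of_nonpos h1 (by linarith)
    have h3 : 0 ≤ (p / 32⁻¹) ^ p := by positivity
    have h4 := mul_le_mul hE1 h2 (by positivity) zero_le_one
    linarith
  · have hw : ‖w‖ = rexp (-2 * s) := by simp [w, Complex.norm_exp]
    have h0 : s / 2 ≤ 1 - rexp (-2 * s) := by
      have h1 : rexp (-2 * s) ≤ (1 + 2 * s)⁻¹ := by
        rw [show -2 * s = -(2 * s) by ring, Real.exp_neg]
        gcongr
        linarith [Real.add_one_le_exp (2 * s)]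
      have h2 : (1 + 2 * s)⁻¹ ≤ 1 - s / 2 := by
        rw [inv_le_iff_one_le_mul₀ (by positivity)]
        nlinarith
      linarith
    have h1 : s / 2 ≤ ‖1 + w‖ := by
      have := norm_sub_norm_le (1 : ℂ) (-w)
      rw [norm_neg, hw, sub_neg_eq_add, norm_one] at this
      linarith
    have h2 : ‖1 + w‖ ^ (-p) ≤ (2 / s) ^ p := by
      refine (Real.rpow_le_rpow_of_nonpos (by positivity) h1 (by linarith)).trans_eq ?_
      rw [Real.rpow_neg (by positivity), ← Real.inv_rpow (by positivity), inv_div]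
    have h3 : E ≤ rexp (-(32⁻¹ * (2 / s))) := by
      rw [hEdef, Real.exp_le_exp, neg_le_neg_iff]
      have : (1 / 2) ^ 2 ≤ y ^ 2 := by rw [← sq_abs y]; gcongr
      rw [show 32⁻¹ * (2 / s) = (1 / 2) ^ 2 / (4 * s) by field_simp; norm_num]
      gcongr
    have h4 := rpow_le_mul_exp hp (show (0 : ℝ) < 32⁻¹ by norm_num) (show 0 ≤ 2 / s by positivity)
    calc E * ‖1 + w‖ ^ (-p)
        ≤ rexp (-(32⁻¹ * (2 / s))) * ((p / 32⁻¹) ^ p * rexp (32⁻¹ * (2 / s))) := by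
          gcongr; exact h2.trans h4
      _ = (p / 32⁻¹) ^ p := by
          rw [mul_left_comm, ← Real.exp_add]; simp
      _ ≤ _ := by linarith

/-- The alternating theta-like series `∑ (-1)^j Γ(j + a) / (Γ(a) j!) (2 j + a) e^{-s (2 j + a)²/2}`. -/
noncomputable def altSeries (a s : ℝ) : ℝ :=
  ∑' j : ℕ, (-1) ^ j * wCoeff a j * rexp (-(s / 2) * (2 * j + a) ^ 2)

lemma exp_neg_mul_sq_le {a s : ℝ} (ha : 0 < a) (hs : 0 < s) (j : ℕ) :
    rexp (-(s / 2) * (2 * j + a) ^ 2) ≤ rexp (-2 * s) ^ j * rexp (-(s / 2) * a ^ 2) := by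
  rw [← Real.exp_nat_mul, ← Real.exp_add, Real.exp_le_exp]
  have h1 : (j : ℝ) ≤ (j : ℝ) ^ 2 := by exact_mod_cast Nat.le_self_pow two_ne_zero j
  have h2 : 0 ≤ (j : ℝ) * a := by positivity
  nlinarith [mul_nonneg hs.le h2, mul_nonneg hs.le (sub_nonneg.2 h1)]

lemma summable_altSeries {a s : ℝ} (ha : 0 < a) (hs : 0 < s) :
    Summable (fun j : ℕ => (-1) ^ j * wCoeff a j * rexp (-(s / 2) * (2 * j + a) ^ 2)) := by
  refine .of_norm_bounded ((summable_wCoeff ha (exp_pos (-2 * s)).le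
    (by rw [exp_lt_one_iff]; linarith)).mul_right (rexp (-(s / 2) * a ^ 2))) fun j => ?_
  have := wCoeff_nonneg ha j
  rw [norm_mul, norm_mul, norm_pow, norm_neg, norm_one, one_pow, one_mul,
    Real.norm_of_nonneg this, Real.norm_of_nonneg (exp_pos _).le, mul_assoc]
  gcongr
  exact exp_neg_mul_sq_le ha hs j

lemma exists_abs_altSeries_le_of_one_le {a : ℝ} (ha : 0 < a) :
    ∃ K, ∀ s, 1 ≤ s → |altSeries a s| ≤ K * rexp (-(s / 2) * a ^ 2) := by
  refine ⟨∑' j, wCoeff a j * rexp (-2) ^ j, fun s hs => ?_⟩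
  have hs0 : 0 < s := by linarith
  have hsum := summable_wCoeff ha (exp_pos (-2)).le (by rw [exp_lt_one_iff]; linarith)
  rw [← Real.norm_eq_abs]
  refine tsum_of_norm_bounded (hsum.hasSum.mul_right _) fun j => ?_
  have := wCoeff_nonneg ha j
  rw [norm_mul, norm_mul, norm_pow, norm_neg, norm_one, one_pow, one_mul,
    Real.norm_of_nonneg this, Real.norm_of_nonneg (exp_pos _).le, mul_assoc]
  gcongr
  refine (exp_neg_mul_sq_le ha hs0 j).trans ?_
  gcongr
  linarith

/-- Summands of the contour representation of `altSeries`. -/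
noncomputable def contourTerm (a s : ℝ) (j : ℕ) (y : ℝ) : ℂ :=
  (((-1) ^ j * wCoeff a j : ℝ) : ℂ) * Complex.exp ((-(1 / (2 * s) : ℝ) : ℂ) * y ^ 2
    + (Complex.I * (2 * j + a - 1)) * y + (s / 2 - (2 * j + a) * s))

lemma integrable_contourTerm {a s : ℝ} (hs : 0 < s) (j : ℕ) :
    Integrable (contourTerm a s j) := by
  refine (integrable_cexp_quadratic' ?_ _ _).const_mul _
  rw [Complex.neg_re, Complex.ofReal_re, neg_lt_zero]
  positivity

lemma integral_contourTerm {a s : ℝ} (hs : 0 < s) (j : ℕ) :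
    ∫ y, contourTerm a s j y =
      ((√(2 * π * s) * ((-1) ^ j * wCoeff a j * rexp (-(s / 2) * (2 * j + a) ^ 2)) : ℝ) : ℂ) := by
  have hs' : (s : ℂ) ≠ 0 := by exact_mod_cast hs.ne'
  unfold contourTerm
  rw [integral_const_mul, integral_cexp_quadratic]
  · have h1 : (π / - -((1 / (2 * s) : ℝ) : ℂ)) ^ (1 / 2 : ℂ) = ((√(2 * π * s) : ℝ) : ℂ) := by
      rw [Real.sqrt_eq_rpow, Complex.ofReal_cpow (by positivity)]
      congr 1
      · push_cast; field_simp
      · push_cast; rfl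
    rw [h1]
    push_cast
    rw [mul_left_comm]
    congr 3
    rw [mul_pow, Complex.I_sq]
    field_simp
    ring
  · rw [Complex.neg_re, Complex.ofReal_re, neg_lt_zero]
    positivity

lemma norm_contourTerm {a s : ℝ} (ha : 0 < a) (j : ℕ) (y : ℝ) :
    ‖contourTerm a s j y‖ = rexp (s / 2) * (wCoeff a j * rexp (-(2 * j + a) * s))
      * rexp (-(1 / (2 * s)) * y ^ 2) := by
  rw [contourTerm, norm_mul, Complex.norm_real, norm_mul, norm_pow, norm_neg, norm_one, one_pow,
    one_mul, Real.norm_of_nonneg (wCoeff_nonneg ha j), Complex.norm_exp]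
  have : ((-(1 / (2 * s) : ℝ) : ℂ) * y ^ 2
    + (Complex.I * (2 * j + a - 1)) * y + (s / 2 - (2 * j + a) * s)) =
     ((-(1 / (2 * s)) * y ^ 2 + (s / 2 - (2 * j + a) * s) : ℝ) : ℂ)
      + ((2 * j + a - 1) * y : ℝ) * Complex.I := by push_cast; ring
  rw [this, Complex.add_re, Complex.ofReal_re, Complex.re_ofReal_mul, Complex.I_re, mul_zero,
    add_zero, mul_comm (rexp _), mul_assoc, mul_assoc, ← Real.exp_add, ← Real.exp_add]
  congr 2
  ring

lemma hasSum_contourTerm {a s : ℝ} (ha : 0 < a) (hs : 0 < s) (y : ℝ) :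
    HasSum (fun j => contourTerm a s j y)
      (Complex.exp ((-(y ^ 2 / (2 * s)) + (s / 2 - a * s) : ℝ) + ((a - 1) * y : ℝ) * Complex.I) *
        (a * (1 - Complex.exp (-2 * s + 2 * y * Complex.I)) *
          (1 + Complex.exp (-2 * s + 2 * y * Complex.I)) ^ (-((a + 1 : ℝ) : ℂ)))) := by
  have hw : ‖Complex.exp (-2 * s + 2 * y * Complex.I)‖ < 1 := by
    simp [Complex.norm_exp, hs]
  convert! (hasSum_wCoeff ha hw).mul_left _ using 2 with j
  rw [contourTerm, mul_left_comm, ← Complex.exp_nat_mul, ← Complex.exp_add]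
  congr 2
  push_cast
  ring

lemma norm_tsum_contourTerm_le {a s : ℝ} (ha : 0 < a) (hs : 0 < s) (hs1 : s ≤ 1) (y : ℝ) :
    ‖∑' j, contourTerm a s j y‖ ≤
      rexp 1 * (2 * a) * (1 + ((a + 1) / 32⁻¹) ^ (a + 1)) * rexp (-(1 / (4 * s)) * y ^ 2) := by
  have hb := exp_mul_norm_one_add_rpow_le (show 0 < a + 1 by positivity) hs hs1 y
  rw [(hasSum_contourTerm ha hs y).tsum_eq, norm_mul, norm_mul, norm_mul, Complex.norm_exp,
    ← Complex.ofReal_neg, Complex.norm_cpow_real, Complex.norm_real, Real.norm_of_nonneg ha.le,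
    Complex.add_re, Complex.ofReal_re, Complex.re_ofReal_mul, Complex.I_re, mul_zero, add_zero,
    Real.exp_add]
  set w := Complex.exp (-2 * s + 2 * y * Complex.I) with hwdef
  have hw : ‖w‖ ≤ 1 := by
    simp [hwdef, Complex.norm_exp, hs.le]
  have h2 : ‖1 - w‖ ≤ 2 := (norm_sub_le _ _).trans (by rw [norm_one]; linarith)
  have h3 : rexp (s / 2 - a * s) ≤ rexp 1 := by
    rw [Real.exp_le_exp]; nlinarith [mul_pos ha hs]
  rw [show -(1 / (4 * s)) * y ^ 2 = -(y ^ 2 / (4 * s)) by ring]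
  calc _ = rexp (s / 2 - a * s) * (‖1 - w‖ * a) * (rexp (-(y ^ 2 / (2 * s)))
        * ‖1 + w‖ ^ (-(a + 1))) := by ring
    _ ≤ rexp 1 * (2 * a) * ((1 + ((a + 1) / 32⁻¹) ^ (a + 1)) * rexp (-(y ^ 2 / (4 * s)))) := by
        gcongr
    _ = _ := by ring

lemma exists_abs_altSeries_le_of_le_one {a : ℝ} (ha : 0 < a) :
    ∃ K, ∀ s, 0 < s → s ≤ 1 → |altSeries a s| ≤ K := by
  set C := rexp 1 * (2 * a) * (1 + ((a + 1) / 32⁻¹) ^ (a + 1))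
  refine ⟨C * √2, fun s hs hs1 => ?_⟩
  have hpos : 0 < √(2 * π * s) := by positivity
  have hsum : Summable fun j => ∫ y, ‖contourTerm a s j y‖ := by
    simp only [norm_contourTerm ha, integral_const_mul]
    exact ((summable_wCoeff_mul_exp ha hs).mul_left _).mul_right _
  have h := (hasSum_integral_of_summable_integral_norm
    (fun j => integrable_contourTerm (a := a) hs j) hsum).tsum_eq
  simp only [integral_contourTerm hs] at h
  rw [← Complex.ofReal_tsum, tsum_mul_left] at h
  have h1 : √(2 * π * s) * |altSeries a s| = ‖∫ y, ∑' j, contourTerm a s j y‖ := by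
    rw [← h, Complex.norm_real, norm_mul, Real.norm_of_nonneg hpos.le]; rfl
  have h2 : ‖∫ y, ∑' j, contourTerm a s j y‖ ≤ C * √(4 * π * s) := by
    refine (norm_integral_le_of_norm_le ((integrable_exp_neg_mul_sq
      (show 0 < 1 / (4 * s) by positivity)).const_mul C) (.of_forall fun y =>
        norm_tsum_contourTerm_le ha hs hs1 y)).trans_eq ?_
    rw [integral_const_mul, integral_gaussian]
    congr 2
    field_simp
  rw [← h1, show 4 * π * s = 2 * (2 * π * s) by ring, Real.sqrt_mul zero_le_two] at h2
  refine le_of_mul_le_mul_left (h2.trans_eq ?_) hpos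
  ring

lemma exists_abs_altSeries_le {a : ℝ} (ha : 0 < a) :
    ∃ K, ∀ s, 0 < s → |altSeries a s| ≤ K * rexp (-(s / 2) * a ^ 2) := by
  obtain ⟨K₁, h₁⟩ := exists_abs_altSeries_le_of_one_le ha
  obtain ⟨K₂, h₂⟩ := exists_abs_altSeries_le_of_le_one ha
  refine ⟨max K₁ (K₂ * rexp (a ^ 2 / 2)), fun s hs => ?_⟩
  rcases le_total 1 s with h | h
  · refine (h₁ s h).trans ?_
    gcongr
    exact le_max_left _ _
  · have hK : 0 ≤ K₂ := (abs_nonneg _).trans (h₂ s hs h)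
    calc |altSeries a s| ≤ K₂ * 1 := by simpa using h₂ s hs h
      _ ≤ K₂ * (rexp (a ^ 2 / 2) * rexp (-(s / 2) * a ^ 2)) := by
        gcongr
        rw [← Real.exp_add, Real.one_le_exp_iff]
        nlinarith [sq_nonneg a]
      _ = K₂ * rexp (a ^ 2 / 2) * rexp (-(s / 2) * a ^ 2) := by ring
      _ ≤ _ := by gcongr; exact le_max_right _ _

section CauchySchlomilch

variable {A B : ℝ}

lemma image_mul_sub_div_Ioi (hA : 0 < A) (hB : 0 < B) :
    (fun b : ℝ => B * b - A / b) '' Set.Ioi 0 = Set.univ := by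
  refine Set.eq_univ_of_forall fun u => ?_
  have hlt : |u| < √(u ^ 2 + 4 * A * B) := by
    rw [← Real.sqrt_sq_eq_abs]
    exact Real.sqrt_lt_sqrt (sq_nonneg u) (by linarith [mul_pos hA hB])
  have hsq : √(u ^ 2 + 4 * A * B) ^ 2 = u ^ 2 + 4 * A * B := Real.sq_sqrt (by positivity)
  set r := √(u ^ 2 + 4 * A * B)
  have hpos : 0 < u + r := by linarith [neg_abs_le u]
  refine ⟨(u + r) / (2 * B), div_pos hpos (by positivity), ?_⟩
  field_simp
  linear_combination hsq

lemma hasDerivAt_mul_sub_div {b : ℝ} (hb : 0 < b) :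
    HasDerivAt (fun b : ℝ => B * b - A / b) (B + A / b ^ 2) b := by
  convert! ((hasDerivAt_id b).const_mul B).sub ((hasDerivAt_inv hb.ne').const_mul A) using 1
  field_simp
  ring

lemma injOn_mul_sub_div (hA : 0 < A) (hB : 0 < B) :
    Set.InjOn (fun b : ℝ => B * b - A / b) (Set.Ioi 0) := by
  refine StrictMonoOn.injOn fun x hx y _ hxy => ?_
  have hx' : 0 < x := hx
  exact sub_lt_sub (by gcongr) (by gcongr)

lemma integrableOn_add_div_sq_mul_exp (hA : 0 < A) (hB : 0 < B) :
    IntegrableOn (fun b : ℝ => (B + A / b ^ 2) * rexp (-(B * b - A / b) ^ 2)) (Set.Ioi 0) := by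
  have h := (integrableOn_image_iff_integrableOn_abs_deriv_smul measurableSet_Ioi
    (fun b hb => (hasDerivAt_mul_sub_div (A := A) (B := B) hb).hasDerivWithinAt)
    (injOn_mul_sub_div hA hB) (fun u => rexp (-u ^ 2))).1 (by
      rw [image_mul_sub_div_Ioi hA hB, integrableOn_univ]
      simpa using integrable_exp_neg_mul_sq (b := 1) one_pos)
  refine h.congr_fun (fun b hb => ?_) measurableSet_Ioi
  have hb' : 0 < b := hb
  simp only [smul_eq_mul]
  rw [abs_of_pos (by positivity)]

lemma integral_add_div_sq_mul_exp (hA : 0 < A) (hB : 0 < B) :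
    ∫ b in Set.Ioi (0 : ℝ), (B + A / b ^ 2) * rexp (-(B * b - A / b) ^ 2) = √π := by
  have h := integral_image_eq_integral_abs_deriv_smul measurableSet_Ioi
    (fun b hb => (hasDerivAt_mul_sub_div (A := A) (B := B) hb).hasDerivWithinAt)
    (injOn_mul_sub_div hA hB) (fun u => rexp (-u ^ 2))
  rw [image_mul_sub_div_Ioi hA hB, setIntegral_univ] at h
  have hg := integral_gaussian 1
  simp only [neg_mul, one_mul, div_one] at hg
  rw [← hg, h]
  refine setIntegral_congr_fun measurableSet_Ioi fun b hb => ?_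
  have hb' : 0 < b := hb
  rw [smul_eq_mul, abs_of_pos (by positivity)]

lemma integral_const_mul_exp_eq_integral_div_sq_mul_exp (hA : 0 < A) (hB : 0 < B) :
    ∫ b in Set.Ioi (0 : ℝ), B * rexp (-(B * b - A / b) ^ 2) =
      ∫ b in Set.Ioi (0 : ℝ), A / b ^ 2 * rexp (-(B * b - A / b) ^ 2) := by
  have himg : (fun b : ℝ => A / B * b⁻¹) '' Set.Ioi 0 = Set.Ioi 0 := by
    ext u
    constructor
    · rintro ⟨b, hb, rfl⟩
      have hb' : 0 < b := hb
      exact (by positivity : 0 < A / B * b⁻¹)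
    · intro hu
      have hu' : 0 < u := hu
      exact ⟨A / B * u⁻¹, (by positivity : 0 < A / B * u⁻¹), by field_simp⟩
  have h := integral_image_eq_integral_abs_deriv_smul measurableSet_Ioi
    (fun b (hb : b ∈ Set.Ioi (0 : ℝ)) =>
      ((hasDerivAt_inv (ne_of_gt hb)).const_mul (A / B)).hasDerivWithinAt)
    (fun x _ y _ hxy => by
      have : A / B ≠ 0 := by positivity
      simpa [this] using hxy) (fun b => B * rexp (-(B * b - A / b) ^ 2))
  rw [himg] at h
  rw [h]
  refine setIntegral_congr_fun measurableSet_Ioi fun b hb => ?_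
  have hb' : 0 < b := hb
  have e : B * (A / B * b⁻¹) - A / (A / B * b⁻¹) = -(B * b - A / b) := by field_simp; ring
  simp only [smul_eq_mul]
  rw [e, neg_sq, mul_neg, abs_neg, abs_of_pos (by positivity)]
  field_simp

lemma integrableOn_inv_sq_mul_exp (hA : 0 < A) (hB : 0 < B) :
    IntegrableOn (fun b : ℝ => (b ^ 2)⁻¹ * rexp (-(A ^ 2 / b ^ 2) - B ^ 2 * b ^ 2))
      (Set.Ioi 0) := by
  refine ((integrableOn_add_div_sq_mul_exp hA hB).const_mul (A⁻¹ * rexp (-(2 * A * B)))).mono'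
    (by fun_prop) ?_
  refine (ae_restrict_iff' measurableSet_Ioi).2 (.of_forall fun b hb => ?_)
  have hb' : 0 < b := hb
  have e : -(A ^ 2 / b ^ 2) - B ^ 2 * b ^ 2 = -(2 * A * B) + -(B * b - A / b) ^ 2 := by
    field_simp; ring
  rw [Real.norm_of_nonneg (by positivity), e, Real.exp_add]
  have h : (b ^ 2)⁻¹ ≤ A⁻¹ * (B + A / b ^ 2) := by
    have : A⁻¹ * (B + A / b ^ 2) = A⁻¹ * B + (b ^ 2)⁻¹ := by field_simp
    rw [this]
    have : 0 < A⁻¹ * B := by positivity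
    linarith
  calc _ ≤ A⁻¹ * (B + A / b ^ 2) * (rexp (-(2 * A * B)) * rexp (-(B * b - A / b) ^ 2)) := by gcongr
    _ = _ := by ring

lemma integral_inv_sq_mul_exp (hA : 0 < A) (hB : 0 < B) :
    ∫ b in Set.Ioi (0 : ℝ), (b ^ 2)⁻¹ * rexp (-(A ^ 2 / b ^ 2) - B ^ 2 * b ^ 2) =
      √π / (2 * A) * rexp (-(2 * A * B)) := by
  have e : ∀ b ∈ Set.Ioi (0 : ℝ), A / b ^ 2 * rexp (-(B * b - A / b) ^ 2) =
      A * rexp (2 * A * B) * ((b ^ 2)⁻¹ * rexp (-(A ^ 2 / b ^ 2) - B ^ 2 * b ^ 2)) := by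
    intro b hb
    have hb' : 0 < b := hb
    have : -(B * b - A / b) ^ 2 = 2 * A * B + (-(A ^ 2 / b ^ 2) - B ^ 2 * b ^ 2) := by
      field_simp; ring
    rw [this, Real.exp_add]
    ring
  have hi : IntegrableOn (fun b : ℝ => A / b ^ 2 * rexp (-(B * b - A / b) ^ 2)) (Set.Ioi 0) :=
    IntegrableOn.congr_fun ((integrableOn_inv_sq_mul_exp hA hB).const_mul _) (fun b hb => (e b hb).symm)
      measurableSet_Ioi
  have hi' : IntegrableOn (fun b : ℝ => B * rexp (-(B * b - A / b) ^ 2)) (Set.Ioi 0) := by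
    refine IntegrableOn.congr_fun ((integrableOn_add_div_sq_mul_exp hA hB).sub hi) (fun b _ => ?_)
      measurableSet_Ioi
    simp only [Pi.sub_apply]
    ring
  have h := integral_add_div_sq_mul_exp hA hB
  simp only [add_mul] at h
  rw [integral_add hi' hi, integral_const_mul_exp_eq_integral_div_sq_mul_exp hA hB,
    setIntegral_congr_fun measurableSet_Ioi e, integral_const_mul] at h
  rw [← h, Real.exp_neg]
  generalize ∫ b in Set.Ioi (0 : ℝ), (b ^ 2)⁻¹ * rexp (-(A ^ 2 / b ^ 2) - B ^ 2 * b ^ 2) = J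
  field_simp
  ring

end CauchySchlomilch

lemma heatKernel_eq {t : ℝ} (ht : 0 < t) (c x b : ℝ) :
    rexp (-(b ^ 2 / t / 2) * c ^ 2) * (x * t / b ^ 2 * rexp (-(x ^ 2 * t / (2 * b ^ 2)))) =
      x * t * ((b ^ 2)⁻¹ * rexp (-((x * √(t / 2)) ^ 2 / b ^ 2) - (c / √(2 * t)) ^ 2 * b ^ 2)) := by
  rw [mul_pow, div_pow, Real.sq_sqrt (by positivity), Real.sq_sqrt (by positivity), sub_eq_add_neg,
    Real.exp_add]
  ring_nf

lemma integrableOn_heatKernel {t c x : ℝ} (ht : 0 < t) (hc : 0 < c) (hx : 0 < x) :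
    IntegrableOn (fun b : ℝ => rexp (-(b ^ 2 / t / 2) * c ^ 2) *
      (x * t / b ^ 2 * rexp (-(x ^ 2 * t / (2 * b ^ 2))))) (Set.Ioi 0) := by
  simp only [heatKernel_eq ht]
  exact (integrableOn_inv_sq_mul_exp (by positivity) (by positivity)).const_mul _

lemma integral_heatKernel {t c x : ℝ} (ht : 0 < t) (hc : 0 < c) (hx : 0 < x) :
    ∫ b in Set.Ioi (0 : ℝ), rexp (-(b ^ 2 / t / 2) * c ^ 2) *
      (x * t / b ^ 2 * rexp (-(x ^ 2 * t / (2 * b ^ 2)))) = √(π * t / 2) * rexp (-c * x) := by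
  simp only [heatKernel_eq ht]
  rw [integral_const_mul, integral_inv_sq_mul_exp (by positivity) (by positivity),
    show 2 * t = 2 * 2 * (t / 2) by ring, Real.sqrt_mul (by norm_num), Real.sqrt_mul_self zero_le_two,
    mul_div_assoc, Real.sqrt_mul pi_pos.le]
  have h : √(t / 2) ^ 2 = t / 2 := Real.sq_sqrt (by positivity)
  have h0 : 0 < √(t / 2) := by positivity
  set r := √(t / 2)
  have e : -(2 * (x * r) * (c / (2 * r))) = -c * x := by field_simp
  rw [e, show t = 2 * r ^ 2 by linarith]
  field_simp

lemma integral_altSeries_mul_heatKernel {a t x : ℝ} (ha : 0 < a) (ht : 0 < t) (hx : 0 < x) :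
    ∫ b in Set.Ioi (0 : ℝ), altSeries a (b ^ 2 / t) *
      (x * t / b ^ 2 * rexp (-(x ^ 2 * t / (2 * b ^ 2)))) =
      √(π * t / 2) * (a * 2 ^ (-a) * (Real.sinh x * Real.cosh x ^ (-(a + 1)))) := by
  set F : ℕ → ℝ → ℝ := fun j b => (-1) ^ j * wCoeff a j *
    (rexp (-(b ^ 2 / t / 2) * (2 * j + a) ^ 2) *
      (x * t / b ^ 2 * rexp (-(x ^ 2 * t / (2 * b ^ 2))))) with hF
  have hc : ∀ j : ℕ, 0 < 2 * (j : ℝ) + a := fun j => by positivity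
  have hint : ∀ j, Integrable (F j) (volume.restrict (Set.Ioi 0)) := fun j =>
    (integrableOn_heatKernel ht (hc j) hx).const_mul _
  have hnorm : ∀ j, ∫ b in Set.Ioi (0 : ℝ), ‖F j b‖ =
      √(π * t / 2) * (wCoeff a j * rexp (-(2 * j + a) * x)) := fun j => by
    have : ∀ b, ‖F j b‖ = wCoeff a j * (rexp (-(b ^ 2 / t / 2) * (2 * j + a) ^ 2) *
      (x * t / b ^ 2 * rexp (-(x ^ 2 * t / (2 * b ^ 2))))) := fun b => by
      simp only [hF]
      rw [norm_mul, norm_mul, norm_pow, norm_neg, norm_one, one_pow, one_mul,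
        Real.norm_of_nonneg (wCoeff_nonneg ha j), Real.norm_of_nonneg (by positivity)]
    simp only [this]
    rw [integral_const_mul, integral_heatKernel ht (hc j) hx]
    ring
  have h := hasSum_integral_of_summable_integral_norm hint (by
    simp only [hnorm]
    exact (summable_wCoeff_mul_exp ha hx).mul_left _)
  have h' : HasSum (fun j => ∫ b in Set.Ioi (0 : ℝ), F j b)
      (√(π * t / 2) * (a * 2 ^ (-a) * (Real.sinh x * Real.cosh x ^ (-(a + 1))))) := by
    convert! (hasSum_wCoeff_mul_exp ha hx).mul_left (√(π * t / 2)) using 2 with j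
    simp only [hF]
    rw [integral_const_mul, integral_heatKernel ht (hc j) hx]
    ring
  rw [← h.unique h']
  refine setIntegral_congr_fun measurableSet_Ioi fun b _ => ?_
  simp only [altSeries, ← tsum_mul_right, hF]
  congr 1 with j
  ring

lemma aestronglyMeasurable_altSeries {a t : ℝ} (ha : 0 < a) (ht : 0 < t) :
    AEStronglyMeasurable (fun b : ℝ => altSeries a (b ^ 2 / t)) (volume.restrict (Set.Ioi 0)) := by
  refine aestronglyMeasurable_of_tendsto_ae atTop (f := fun n b => ∑ j ∈ Finset.range n,
    (-1) ^ j * wCoeff a j * rexp (-(b ^ 2 / t / 2) * (2 * j + a) ^ 2)) (fun n => ?_) ?_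
  · exact (Continuous.aestronglyMeasurable (by fun_prop))
  · refine (ae_restrict_iff' measurableSet_Ioi).2 (.of_forall fun b hb => ?_)
    have hb' : 0 < b := hb
    exact (summable_altSeries ha (by positivity)).hasSum.tendsto_sum_nat

lemma integrableOn_pow_mul_altSeries {a t : ℝ} (ha : 0 < a) (ht : 0 < t) (k : ℕ) :
    IntegrableOn (fun b : ℝ => b ^ k * altSeries a (b ^ 2 / t)) (Set.Ioi 0) := by
  obtain ⟨K, hK⟩ := exists_abs_altSeries_le ha
  have hg := ((integrable_rpow_mul_exp_neg_mul_sq (b := a ^ 2 / (2 * t)) (by positivity)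
    (s := k) (by linarith [(Nat.cast_nonneg k : (0 : ℝ) ≤ k)])).const_mul K).integrableOn
      (s := Set.Ioi 0)
  refine hg.mono' ((by fun_prop : AEStronglyMeasurable _ _).mul
    (aestronglyMeasurable_altSeries ha ht)) ?_
  refine (ae_restrict_iff' measurableSet_Ioi).2 (.of_forall fun b hb => ?_)
  have hb' : 0 < b := hb
  rw [norm_mul, Real.norm_of_nonneg (by positivity), Real.norm_eq_abs, Real.rpow_natCast,
    mul_left_comm]
  gcongr
  rw [show -(a ^ 2 / (2 * t)) * b ^ 2 = -(b ^ 2 / t / 2) * a ^ 2 by field_simp]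
  exact hK (b ^ 2 / t) (by positivity)

section RayleighMoment

variable {t b : ℝ}

lemma pow_mul_rayleigh_eq (k : ℕ) {x : ℝ} (hx : 0 < x) :
    x ^ k * (x * t / b ^ 2 * rexp (-(x ^ 2 * t / (2 * b ^ 2)))) =
      t / b ^ 2 * (x ^ ((k : ℝ) + 1) * rexp (-(t / (2 * b ^ 2)) * x ^ (2 : ℝ))) := by
  rw [Real.rpow_add_one hx.ne', Real.rpow_natCast, Real.rpow_two]
  ring_nf

lemma integrableOn_pow_mul_rayleigh (ht : 0 < t) (hb : 0 < b) (k : ℕ) :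
    IntegrableOn (fun x : ℝ => x ^ k * (x * t / b ^ 2 * rexp (-(x ^ 2 * t / (2 * b ^ 2)))))
      (Set.Ioi 0) :=
  IntegrableOn.congr_fun ((integrableOn_rpow_mul_exp_neg_mul_rpow (s := k + 1) (p := 2)
    (b := t / (2 * b ^ 2)) (by linarith [(Nat.cast_nonneg k : (0 : ℝ) ≤ k)]) (by norm_num)
    (by positivity)).const_mul (t / b ^ 2)) (fun _ hx => (pow_mul_rayleigh_eq k hx).symm)
    measurableSet_Ioi

lemma integral_pow_mul_rayleigh (ht : 0 < t) (hb : 0 < b) (k : ℕ) :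
    ∫ x in Set.Ioi (0 : ℝ), x ^ k * (x * t / b ^ 2 * rexp (-(x ^ 2 * t / (2 * b ^ 2)))) =
      (2 / t) ^ ((k : ℝ) / 2) * Real.Gamma ((k : ℝ) / 2 + 1) * b ^ k := by
  rw [setIntegral_congr_fun measurableSet_Ioi fun x hx => pow_mul_rayleigh_eq k hx,
    integral_const_mul, integral_rpow_mul_exp_neg_mul_rpow (by norm_num)
    (by linarith [(Nat.cast_nonneg k : (0 : ℝ) ≤ k)]) (by positivity)]
  have e : -((k : ℝ) + 1 + 1) / 2 = -((k : ℝ) / 2) - 1 := by ring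
  have hbk : (b ^ 2) ^ ((k : ℝ) / 2) = b ^ k := by
    rw [← Real.rpow_two, ← Real.rpow_mul hb.le, ← Real.rpow_natCast]
    congr 1; ring
  rw [e, Real.rpow_sub_one (by positivity), Real.rpow_neg (by positivity),
    ← Real.inv_rpow (by positivity), show (t / (2 * b ^ 2))⁻¹ = 2 / t * b ^ 2 by field_simp,
    Real.mul_rpow (by positivity) (by positivity), hbk,
    show ((k : ℝ) + 1 + 1) / 2 = (k : ℝ) / 2 + 1 by ring]
  field_simp

end RayleighMoment

lemma integral_pow_mul_altSeries {a t : ℝ} (ha : 0 < a) (ht : 0 < t) (k : ℕ) :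
    (2 / t) ^ ((k : ℝ) / 2) * Real.Gamma ((k : ℝ) / 2 + 1) *
        ∫ b in Set.Ioi (0 : ℝ), b ^ k * altSeries a (b ^ 2 / t) =
      √(π * t / 2) * (a * 2 ^ (-a)) *
        ∫ x in Set.Ioi (0 : ℝ), x ^ k * Real.sinh x * Real.cosh x ^ (-(a + 1)) := by
  set G : ℝ → ℝ → ℝ := fun b x => altSeries a (b ^ 2 / t) *
    (x ^ k * (x * t / b ^ 2 * rexp (-(x ^ 2 * t / (2 * b ^ 2))))) with hG
  set M := (2 / t) ^ ((k : ℝ) / 2) * Real.Gamma ((k : ℝ) / 2 + 1)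
  have hint : Integrable (Function.uncurry G)
      ((volume.restrict (Set.Ioi 0)).prod (volume.restrict (Set.Ioi 0))) := by
    have hmeas : AEStronglyMeasurable (Function.uncurry G)
        ((volume.restrict (Set.Ioi 0)).prod (volume.restrict (Set.Ioi 0))) := by
      refine (aestronglyMeasurable_altSeries ha ht).comp_fst.mul ?_
      exact Measurable.aestronglyMeasurable (by fun_prop)
    refine (integrable_prod_iff hmeas).2 ⟨?_, ?_⟩
    · refine (ae_restrict_iff' measurableSet_Ioi).2 (.of_forall fun b hb => ?_)
      exact (integrableOn_pow_mul_rayleigh ht hb k).const_mul (altSeries a (b ^ 2 / t))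
    · refine IntegrableOn.congr_fun ((integrableOn_pow_mul_altSeries ha ht k).norm.const_mul M)
        (fun b hb => ?_) measurableSet_Ioi
      have hb' : 0 < b := hb
      have : ∀ x ∈ Set.Ioi (0 : ℝ), ‖Function.uncurry G (b, x)‖ = |altSeries a (b ^ 2 / t)| *
          (x ^ k * (x * t / b ^ 2 * rexp (-(x ^ 2 * t / (2 * b ^ 2))))) := fun x hx => by
        have hx' : 0 < x := hx
        simp only [Function.uncurry_apply_pair, hG]
        rw [norm_mul, Real.norm_eq_abs, Real.norm_of_nonneg (by positivity)]
      rw [setIntegral_congr_fun measurableSet_Ioi this, integral_const_mul,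
        integral_pow_mul_rayleigh ht hb', norm_mul, Real.norm_of_nonneg (by positivity),
        Real.norm_eq_abs]
      ring
  have hswap := integral_integral_swap hint
  rw [← integral_const_mul, ← integral_const_mul]
  convert! hswap using 1
  · refine setIntegral_congr_fun measurableSet_Ioi fun b hb => ?_
    simp only [hG]
    rw [integral_const_mul, integral_pow_mul_rayleigh ht hb]
    ring
  · refine setIntegral_congr_fun measurableSet_Ioi fun x hx => ?_
    simp only [hG, mul_left_comm _ (x ^ k)]
    rw [integral_const_mul, integral_altSeries_mul_heatKernel ha ht hx]
    ring

/-- Moments of the maximum: ∫₀^∞ b^k Q_δ(t,b) db =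
(2+δ)·t^{k/2}·2^{−(k+2)/2}/Γ(k/2+1) · ∫₀^∞ x^k sinh x (cosh x)^{−(2+δ/2)} dx. -/
theorem stmt_11 (δ : ℝ) (hδ : δ > -2)
    (Q : ℝ → ℝ → ℝ)
    (hQ : ∀ t b : ℝ, 0 < t → 0 < b → Q t b =
      (2 : ℝ) ^ (1 + δ / 2) * Real.sqrt (2 / (π * t)) * ∑' j : ℕ, (-1 : ℝ) ^ j
        * (Real.Gamma (j + 1 + δ / 2) / (Real.Gamma (1 + δ / 2) * (Nat.factorial j)))
        * (2 * j + 1 + δ / 2)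
        * Real.exp (-(b ^ 2 / (2 * t)) * (2 * j + 1 + δ / 2) ^ 2))
    (t : ℝ) (ht : 0 < t) (k : ℕ) :
    (∫ b in Set.Ioi (0 : ℝ), b ^ k * Q t b)
      = (2 + δ) * t ^ ((k : ℝ) / 2) * (2 : ℝ) ^ (-((k : ℝ) + 2) / 2)
          / Real.Gamma ((k : ℝ) / 2 + 1)
          * ∫ x in Set.Ioi (0 : ℝ), x ^ k * Real.sinh x * Real.cosh x ^ (-(2 + δ / 2)) := by

  set a : ℝ := 1 + δ / 2 with ha_def
  have ha : 0 < a := by linarith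
  have hQ' : ∀ b ∈ Set.Ioi (0 : ℝ), b ^ k * Q t b =
      (2 : ℝ) ^ a * √(2 / (π * t)) * (b ^ k * altSeries a (b ^ 2 / t)) := by
    intro b hb
    rw [hQ t b ht hb, mul_left_comm]
    congr 2
    unfold altSeries
    refine tsum_congr fun j => ?_
    rw [wCoeff, gammaBinom]
    simp only [add_assoc, ← ha_def]
    ring_nf
  have hM : 0 < Real.Gamma ((k : ℝ) / 2 + 1) := Real.Gamma_pos_of_pos (by positivity)
  have h := integral_pow_mul_altSeries ha ht k
  rw [setIntegral_congr_fun measurableSet_Ioi hQ', integral_const_mul,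
    show 2 + δ / 2 = a + 1 by rw [ha_def]; ring, show 2 + δ = 2 * a by rw [ha_def]; ring,
    show -((k : ℝ) + 2) / 2 = -((k : ℝ) / 2) - 1 by ring, Real.rpow_sub_one two_ne_zero,
    Real.rpow_neg zero_le_two]
  rw [Real.div_rpow zero_le_two ht.le, Real.rpow_neg zero_le_two] at h
  have hs : √(2 / (π * t)) * √(π * t / 2) = 1 := by
    rw [← Real.sqrt_mul (by positivity), ← Real.sqrt_one]
    congr 1
    field_simp
  have h2a : (0 : ℝ) < 2 ^ a := by positivity
  have h2k : (0 : ℝ) < 2 ^ ((k : ℝ) / 2) := by positivity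
  have htk : (0 : ℝ) < t ^ ((k : ℝ) / 2) := by positivity
  generalize (∫ b in Set.Ioi (0 : ℝ), b ^ k * altSeries a (b ^ 2 / t)) = I at *
  generalize (∫ x in Set.Ioi (0 : ℝ), x ^ k * Real.sinh x * Real.cosh x ^ (-(a + 1))) = J at *
  generalize Real.Gamma ((k : ℝ) / 2 + 1) = g at *
  generalize (2 : ℝ) ^ a = p at *
  generalize (2 : ℝ) ^ ((k : ℝ) / 2) = q at *
  generalize t ^ ((k : ℝ) / 2) = r at *
  generalize √(2 / (π * t)) = u at *
  generalize √(π * t / 2) = v at *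
  field_simp at h ⊢
  linear_combination u * h + r * a * J * hs
end

section
/- Fix a natural number k. Then, as the integer m tends to infinity, (2m+1)^{k/2} · (2 + 4m) · 2^{−(k+2)/2} / Γ(k/2 + 1) · ∫₀^∞ x^k · sinh x · (cosh x)^{−(2+2m)} dx tends to 1. (Equivalently: with δ = 4m, the k-th moment of the maximum of the reinforced Brownian motion satisfies E(b^k) ~ t^{k/2}/(2m+1)^{k/2} as m → ∞.) -/
open Real Filter Topology MeasureTheory

theorem one_add_sq_half_le_cosh {x : ℝ} (hx : 0 ≤ x) : 1 + x ^ 2 / 2 ≤ Real.cosh x := by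
  have h : x / 2 ≤ Real.sinh (x / 2) := Real.self_le_sinh_iff.2 (by positivity)
  have h2 : Real.cosh x = Real.cosh (x / 2) ^ 2 + Real.sinh (x / 2) ^ 2 := by
    rw [← Real.cosh_two_mul]; ring_nf
  rw [h2, Real.cosh_sq']
  nlinarith

theorem sinh_le_self_mul_cosh {x : ℝ} (hx : 0 ≤ x) : Real.sinh x ≤ x * Real.cosh x := by
  have hd : ∀ y : ℝ, HasDerivAt (fun y => y * Real.cosh y - Real.sinh y) (y * Real.sinh y) y := by
    intro y
    refine (((hasDerivAt_id y).mul (Real.hasDerivAt_cosh y)).sub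
      (Real.hasDerivAt_sinh y)).congr_deriv ?_
    simp
  have hm : MonotoneOn (fun y => y * Real.cosh y - Real.sinh y) (Set.Ici (0 : ℝ)) := by
    refine monotoneOn_of_deriv_nonneg (convex_Ici 0) (by fun_prop) (by fun_prop) ?_
    intro y hy
    rw [interior_Ici] at hy
    rw [(hd y).deriv]
    exact mul_nonneg (le_of_lt hy) (Real.sinh_nonneg_iff.2 (le_of_lt hy))
  have := hm Set.self_mem_Ici (Set.mem_Ici.2 hx) hx
  simp only [Real.sinh_zero, zero_mul, sub_zero] at this
  linarith

theorem one_add_div_pow_le_one_add_div_pow {a : ℝ} (ha : 0 ≤ a) {N n : ℕ} (hN : 0 < N)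
    (hn : N ≤ n) : (1 + a / N) ^ N ≤ (1 + a / n) ^ n := by
  have hN' : (0 : ℝ) < N := by exact_mod_cast hN
  have hn' : (0 : ℝ) < n := by exact_mod_cast hN.trans_le hn
  have h := one_add_mul_self_le_rpow_one_add (s := a / n) (p := (n : ℝ) / N)
    (by linarith [div_nonneg ha hn'.le]) ((one_le_div hN').2 (by exact_mod_cast hn))
  rw [show (n : ℝ) / N * (a / n) = a / N by field_simp] at h
  calc (1 + a / N) ^ N ≤ ((1 + a / n) ^ ((n : ℝ) / N)) ^ N := by gcongr
    _ = (1 + a / n) ^ n := by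
      rw [← Real.rpow_natCast, ← Real.rpow_mul (by positivity), div_mul_cancel₀ _ hN'.ne',
        Real.rpow_natCast]

theorem one_add_div_le_cosh_div_sqrt {y : ℝ} (hy : 0 ≤ y) (n : ℕ) :
    1 + y ^ 2 / 2 / n ≤ Real.cosh (y / √n) := by
  refine le_trans (le_of_eq ?_) (one_add_sq_half_le_cosh (by positivity))
  rw [div_pow, Real.sq_sqrt (by positivity)]
  ring

theorem tendsto_cosh_div_sqrt_pow {y : ℝ} (hy : 0 ≤ y) :
    Tendsto (fun n : ℕ => Real.cosh (y / √n) ^ n) atTop (𝓝 (Real.exp (y ^ 2 / 2))) := by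
  refine tendsto_of_tendsto_of_tendsto_of_le_of_le' (Real.tendsto_one_add_div_pow_exp (y ^ 2 / 2))
    tendsto_const_nhds (Eventually.of_forall fun n => ?_) ?_
  · exact pow_le_pow_left₀ (by positivity) (one_add_div_le_cosh_div_sqrt hy n) n
  · filter_upwards [eventually_gt_atTop 0] with n hn
    have hn' : (0 : ℝ) < n := by exact_mod_cast hn
    calc Real.cosh (y / √n) ^ n ≤ Real.exp ((y / √n) ^ 2 / 2) ^ n :=
          pow_le_pow_left₀ (Real.cosh_pos _).le (Real.cosh_le_exp_half_sq _) n
      _ = Real.exp (y ^ 2 / 2) := by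
        rw [← Real.exp_nat_mul, div_pow, Real.sq_sqrt hn'.le]
        congr 1
        field_simp

theorem tendsto_cosh_div_sqrt (y : ℝ) :
    Tendsto (fun n : ℕ => Real.cosh (y / √n)) atTop (𝓝 1) := by
  have h : Tendsto (fun n : ℕ => y / √n) atTop (𝓝 0) :=
    tendsto_const_nhds.div_atTop (Real.tendsto_sqrt_atTop.comp tendsto_natCast_atTop_atTop)
  simpa [Function.comp_def] using (Real.continuous_cosh.tendsto 0).comp h

theorem sqrt_mul_sinh_div_sqrt_le {y : ℝ} (hy : 0 ≤ y) {n : ℕ} (hn : 0 < n) :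
    √n * Real.sinh (y / √n) ≤ y * Real.cosh (y / √n) := by
  have hs : (0 : ℝ) < √n := Real.sqrt_pos.2 (by exact_mod_cast hn)
  calc √n * Real.sinh (y / √n) ≤ √n * (y / √n * Real.cosh (y / √n)) := by
        gcongr
        exact sinh_le_self_mul_cosh (by positivity)
    _ = y * Real.cosh (y / √n) := by field_simp

theorem tendsto_sqrt_mul_sinh_div_sqrt {y : ℝ} (hy : 0 ≤ y) :
    Tendsto (fun n : ℕ => √n * Real.sinh (y / √n)) atTop (𝓝 y) := by
  have hc : Tendsto (fun n : ℕ => y * Real.cosh (y / √n)) atTop (𝓝 y) := by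
    simpa using (tendsto_cosh_div_sqrt y).const_mul y
  refine tendsto_of_tendsto_of_tendsto_of_le_of_le' tendsto_const_nhds hc ?_ ?_
  · filter_upwards [eventually_gt_atTop 0] with n hn
    have hs : (0 : ℝ) < √n := Real.sqrt_pos.2 (by exact_mod_cast hn)
    calc y = √n * (y / √n) := by field_simp
      _ ≤ √n * Real.sinh (y / √n) := by
        gcongr
        exact Real.self_le_sinh_iff.2 (by positivity)
  · filter_upwards [eventually_gt_atTop 0] with n hn
    exact sqrt_mul_sinh_div_sqrt_le hy hn

theorem rescaled_integrand_le (k : ℕ) {y : ℝ} (hy : 0 ≤ y) {n : ℕ} (hn : k + 2 ≤ n) :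
    y ^ k * (√n * Real.sinh (y / √n)) / Real.cosh (y / √n) ^ (n + 1) ≤
      (2 * (k + 2 : ℕ) : ℝ) ^ (k + 2) * (1 + y ^ 2)⁻¹ := by
  have hc : 0 < Real.cosh (y / √n) := Real.cosh_pos _
  have hpow : (1 + y ^ 2) ^ (k + 2) ≤
      (2 * (k + 2 : ℕ) : ℝ) ^ (k + 2) * Real.cosh (y / √n) ^ n := by
    calc (1 + y ^ 2) ^ (k + 2)
        ≤ (2 * (k + 2 : ℕ) * (1 + y ^ 2 / 2 / (k + 2 : ℕ)) : ℝ) ^ (k + 2) := by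
          gcongr
          push_cast
          field_simp
          nlinarith [sq_nonneg y, (Nat.cast_nonneg k : (0 : ℝ) ≤ k)]
      _ = (2 * (k + 2 : ℕ) : ℝ) ^ (k + 2) * (1 + y ^ 2 / 2 / (k + 2 : ℕ)) ^ (k + 2) := mul_pow ..
      _ ≤ (2 * (k + 2 : ℕ) : ℝ) ^ (k + 2) * (1 + y ^ 2 / 2 / n) ^ n := by
          gcongr ?_ * ?_
          exact one_add_div_pow_le_one_add_div_pow (by positivity) (by positivity) hn
      _ ≤ _ := by
          gcongr
          exact one_add_div_le_cosh_div_sqrt hy n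
  have hy1 : y ^ (k + 1) ≤ (1 + y ^ 2) ^ (k + 1) := by
    gcongr
    nlinarith [sq_nonneg (y - 1)]
  calc y ^ k * (√n * Real.sinh (y / √n)) / Real.cosh (y / √n) ^ (n + 1)
      ≤ y ^ k * (y * Real.cosh (y / √n)) / Real.cosh (y / √n) ^ (n + 1) := by
        gcongr y ^ k * ?_ / _
        exact sqrt_mul_sinh_div_sqrt_le hy (by omega)
    _ = y ^ (k + 1) / Real.cosh (y / √n) ^ n := by
        field_simp
        ring
    _ ≤ _ := by
        rw [← div_eq_mul_inv, div_le_div_iff₀ (by positivity) (by positivity)]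
        calc y ^ (k + 1) * (1 + y ^ 2) ≤ (1 + y ^ 2) ^ (k + 1) * (1 + y ^ 2) := by gcongr
          _ = (1 + y ^ 2) ^ (k + 2) := by ring
          _ ≤ _ := hpow

theorem tendsto_integral_rescaled (k : ℕ) :
    Tendsto (fun n : ℕ => ∫ y in Set.Ioi (0 : ℝ),
        y ^ k * (√n * Real.sinh (y / √n)) / Real.cosh (y / √n) ^ (n + 1)) atTop
      (𝓝 (∫ y in Set.Ioi (0 : ℝ), y ^ (k + 1) * Real.exp (-(y ^ 2 / 2)))) := by
  refine tendsto_integral_filter_of_dominated_convergence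
    (fun y => (2 * (k + 2 : ℕ) : ℝ) ^ (k + 2) * (1 + y ^ 2)⁻¹) ?_ ?_ ?_ ?_
  · refine Eventually.of_forall fun n => Continuous.aestronglyMeasurable ?_
    exact Continuous.div (by fun_prop) (by fun_prop) fun y => (pow_pos (Real.cosh_pos _) _).ne'
  · filter_upwards [eventually_ge_atTop (k + 2)] with n hn
    filter_upwards [ae_restrict_mem measurableSet_Ioi] with y hy
    have hy' : 0 ≤ y := le_of_lt hy
    have hs : 0 ≤ Real.sinh (y / √n) := Real.sinh_nonneg_iff.2 (by positivity)
    have hc : 0 < Real.cosh (y / √n) := Real.cosh_pos _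
    rw [Real.norm_of_nonneg (by positivity)]
    exact rescaled_integrand_le k hy' hn
  · exact (integrable_inv_one_add_sq.const_mul _).integrableOn
  · filter_upwards [ae_restrict_mem measurableSet_Ioi] with y hy
    have hy' : 0 ≤ y := le_of_lt hy
    have hden : Tendsto (fun n : ℕ => Real.cosh (y / √n) ^ (n + 1)) atTop
        (𝓝 (Real.exp (y ^ 2 / 2))) := by
      simpa [pow_succ] using (tendsto_cosh_div_sqrt_pow hy').mul (tendsto_cosh_div_sqrt y)
    have h := ((tendsto_sqrt_mul_sinh_div_sqrt hy').const_mul (y ^ k)).div hden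
      (Real.exp_pos _).ne'
    rwa [← pow_succ, div_eq_mul_inv (y ^ (k + 1)), ← Real.exp_neg] at h

theorem integral_pow_succ_mul_exp_neg_sq_half (k : ℕ) :
    ∫ y in Set.Ioi (0 : ℝ), y ^ (k + 1) * Real.exp (-(y ^ 2 / 2)) =
      (2 : ℝ) ^ ((k : ℝ) / 2) * Real.Gamma ((k : ℝ) / 2 + 1) := by
  have h := integral_rpow_mul_exp_neg_mul_rpow (p := 2) (q := (k : ℝ) + 1) (b := 1 / 2)
    (by norm_num) (by linarith [(Nat.cast_nonneg k : (0 : ℝ) ≤ k)]) (by norm_num)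
  have hexp : (1 / 2 : ℝ) ^ (-((k : ℝ) + 1 + 1) / 2) * (1 / 2) = (2 : ℝ) ^ ((k : ℝ) / 2) := by
    rw [one_div, Real.inv_rpow (by norm_num), ← Real.rpow_neg (by norm_num),
      show -(-((k : ℝ) + 1 + 1) / 2) = (k : ℝ) / 2 + 1 by ring,
      Real.rpow_add_one (by norm_num)]
    ring
  rw [hexp, show ((k : ℝ) + 1 + 1) / 2 = (k : ℝ) / 2 + 1 by ring] at h
  rw [← h]
  refine setIntegral_congr_fun measurableSet_Ioi fun y _ => ?_
  have h1 : y ^ ((k : ℝ) + 1) = y ^ (k + 1) := by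
    rw [← Real.rpow_natCast]; push_cast; rfl
  simp only [h1, Real.rpow_ofNat]
  ring_nf

theorem integral_rescaled (k : ℕ) {n : ℕ} (hn : 0 < n) :
    ∫ y in Set.Ioi (0 : ℝ), y ^ k * (√n * Real.sinh (y / √n)) / Real.cosh (y / √n) ^ (n + 1) =
      √n ^ (k + 2) *
        ∫ x in Set.Ioi (0 : ℝ), x ^ k * Real.sinh x / Real.cosh x ^ (n + 1) := by
  have hs : (0 : ℝ) < √n := Real.sqrt_pos.2 (by exact_mod_cast hn)
  have h := integral_comp_mul_left_Ioi
    (fun x => x ^ k * Real.sinh x / Real.cosh x ^ (n + 1)) 0 (inv_pos.2 hs)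
  rw [mul_zero, inv_inv, smul_eq_mul] at h
  rw [pow_succ, mul_assoc, ← h, ← integral_const_mul]
  congr 1 with y
  rw [inv_mul_eq_div, div_pow]
  field_simp
  ring

/-- Asymptotics of the k-th moment of the maximum for δ = 4m:
(2m+1)^{k/2}·(2+4m)·2^{−(k+2)/2}/Γ(k/2+1)·∫₀^∞ x^k sinh x (cosh x)^{−(2+2m)} dx → 1. -/
theorem stmt_12 (k : ℕ) :
    Tendsto (fun m : ℕ =>
        (2 * (m : ℝ) + 1) ^ ((k : ℝ) / 2) * (2 + 4 * (m : ℝ))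
          * (2 : ℝ) ^ (-((k : ℝ) + 2) / 2) / Real.Gamma ((k : ℝ) / 2 + 1)
          * ∫ x in Set.Ioi (0 : ℝ),
              x ^ k * Real.sinh x * Real.cosh x ^ (-(2 + 2 * (m : ℝ))))
      atTop (𝓝 1) := by
  have hG : 0 < Real.Gamma ((k : ℝ) / 2 + 1) := Real.Gamma_pos_of_pos (by positivity)
  have hodd : Tendsto (fun m : ℕ => 2 * m + 1) atTop atTop :=
    tendsto_atTop_mono (fun m => by simp only [id]; omega) tendsto_id
  have h := ((tendsto_integral_rescaled k).comp hodd).const_mul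
    (2 * (2 : ℝ) ^ (-((k : ℝ) + 2) / 2) / Real.Gamma ((k : ℝ) / 2 + 1))
  have hlim : 2 * (2 : ℝ) ^ (-((k : ℝ) + 2) / 2) / Real.Gamma ((k : ℝ) / 2 + 1) *
      ((2 : ℝ) ^ ((k : ℝ) / 2) * Real.Gamma ((k : ℝ) / 2 + 1)) = 1 := by
    have h2 : (2 : ℝ) ^ (-((k : ℝ) + 2) / 2) * (2 : ℝ) ^ ((k : ℝ) / 2) = 1 / 2 := by
      rw [← Real.rpow_add (by norm_num),
        show -((k : ℝ) + 2) / 2 + (k : ℝ) / 2 = -1 by ring, Real.rpow_neg_one, one_div]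
    rw [div_mul_eq_mul_div, div_eq_one_iff_eq hG.ne']
    linear_combination 2 * Real.Gamma ((k : ℝ) / 2 + 1) * h2
  rw [integral_pow_succ_mul_exp_neg_sq_half, hlim] at h
  refine h.congr fun m => ?_
  have hpos : (0 : ℝ) ≤ 2 * (m : ℝ) + 1 := by positivity
  have hint : ∀ x : ℝ, x ^ k * Real.sinh x * Real.cosh x ^ (-(2 + 2 * (m : ℝ))) =
      x ^ k * Real.sinh x / Real.cosh x ^ (2 * m + 1 + 1) := by
    intro x
    rw [Real.rpow_neg (Real.cosh_pos x).le, div_eq_mul_inv,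
      ← Real.rpow_natCast _ (2 * m + 1 + 1)]
    push_cast
    ring_nf
  have hsq : √(2 * (m : ℝ) + 1) ^ (k + 2) =
      (2 * (m : ℝ) + 1) ^ ((k : ℝ) / 2) * (2 * (m : ℝ) + 1) := by
    rw [pow_add, Real.sq_sqrt hpos, Real.sqrt_eq_rpow, ← Real.rpow_natCast, ← Real.rpow_mul hpos]
    ring_nf
  simp only [Function.comp_apply, hint]
  rw [integral_rescaled k (by omega : 0 < 2 * m + 1)]
  push_cast
  rw [hsq]
  ring
end

section
/- Let m be a natural number and define the walker-marginal series P_m(t,y) := ((2+4m)·2^{2m+1}/√(2πt)) · Σ_{j=0}^{∞} (−1)^j · C(j+1+2m, j) · [e^{−y²(2j+2m+1)²/(2t)} + e^{−y²(2j+2m+3)²/(2t)}] / (2j + 2 + 2m) for t > 0, y > 0, where C(n,k) denotes the binomial coefficient. Then for every s > 0 and y > 0, ∫₀^∞ e^{−st} P_m(t,y) dt = (2+4m) · ∫_y^∞ cosh(y√(2s)) · (cosh(b√(2s)))^{−(2m+2)} db. -/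
open Real Filter Topology MeasureTheory

theorem hasDerivAt_integral_exp_neg_sq (x : ℝ) :
    HasDerivAt (fun x : ℝ => ∫ v in (0 : ℝ)..x, exp (-v ^ 2)) (exp (-x ^ 2)) x := by
  have hc : Continuous fun v : ℝ => exp (-v ^ 2) := by fun_prop
  exact intervalIntegral.integral_hasDerivAt_right (hc.intervalIntegrable _ _)
    (hc.stronglyMeasurableAtFilter _ _) hc.continuousAt

theorem tendsto_integral_exp_neg_sq_atTop :
    Tendsto (fun x : ℝ => ∫ v in (0 : ℝ)..x, exp (-v ^ 2)) atTop (𝓝 (√π / 2)) := by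
  have hi : Integrable fun v : ℝ => exp (-v ^ 2) := by
    simpa using integrable_exp_neg_mul_sq (b := 1) one_pos
  have h := intervalIntegral_tendsto_integral_Ioi 0 hi.integrableOn tendsto_id
  have hg := integral_gaussian_Ioi 1
  simp only [neg_one_mul, div_one] at hg
  rwa [hg] at h

theorem tendsto_integral_exp_neg_sq_atBot :
    Tendsto (fun x : ℝ => ∫ v in (0 : ℝ)..x, exp (-v ^ 2)) atBot (𝓝 (-(√π / 2))) := by
  have h := (tendsto_integral_exp_neg_sq_atTop.comp tendsto_neg_atBot_atTop).neg
  refine h.congr fun x => ?_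
  have := intervalIntegral.integral_comp_neg (a := 0) (b := x) fun v : ℝ => exp (-v ^ 2)
  simp only [neg_sq, neg_zero] at this
  rw [Function.comp_apply, intervalIntegral.integral_symm, this, neg_neg]

theorem integral_Ioi_of_hasDerivAt_of_nonneg_of_tendsto {F F' : ℝ → ℝ} {a l r : ℝ}
    (hderiv : ∀ x ∈ Set.Ioi a, HasDerivAt F (F' x) x) (hpos : ∀ x ∈ Set.Ioi a, 0 ≤ F' x)
    (hl : Tendsto F (𝓝[>] a) (𝓝 l)) (hr : Tendsto F atTop (𝓝 r)) :
    IntegrableOn F' (Set.Ioi a) ∧ ∫ x in Set.Ioi a, F' x = r - l := by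
  have hcont : ContinuousWithinAt (Function.update F a l) (Set.Ici a) a := by
    rw [continuousWithinAt_update_same, Set.Ici_sdiff_left]
    exact hl
  have hderiv' : ∀ x ∈ Set.Ioi a, HasDerivAt (Function.update F a l) (F' x) x := by
    intro x hx
    refine (hderiv x hx).congr_of_eventuallyEq ?_
    filter_upwards [eventually_ne_nhds (ne_of_gt hx)] with z hz
    exact Function.update_of_ne hz _ _
  have hr' : Tendsto (Function.update F a l) atTop (𝓝 r) := by
    refine hr.congr' ?_
    filter_upwards [eventually_ne_atTop a] with z hz
    exact (Function.update_of_ne hz _ _).symm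
  refine ⟨integrableOn_Ioi_deriv_of_nonneg hcont hderiv' hpos hr', ?_⟩
  simpa using integral_Ioi_of_hasDerivAt_of_nonneg hcont hderiv' hpos hr'

theorem integral_sqrt_inv_mul_exp_neg_sq_sub {α β : ℝ} (hα : 0 < α) (hβ : 0 < β) :
    IntegrableOn (fun t : ℝ => α / √t * exp (-(α * √t - β / √t) ^ 2)) (Set.Ioi 0) ∧
      ∫ t in Set.Ioi (0 : ℝ), α / √t * exp (-(α * √t - β / √t) ^ 2) = √π := by
  let G : ℝ → ℝ := fun x => ∫ v in (0 : ℝ)..x, exp (-v ^ 2)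
  let F : ℝ → ℝ := fun t => G (α * √t - β / √t) + exp (4 * α * β) * G (α * √t + β / √t)
  have hinv : Tendsto (fun t : ℝ => β / √t) (𝓝[>] 0) atTop := by
    have h0 : Tendsto (fun t : ℝ => √t) (𝓝[>] 0) (𝓝[>] 0) := by
      refine tendsto_nhdsWithin_iff.2 ⟨?_, ?_⟩
      · simpa using (continuous_sqrt.tendsto 0).mono_left nhdsWithin_le_nhds
      · filter_upwards [self_mem_nhdsWithin] with t ht using sqrt_pos.2 ht
    simpa only [div_eq_mul_inv, Function.comp_apply] using
      (tendsto_inv_nhdsGT_zero.comp h0).const_mul_atTop hβ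
  have hsqrt : Tendsto (fun t : ℝ => α * √t) (𝓝[>] 0) (𝓝 0) := by
    have : Continuous fun t : ℝ => α * √t := by fun_prop
    simpa using (this.tendsto 0).mono_left nhdsWithin_le_nhds
  have hinv' : Tendsto (fun t : ℝ => β / √t) atTop (𝓝 0) :=
    tendsto_sqrt_atTop.const_div_atTop β
  have hsqrt' : Tendsto (fun t : ℝ => α * √t) atTop atTop :=
    tendsto_sqrt_atTop.const_mul_atTop hα
  have hl : Tendsto F (𝓝[>] 0) (𝓝 (-(√π / 2) + exp (4 * α * β) * (√π / 2))) := by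
    refine (tendsto_integral_exp_neg_sq_atBot.comp ?_).add
      ((tendsto_integral_exp_neg_sq_atTop.comp ?_).const_mul _)
    · simpa only [sub_eq_add_neg, Function.comp_apply] using hsqrt.add_atBot (tendsto_neg_atTop_atBot.comp hinv)
    · exact hsqrt.add_atTop hinv
  have hr : Tendsto F atTop (𝓝 (√π / 2 + exp (4 * α * β) * (√π / 2))) := by
    refine (tendsto_integral_exp_neg_sq_atTop.comp ?_).add
      ((tendsto_integral_exp_neg_sq_atTop.comp ?_).const_mul _)
    · simpa only [sub_eq_add_neg] using hsqrt'.atTop_add hinv'.neg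
    · exact hsqrt'.atTop_add hinv'
  have hderiv : ∀ t ∈ Set.Ioi (0 : ℝ),
      HasDerivAt F (α / √t * exp (-(α * √t - β / √t) ^ 2)) t := by
    intro t ht
    have hu : 0 < √t := sqrt_pos.2 ht
    have h1 := (hasDerivAt_sqrt (ne_of_gt ht)).const_mul α
    have h2 := ((hasDerivAt_sqrt (ne_of_gt ht)).inv hu.ne').const_mul β
    have hA := (hasDerivAt_integral_exp_neg_sq (α * √t - β * (√t)⁻¹)).comp t (h1.sub h2)
    have hB := (hasDerivAt_integral_exp_neg_sq (α * √t + β * (√t)⁻¹)).comp t (h1.add h2)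
    have hexp : exp (4 * α * β) * exp (-(α * √t + β * (√t)⁻¹) ^ 2)
        = exp (-(α * √t - β * (√t)⁻¹) ^ 2) := by
      rw [← exp_add]
      congr 1
      field_simp
      ring
    simp only [F, div_eq_mul_inv β]
    convert! hA.add (hB.const_mul (exp (4 * α * β))) using 1
    rw [← mul_assoc, hexp]
    field_simp
    ring
  obtain ⟨h1, h2⟩ := integral_Ioi_of_hasDerivAt_of_nonneg_of_tendsto hderiv
    (fun t _ => by positivity) hl hr
  refine ⟨h1, h2.trans (by ring)⟩

/-- The Laplace transform of the (half-line) Brownian heat kernel. -/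
theorem integral_exp_neg_mul_heat_kernel {s c : ℝ} (hs : 0 < s) (hc : 0 < c) :
    IntegrableOn (fun t : ℝ => exp (-s * t) * (exp (-c ^ 2 / (2 * t)) / √(2 * π * t)))
        (Set.Ioi 0) ∧
      ∫ t in Set.Ioi (0 : ℝ), exp (-s * t) * (exp (-c ^ 2 / (2 * t)) / √(2 * π * t))
        = exp (-(c * √(2 * s))) / √(2 * s) := by
  have hs' : 0 < √s := sqrt_pos.2 hs
  have h2 : 0 < √(2 : ℝ) := sqrt_pos.2 two_pos
  have hπ : 0 < √π := sqrt_pos.2 pi_pos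
  obtain ⟨hi, hv⟩ := integral_sqrt_inv_mul_exp_neg_sq_sub hs' (div_pos hc h2)
  let K : ℝ := exp (-(c * √(2 * s))) / (√(2 * s) * √π)
  have hEq : Set.EqOn (fun t : ℝ => K * (√s / √t * exp (-(√s * √t - c / √2 / √t) ^ 2)))
      (fun t : ℝ => exp (-s * t) * (exp (-c ^ 2 / (2 * t)) / √(2 * π * t))) (Set.Ioi 0) := by
    intro t ht
    have ht0 : (0 : ℝ) < t := ht
    have hu : 0 < √t := sqrt_pos.2 ht
    have hE : exp (-(c * √(2 * s))) * exp (-(√s * √t - c / √2 / √t) ^ 2)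
        = exp (-s * t) * exp (-c ^ 2 / (2 * t)) := by
      rw [← exp_add, ← exp_add]
      congr 1
      have e1 : √s ^ 2 = s := sq_sqrt hs.le
      have e2 : √t ^ 2 = t := sq_sqrt ht0.le
      have e3 : √(2 : ℝ) ^ 2 = 2 := sq_sqrt zero_le_two
      rw [sqrt_mul zero_le_two]
      have : (√s * √t - c / √2 / √t) ^ 2
          = √s ^ 2 * √t ^ 2 - 2 * c * √s / √2 + c ^ 2 / (√2 ^ 2 * √t ^ 2) := by
        field_simp
        ring
      rw [this, e1, e2, e3]
      have : 2 * c * √s / √2 = c * (√2 * √s) := by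
        field_simp
        rw [e3]
      rw [this]
      ring
    have hd : √(2 * π * t) = √2 * √π * √t := by
      rw [sqrt_mul (by positivity), sqrt_mul zero_le_two]
    simp only [K]
    rw [← mul_div_assoc, ← hE, hd, sqrt_mul zero_le_two]
    field_simp
  refine ⟨IntegrableOn.congr_fun (hi.const_mul K) hEq measurableSet_Ioi, ?_⟩
  rw [← setIntegral_congr_fun measurableSet_Ioi hEq, integral_const_mul, hv]
  simp only [K]
  field_simp

theorem integral_tsum_mul_of_nonneg {S : Set ℝ} (hS : MeasurableSet S) {w I : ℕ → ℝ}
    {h : ℕ → ℝ → ℝ} (hpos : ∀ j, ∀ x ∈ S, 0 ≤ h j x) (hint : ∀ j, IntegrableOn (h j) S)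
    (hI : ∀ j, ∫ x in S, h j x = I j) (hsum : Summable fun j => w j * I j) :
    ∫ x in S, ∑' j, w j * h j x = ∑' j, w j * I j := by
  have hI0 : ∀ j, 0 ≤ I j := fun j => hI j ▸ setIntegral_nonneg hS (hpos j)
  have hnorm : ∀ j, ∫ x in S, ‖w j * h j x‖ = ‖w j * I j‖ := by
    intro j
    rw [norm_mul, norm_of_nonneg (hI0 j), ← hI j, ← integral_const_mul]
    refine setIntegral_congr_fun hS fun x hx => ?_
    simp only [norm_mul, norm_of_nonneg (hpos j x hx)]
  rw [← (hasSum_integral_of_summable_integral_norm (fun j => (hint j).const_mul (w j))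
    (by simpa only [hnorm] using hsum.norm)).tsum_eq]
  simp only [integral_const_mul, hI]

theorem summable_choose_mul_exp_div (m : ℕ) {x : ℝ} (hx : 0 < x) :
    Summable fun j : ℕ => (-1 : ℝ) ^ j * (Nat.choose (j + 1 + 2 * m) j : ℝ)
      * (exp (-((2 * j + 2 + 2 * m) * x)) / (2 * j + 2 + 2 * m)) := by
  have hr : ‖exp (-(2 * x))‖ < 1 := by
    rw [norm_of_nonneg (exp_pos _).le, exp_lt_one_iff]
    linarith
  refine Summable.of_norm_bounded
    (summable_choose_mul_geometric_of_norm_lt_one (2 * m + 1) hr) fun j => ?_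
  have hq : (1 : ℝ) ≤ 2 * j + 2 + 2 * m := by
    have : (0 : ℝ) ≤ j := j.cast_nonneg
    have : (0 : ℝ) ≤ m := m.cast_nonneg
    linarith
  rw [norm_mul, norm_mul, norm_pow, norm_neg, norm_one, one_pow, one_mul, norm_natCast,
    norm_of_nonneg (by positivity), show j + 1 + 2 * m = j + (2 * m + 1) by ring,
    Nat.choose_symm_add]
  gcongr
  refine (div_le_self (exp_pos _).le hq).trans ?_
  rw [← exp_nat_mul, exp_le_exp]
  nlinarith [mul_nonneg (m.cast_nonneg (α := ℝ)) hx.le]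

theorem cosh_rpow_neg_eq_tsum (m : ℕ) {x : ℝ} (hx : 0 < x) :
    cosh x ^ (-(2 * (m : ℝ) + 2)) = 2 ^ (2 * m + 2) *
      ∑' j : ℕ, (-1 : ℝ) ^ j * (Nat.choose (j + 1 + 2 * m) j : ℝ)
        * exp (-((2 * j + 2 + 2 * m) * x)) := by
  have hr : ‖-exp (-(2 * x))‖ < 1 := by
    rw [norm_neg, norm_of_nonneg (exp_pos _).le, exp_lt_one_iff]
    linarith
  have hterm : ∀ j : ℕ, (-1 : ℝ) ^ j * (Nat.choose (j + 1 + 2 * m) j : ℝ)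
      * exp (-((2 * j + 2 + 2 * m) * x))
      = exp (-x) ^ (2 * m + 2)
        * ((Nat.choose (j + (2 * m + 1)) (2 * m + 1) : ℝ) * (-exp (-(2 * x))) ^ j) := by
    intro j
    rw [show j + 1 + 2 * m = j + (2 * m + 1) by ring, Nat.choose_symm_add,
      neg_pow (exp (-(2 * x))),
      ← exp_nat_mul, ← exp_nat_mul, show -((2 * j + 2 + 2 * m) * x)
        = ((2 * m + 2 : ℕ) : ℝ) * -x + j * -(2 * x) by push_cast; ring, exp_add]
    ring
  have hcosh : exp (-x) * (2 * cosh x) = 1 + exp (-(2 * x)) := by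
    rw [cosh_eq, mul_div_cancel₀ _ two_ne_zero, mul_add, ← exp_add, ← exp_add]
    ring_nf
    simp
  rw [tsum_congr hterm, tsum_mul_left, tsum_choose_mul_geometric_of_norm_lt_one _ hr,
    sub_neg_eq_add, ← hcosh, rpow_neg (cosh_pos x).le,
    show (2 * (m : ℝ) + 2) = ((2 * m + 2 : ℕ) : ℝ) by push_cast; ring, rpow_natCast]
  have := cosh_pos x
  have := exp_pos (-x)
  rw [mul_pow, mul_pow]
  field_simp

theorem integral_cosh_rpow_neg_eq_tsum (m : ℕ) {a y : ℝ} (ha : 0 < a) (hy : 0 < y) :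
    ∫ b in Set.Ioi y, cosh (b * a) ^ (-(2 * (m : ℝ) + 2)) = 2 ^ (2 * m + 2) *
      ∑' j : ℕ, (-1 : ℝ) ^ j * (Nat.choose (j + 1 + 2 * m) j : ℝ)
        * (exp (-((2 * j + 2 + 2 * m) * (y * a))) / (2 * j + 2 + 2 * m) / a) := by
  have hq : ∀ j : ℕ, (0 : ℝ) < 2 * j + 2 + 2 * m := fun j => by positivity
  rw [setIntegral_congr_fun measurableSet_Ioi fun b hb =>
    cosh_rpow_neg_eq_tsum m (mul_pos (hy.trans hb) ha), integral_const_mul]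
  congr 1
  refine integral_tsum_mul_of_nonneg measurableSet_Ioi
    (h := fun j b => exp (-((2 * j + 2 + 2 * m) * (b * a)))) (fun _ _ _ => (exp_pos _).le)
    (fun j => ?_) (fun j => ?_) ?_
  · have := integrableOn_exp_mul_Ioi (neg_neg_of_pos (mul_pos (hq j) ha)) y
    refine this.congr_fun (fun b _ => ?_) measurableSet_Ioi
    simp only
    congr 1
    ring
  · have := integral_exp_mul_Ioi (neg_neg_of_pos (mul_pos (hq j) ha)) y
    rw [neg_div_neg_eq, ← div_div, show -((2 * j + 2 + 2 * m) * a) * y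
      = -((2 * j + 2 + 2 * m) * (y * a)) by ring] at this
    rw [← this]
    congr 1 with b
    congr 1
    ring
  · simpa only [mul_div_assoc] using
      (summable_choose_mul_exp_div m (mul_pos hy ha)).div_const a

/-- The walker-marginal series P_m(t,y) (equation (19) before index shift) has Laplace
transform P̃_m(s,y) = (2+4m)·∫_y^∞ cosh(y√(2s))·(cosh(b√(2s)))^{−(2m+2)} db. -/
theorem stmt_14 (m : ℕ)
    (Pm : ℝ → ℝ → ℝ)
    (hPm : ∀ t y : ℝ, 0 < t → 0 < y → Pm t y =
      ((2 + 4 * (m : ℝ)) * 2 ^ (2 * m + 1) / Real.sqrt (2 * π * t))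
        * ∑' j : ℕ, (-1 : ℝ) ^ j * (Nat.choose (j + 1 + 2 * m) j : ℝ)
            * (Real.exp (-(y ^ 2) * (2 * j + 2 * m + 1) ^ 2 / (2 * t))
                + Real.exp (-(y ^ 2) * (2 * j + 2 * m + 3) ^ 2 / (2 * t)))
            / (2 * j + 2 + 2 * m))
    (s y : ℝ) (hs : 0 < s) (hy : 0 < y) :
    (∫ t in Set.Ioi (0 : ℝ), Real.exp (-s * t) * Pm t y)
      = (2 + 4 * (m : ℝ)) * ∫ b in Set.Ioi y,
          Real.cosh (y * Real.sqrt (2 * s))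
            * Real.cosh (b * Real.sqrt (2 * s)) ^ (-(2 * (m : ℝ) + 2)) := by
  have ha : 0 < √(2 * s) := sqrt_pos.2 (by positivity)
  let w : ℕ → ℝ := fun j => (-1) ^ j * (Nat.choose (j + 1 + 2 * m) j : ℝ) / (2 * j + 2 + 2 * m)
  let g : ℝ → ℝ → ℝ := fun c t => exp (-s * t) * (exp (-c ^ 2 / (2 * t)) / √(2 * π * t))
  let h : ℕ → ℝ → ℝ := fun j t =>
    g (y * (2 * j + 2 * m + 1)) t + g (y * (2 * j + 2 * m + 3)) t
  let I : ℕ → ℝ := fun j => exp (-(y * (2 * j + 2 * m + 1) * √(2 * s))) / √(2 * s)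
    + exp (-(y * (2 * j + 2 * m + 3) * √(2 * s))) / √(2 * s)
  have hg₁ : ∀ j : ℕ, 0 < y * (2 * j + 2 * m + 1) := fun j => by positivity
  have hg₃ : ∀ j : ℕ, 0 < y * (2 * j + 2 * m + 3) := fun j => by positivity
  have hwI : ∀ j, w j * I j = 2 * cosh (y * √(2 * s)) *
      ((-1 : ℝ) ^ j * (Nat.choose (j + 1 + 2 * m) j : ℝ)
        * (exp (-((2 * j + 2 + 2 * m) * (y * √(2 * s)))) / (2 * j + 2 + 2 * m) / √(2 * s))) := by
    intro j
    have h₁ : exp (-(y * (2 * j + 2 * m + 1) * √(2 * s)))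
        = exp (y * √(2 * s)) * exp (-((2 * j + 2 + 2 * m) * (y * √(2 * s)))) := by
      rw [← exp_add]
      ring_nf
    have h₃ : exp (-(y * (2 * j + 2 * m + 3) * √(2 * s)))
        = exp (-(y * √(2 * s))) * exp (-((2 * j + 2 + 2 * m) * (y * √(2 * s)))) := by
      rw [← exp_add]
      ring_nf
    simp only [w, I]
    rw [h₁, h₃, cosh_eq]
    ring
  have hPm' : ∀ t ∈ Set.Ioi (0 : ℝ), exp (-s * t) * Pm t y
      = (2 + 4 * (m : ℝ)) * 2 ^ (2 * m + 1) * ∑' j, w j * h j t := by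
    intro t ht
    rw [hPm t y ht hy, div_mul_eq_mul_div, mul_div_assoc, ← tsum_div_const, mul_left_comm,
      ← tsum_mul_left]
    congr 1
    refine tsum_congr fun j => ?_
    simp only [w, h, g, mul_pow, neg_mul]
    ring
  have hsum : Summable fun j => w j * I j := by
    simp only [hwI]
    refine Summable.mul_left _ ?_
    simpa only [mul_div_assoc] using
      (summable_choose_mul_exp_div m (mul_pos hy ha)).div_const √(2 * s)
  have hint : ∫ t in Set.Ioi (0 : ℝ), ∑' j, w j * h j t = ∑' j, w j * I j := by
    refine integral_tsum_mul_of_nonneg measurableSet_Ioi (fun j t _ => by positivity)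
      (fun j => (integral_exp_neg_mul_heat_kernel hs (hg₁ j)).1.add
        (integral_exp_neg_mul_heat_kernel hs (hg₃ j)).1) (fun j => ?_) hsum
    obtain ⟨i₁, e₁⟩ := integral_exp_neg_mul_heat_kernel hs (hg₁ j)
    obtain ⟨i₃, e₃⟩ := integral_exp_neg_mul_heat_kernel hs (hg₃ j)
    simp only [h, g, I]
    rw [integral_add i₁ i₃, e₁, e₃]
  rw [setIntegral_congr_fun measurableSet_Ioi hPm', integral_const_mul, hint, tsum_congr hwI,
    tsum_mul_left, integral_const_mul, integral_cosh_rpow_neg_eq_tsum m ha hy]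
  ring
end

section
/- For every integer m ≥ 1, ∫₀¹ ((1−u)/u)² · (2u/(1+u²))^{2m+1} du = √π · ( Γ(m)/Γ(m + 1/2) − Γ(m + 1/2)/Γ(m + 1) ). -/
open Real Filter Topology MeasureTheory

theorem integral_sin_pow_eq_Gamma (n : ℕ) :
    (∫ x in (0 : ℝ)..π, sin x ^ n)
      = √π * (Gamma (((n : ℝ) + 1) / 2) / Gamma ((n : ℝ) / 2 + 1)) := by
  induction n using Nat.twoStepInduction with
  | zero =>
    have h : Gamma ((2 : ℝ)⁻¹) = √π := by rw [← one_div, Gamma_one_half_eq]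
    simp [h, mul_self_sqrt pi_pos.le]
  | one =>
    have h : Gamma ((1 : ℝ) / 2 + 1) = 1 / 2 * √π := by
      rw [Gamma_add_one (by norm_num), Gamma_one_half_eq]
    have hπ : √π ≠ 0 := by positivity
    norm_num at h ⊢
    rw [h]
    field_simp
  | more n ih _ =>
    have hn : (0 : ℝ) < (n : ℝ) + 1 := by positivity
    have h₁ : Gamma ((((n + 2 : ℕ) : ℝ) + 1) / 2)
        = ((n : ℝ) + 1) / 2 * Gamma (((n : ℝ) + 1) / 2) := by
      rw [← Gamma_add_one (by positivity)]
      push_cast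
      ring_nf
    have h₂ : Gamma (((n + 2 : ℕ) : ℝ) / 2 + 1)
        = ((n : ℝ) / 2 + 1) * Gamma ((n : ℝ) / 2 + 1) := by
      rw [← Gamma_add_one (by positivity)]
      push_cast
      ring_nf
    have h₃ : Gamma ((n : ℝ) / 2 + 1) ≠ 0 := (Gamma_pos_of_pos (by positivity)).ne'
    rw [integral_sin_pow, ih, h₁, h₂]
    simp
    field_simp

theorem sin_two_mul_arctan_eq (u : ℝ) : sin (2 * arctan u) = 2 * u / (1 + u ^ 2) := by
  have h : √(1 + u ^ 2) ≠ 0 := by positivity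
  rw [sin_two_mul, sin_arctan, cos_arctan]
  field_simp
  rw [sq_sqrt (by positivity)]

/-- Evaluation of the mean walker position integral (21):
∫₀¹ ((1−u)/u)²·(2u/(1+u²))^{2m+1} du = √π·(Γ(m)/Γ(m+1/2) − Γ(m+1/2)/Γ(m+1)). -/
theorem stmt_15 (m : ℕ) (hm : 1 ≤ m) :
    (∫ u in (0 : ℝ)..1, ((1 - u) / u) ^ 2 * (2 * u / (1 + u ^ 2)) ^ (2 * m + 1))
      = Real.sqrt π * (Real.Gamma m / Real.Gamma ((m : ℝ) + 1 / 2)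
          - Real.Gamma ((m : ℝ) + 1 / 2) / Real.Gamma ((m : ℝ) + 1)) := by
  obtain ⟨k, rfl⟩ := Nat.exists_eq_add_of_le' hm
  let g : ℝ → ℝ := fun x => 2 * (cos x ^ (2 * k + 1) - cos x ^ (2 * k + 2))
  let f : ℝ → ℝ := fun u => π / 2 - 2 * arctan u
  have hf : ∀ u : ℝ, HasDerivAt f (-(2 * (1 / (1 + u ^ 2)))) u := fun u =>
    ((hasDerivAt_arctan u).const_mul 2).const_sub (π / 2)
  have hf' : Continuous fun u : ℝ => -(2 * (1 / (1 + u ^ 2))) := by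
    fun_prop (disch := intro x; positivity)
  have integrand_eq : ∀ u : ℝ,
      ((1 - u) / u) ^ 2 * (2 * u / (1 + u ^ 2)) ^ (2 * (k + 1) + 1)
        = -((g ∘ f) u * (-(2 * (1 / (1 + u ^ 2))))) := by
    intro u
    simp only [g, f, Function.comp_apply, cos_pi_div_two_sub, sin_two_mul_arctan_eq]
    rcases eq_or_ne u 0 with rfl | hu
    · simp
    · have h : 1 + u ^ 2 ≠ 0 := by positivity
      rw [show 2 * (k + 1) + 1 = 2 * k + 1 + 2 by ring, pow_add _ (2 * k + 1) 2,
        pow_succ _ (2 * k + 1)]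
      generalize (2 * u / (1 + u ^ 2)) ^ (2 * k + 1) = p
      field_simp
      ring
  have subst_eq := intervalIntegral.integral_comp_mul_deriv (a := 0) (b := 1)
    (fun u _ => hf u) hf'.continuousOn (g := g) (by fun_prop)
  have hf₀ : f 0 = π / 2 := by simp [f]
  have hf₁ : f 1 = 0 := by simp only [f, arctan_one]; ring
  rw [intervalIntegral.integral_congr (fun u _ => integrand_eq u),
    intervalIntegral.integral_neg, subst_eq, hf₀, hf₁, ← intervalIntegral.integral_symm,
    intervalIntegral.integral_const_mul,
    intervalIntegral.integral_sub (by apply Continuous.intervalIntegrable; fun_prop)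
      (by apply Continuous.intervalIntegrable; fun_prop),
    EulerSine.integral_cos_pow_eq, EulerSine.integral_cos_pow_eq,
    integral_sin_pow_eq_Gamma, integral_sin_pow_eq_Gamma]
  push_cast
  ring_nf
end

section
/- As the integer m tends to infinity, m^{3/2} · ( Γ(m)/Γ(m + 1/2) − Γ(m + 1/2)/Γ(m + 1) ) tends to 1/4. (Equivalently: the mean walker position of the reinforced Brownian motion with δ = 4m satisfies E_m(y) ~ (1/4)·√(t/(2m)) as m → ∞.) -/
open Real Filter Topology MeasureTheory

lemma Gamma_midpoint_sq_le {x : ℝ} (hx : 0 < x) :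
    Real.Gamma (x + 1 / 2) ^ 2 ≤ x * Real.Gamma x ^ 2 := by
  have h := Real.Gamma_mul_add_mul_le_rpow_Gamma_mul_rpow_Gamma hx
    (show (0 : ℝ) < x + 1 by linarith) (show (0 : ℝ) < 1 / 2 by norm_num)
    (show (0 : ℝ) < 1 / 2 by norm_num) (by norm_num)
  rw [show 1 / 2 * x + 1 / 2 * (x + 1) = x + 1 / 2 by ring, Real.Gamma_add_one hx.ne',
    ← Real.sqrt_eq_rpow, ← Real.sqrt_eq_rpow] at h
  have hG := Real.Gamma_pos_of_pos hx
  have hG' := Real.Gamma_pos_of_pos (show 0 < x + 1 / 2 by linarith)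
  calc Real.Gamma (x + 1 / 2) ^ 2
      ≤ (√(Real.Gamma x) * √(x * Real.Gamma x)) ^ 2 := by gcongr
    _ = x * Real.Gamma x ^ 2 := by
        rw [mul_pow, Real.sq_sqrt hG.le, Real.sq_sqrt (by positivity)]
        ring

/-- The square of the ratio `Γ (x + 1 / 2) / Γ x`. -/
noncomputable def gammaHalfRatioSq (x : ℝ) : ℝ :=
  (Real.Gamma (x + 1 / 2) / Real.Gamma x) ^ 2

lemma gammaHalfRatioSq_pos {x : ℝ} (hx : 0 < x) : 0 < gammaHalfRatioSq x := by
  have hG := Real.Gamma_pos_of_pos hx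
  have hG' := Real.Gamma_pos_of_pos (show 0 < x + 1 / 2 by linarith)
  unfold gammaHalfRatioSq
  positivity

lemma gammaHalfRatioSq_le {x : ℝ} (hx : 0 < x) : gammaHalfRatioSq x ≤ x := by
  have hG := Real.Gamma_pos_of_pos hx
  rw [gammaHalfRatioSq, div_pow, div_le_iff₀ (by positivity)]
  exact Gamma_midpoint_sq_le hx

lemma sub_half_le_gammaHalfRatioSq {x : ℝ} (hx : 0 < x) :
    x - 1 / 2 ≤ gammaHalfRatioSq x := by
  have hG := Real.Gamma_pos_of_pos hx
  have h := Gamma_midpoint_sq_le (show 0 < x + 1 / 2 by linarith)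
  rw [add_assoc, add_halves, Real.Gamma_add_one hx.ne'] at h
  rw [gammaHalfRatioSq, div_pow, le_div_iff₀ (by positivity)]
  nlinarith [sq_nonneg (Real.Gamma x)]

lemma gammaHalfRatioSq_add_one {x : ℝ} (hx : 0 < x) :
    gammaHalfRatioSq (x + 1) = gammaHalfRatioSq x * ((x + 1 / 2) ^ 2 / x ^ 2) := by
  have hG := Real.Gamma_pos_of_pos hx
  rw [gammaHalfRatioSq, gammaHalfRatioSq, add_right_comm, Real.Gamma_add_one hx.ne',
    Real.Gamma_add_one (by positivity)]
  field_simp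

lemma tendsto_gammaHalfRatioSq_div :
    Tendsto (fun x : ℝ => gammaHalfRatioSq x / x) atTop (𝓝 1) := by
  have h : Tendsto (fun x : ℝ => 1 - 1 / 2 * x⁻¹) atTop (𝓝 1) := by
    simpa only [mul_zero, sub_zero] using
      (tendsto_inv_atTop_zero (𝕜 := ℝ)).const_mul (1 / 2) |>.const_sub 1
  refine tendsto_of_tendsto_of_tendsto_of_le_of_le' h tendsto_const_nhds ?_ ?_
  · filter_upwards [eventually_gt_atTop 0] with x hx
    rw [le_div_iff₀ hx]
    have := sub_half_le_gammaHalfRatioSq hx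
    field_simp
    linarith
  · filter_upwards [eventually_gt_atTop 0] with x hx
    rw [div_le_one hx]
    exact gammaHalfRatioSq_le hx

lemma tendsto_gammaHalfRatioSq_div_add_nat (x c : ℝ) :
    Tendsto (fun n : ℕ => gammaHalfRatioSq (x + n) / (x + n - 1 / 4 + c / (x + n)))
      atTop (𝓝 1) := by
  have hx : Tendsto (fun n : ℕ => x + (n : ℝ)) atTop atTop :=
    tendsto_atTop_add_const_left _ _ tendsto_natCast_atTop_atTop
  have hinv := tendsto_inv_atTop_zero (𝕜 := ℝ)
  have h : Tendsto (fun y : ℝ => 1 - 1 / 4 * y⁻¹ + c * (y⁻¹ * y⁻¹)) atTop (𝓝 1) := by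
    simpa only [mul_zero, sub_zero, add_zero] using
      ((hinv.const_mul (1 / 4)).const_sub 1).add ((hinv.mul hinv).const_mul c)
  have h' := tendsto_gammaHalfRatioSq_div.div h one_ne_zero
  rw [div_one] at h'
  refine Tendsto.comp (g := fun y : ℝ => gammaHalfRatioSq y / (y - 1 / 4 + c / y)) ?_ hx
  refine h'.congr' ?_
  filter_upwards [eventually_gt_atTop 0] with y hy
  simp only [Pi.div_apply]
  rw [div_div]
  congr 1
  field_simp

lemma sub_quarter_le_gammaHalfRatioSq {x : ℝ} (hx : 1 ≤ x) :
    x - 1 / 4 ≤ gammaHalfRatioSq x := by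
  have hanti : Antitone
      (fun n : ℕ => gammaHalfRatioSq (x + n) / (x + n - 1 / 4 + 0 / (x + n))) := by
    refine antitone_nat_of_succ_le fun n => ?_
    have hy : 1 ≤ x + n := by linarith [n.cast_nonneg (α := ℝ)]
    push_cast
    rw [← add_assoc]
    generalize x + (n : ℝ) = y at hy
    have hQ := gammaHalfRatioSq_pos (show 0 < y by linarith)
    rw [gammaHalfRatioSq_add_one (by linarith), zero_div, zero_div, add_zero, add_zero,
      mul_div_assoc, div_eq_mul_inv (gammaHalfRatioSq y)]
    refine mul_le_mul_of_nonneg_left ?_ hQ.le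
    rw [← one_div, div_div, div_le_div_iff₀ (by nlinarith) (by linarith)]
    nlinarith
  have h := hanti.le_of_tendsto (tendsto_gammaHalfRatioSq_div_add_nat x 0) 0
  simp only [Nat.cast_zero, add_zero, zero_div] at h
  rwa [one_le_div (by linarith)] at h

lemma gammaHalfRatioSq_le_sub_quarter_add {x : ℝ} (hx : 1 ≤ x) :
    gammaHalfRatioSq x ≤ x - 1 / 4 + 1 / 8 / x := by
  have hpos {y : ℝ} (hy : 1 ≤ y) : 0 < y - 1 / 4 + 1 / 8 / y := by
    have : 0 < 1 / 8 / y := by positivity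
    linarith
  have hmono : Monotone
      (fun n : ℕ => gammaHalfRatioSq (x + n) / (x + n - 1 / 4 + 1 / 8 / (x + n))) := by
    refine monotone_nat_of_le_succ fun n => ?_
    have hy : 1 ≤ x + n := by linarith [n.cast_nonneg (α := ℝ)]
    push_cast
    rw [← add_assoc]
    generalize x + (n : ℝ) = y at hy
    have hy0 : 0 < y := by linarith
    have hQ := gammaHalfRatioSq_pos hy0
    have hp := hpos hy
    have hp' := hpos (show 1 ≤ y + 1 by linarith)
    rw [gammaHalfRatioSq_add_one hy0, mul_div_assoc, div_eq_mul_inv (gammaHalfRatioSq y)]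
    refine mul_le_mul_of_nonneg_left ?_ hQ.le
    rw [← one_div, div_div ((y + 1 / 2) ^ 2), div_le_div_iff₀ hp (by positivity), ← sub_nonneg]
    have key : (y + 1 / 2) ^ 2 * (y - 1 / 4 + 1 / 8 / y)
        - 1 * (y ^ 2 * (y + 1 - 1 / 4 + 1 / 8 / (y + 1)))
        = (6 * y ^ 2 + 3 * y + 1) / (32 * y * (y + 1)) := by
      field_simp
      ring
    rw [key]
    positivity
  have h := hmono.ge_of_tendsto (tendsto_gammaHalfRatioSq_div_add_nat x (1 / 8)) 0
  simp only [Nat.cast_zero, add_zero] at h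
  rwa [div_le_one (hpos hx)] at h

lemma tendsto_sub_gammaHalfRatioSq :
    Tendsto (fun x : ℝ => x - gammaHalfRatioSq x) atTop (𝓝 (1 / 4)) := by
  have h : Tendsto (fun x : ℝ => 1 / 4 - 1 / 8 / x) atTop (𝓝 (1 / 4)) := by
    simpa using (tendsto_const_nhds.div_atTop tendsto_id).const_sub (1 / 4 : ℝ)
  refine tendsto_of_tendsto_of_tendsto_of_le_of_le' h tendsto_const_nhds ?_ ?_
  · filter_upwards [eventually_ge_atTop 1] with x hx
    linarith [gammaHalfRatioSq_le_sub_quarter_add hx]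
  · filter_upwards [eventually_ge_atTop 1] with x hx
    linarith [sub_quarter_le_gammaHalfRatioSq hx]

lemma rpow_mul_Gamma_ratio_sub {x : ℝ} (hx : 0 < x) :
    x ^ ((3 : ℝ) / 2) * (Real.Gamma x / Real.Gamma (x + 1 / 2)
      - Real.Gamma (x + 1 / 2) / Real.Gamma (x + 1))
      = (x - gammaHalfRatioSq x) / √(gammaHalfRatioSq x / x) := by
  have hG := Real.Gamma_pos_of_pos hx
  have hG' := Real.Gamma_pos_of_pos (show 0 < x + 1 / 2 by linarith)
  have hs := Real.sqrt_pos.2 hx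
  rw [Real.sqrt_div' _ hx.le, gammaHalfRatioSq, Real.sqrt_sq (by positivity),
    Real.Gamma_add_one hx.ne', show (3 : ℝ) / 2 = 1 + 1 / 2 by norm_num, Real.rpow_add hx,
    Real.rpow_one, ← Real.sqrt_eq_rpow]
  generalize Real.Gamma (x + 1 / 2) = b at *
  field_simp

/-- Asymptotics of the mean walker position:
m^{3/2}·(Γ(m)/Γ(m+1/2) − Γ(m+1/2)/Γ(m+1)) → 1/4 as m → ∞. -/
theorem stmt_16 :
    Tendsto (fun m : ℕ =>
        (m : ℝ) ^ ((3 : ℝ) / 2) * (Real.Gamma m / Real.Gamma ((m : ℝ) + 1 / 2)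
          - Real.Gamma ((m : ℝ) + 1 / 2) / Real.Gamma ((m : ℝ) + 1)))
      atTop (𝓝 (1 / 4)) := by
  have h := tendsto_sub_gammaHalfRatioSq.div tendsto_gammaHalfRatioSq_div.sqrt (by simp)
  rw [Real.sqrt_one, div_one] at h
  refine (h.comp tendsto_natCast_atTop_atTop).congr' ?_
  filter_upwards [eventually_gt_atTop 0] with m hm
  exact (rpow_mul_Gamma_ratio_sub (Nat.cast_pos.2 hm)).symm
end

section
/- ∫₀¹ ∫₀¹ x·z²·(1−x)·(1−z) / (1 + x²z²)³ dx dz = (1 − G)/8, where G := Σ_{n=0}^{∞} (−1)^n/(2n+1)² is Catalan's constant. (Equivalently: the second moment of the walker position for reinforcement parameter δ = 4, m = 1, is E_1(y²) = 3(1 − G)·t.) -/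
open Real Filter Topology MeasureTheory

theorem hasSum_div_arctan {x : ℝ} (h0 : 0 < x) (h1 : x < 1) :
    HasSum (fun n : ℕ => (-1 : ℝ) ^ n / (2 * (n : ℝ) + 1) * x ^ (2 * n)) (arctan x / x) := by
  have h := (Real.hasSum_arctan (x := x) (by rwa [Real.norm_eq_abs, abs_of_pos h0])).div_const x
  refine (congrArg (HasSum · (arctan x / x)) (funext fun n => ?_)).mp h
  push_cast
  field_simp
  ring

theorem continuous_dslope_arctan : Continuous (dslope arctan 0) := by
  rw [continuous_iff_continuousAt]
  intro x
  rcases eq_or_ne x 0 with rfl | hx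
  · exact continuousAt_dslope_same.2 differentiable_arctan.differentiableAt
  · exact (continuousAt_dslope_of_ne hx).2 continuous_arctan.continuousAt

theorem dslope_arctan_of_ne {x : ℝ} (hx : x ≠ 0) : dslope arctan 0 x = arctan x / x := by
  simp [dslope_of_ne _ hx, slope_def_field]

theorem summable_one_div_odd_sq : Summable fun n : ℕ => 1 / (2 * (n : ℝ) + 1) ^ 2 := by
  have h := (Real.summable_one_div_nat_pow (p := 2)).2 one_lt_two
  have h' := h.comp_injective (i := fun n : ℕ => 2 * n + 1) (fun a b hab => by simpa using hab)
  refine h'.congr fun n => ?_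
  simp

/-- Catalan's constant as the integral of `arctan x / x`. -/
theorem integral_dslope_arctan :
    ∫ x in (0 : ℝ)..1, dslope arctan 0 x = ∑' n : ℕ, (-1 : ℝ) ^ n / (2 * (n : ℝ) + 1) ^ 2 := by
  have hcoef (c : ℝ) (n : ℕ) :
      ∫ x in Set.Ioo (0 : ℝ) 1, c * x ^ (2 * n) = c / (2 * (n : ℝ) + 1) := by
    rw [← integral_Ioc_eq_integral_Ioo, ← intervalIntegral.integral_of_le zero_le_one,
      intervalIntegral.integral_const_mul, integral_pow]
    push_cast
    simp [div_eq_mul_inv]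
  have hint (n : ℕ) : Integrable (fun x : ℝ => (-1 : ℝ) ^ n / (2 * (n : ℝ) + 1) * x ^ (2 * n))
      (volume.restrict (Set.Ioo 0 1)) :=
    ((by fun_prop : Continuous fun x : ℝ =>
      (-1 : ℝ) ^ n / (2 * (n : ℝ) + 1) * x ^ (2 * n)).integrableOn_Icc).mono_set
        Set.Ioo_subset_Icc_self
  have hnorm (n : ℕ) : ∫ x in Set.Ioo (0 : ℝ) 1,
      ‖(-1 : ℝ) ^ n / (2 * (n : ℝ) + 1) * x ^ (2 * n)‖ = 1 / (2 * (n : ℝ) + 1) ^ 2 := by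
    have hn : (0 : ℝ) < 2 * n + 1 := by positivity
    have h (x : ℝ) : ‖(-1 : ℝ) ^ n / (2 * (n : ℝ) + 1) * x ^ (2 * n)‖
        = 1 / (2 * (n : ℝ) + 1) * x ^ (2 * n) := by
      rw [norm_mul, norm_div, norm_pow, norm_neg, norm_one, one_pow, Real.norm_of_nonneg hn.le,
        Real.norm_of_nonneg ((even_two_mul n).pow_nonneg x)]
    simp_rw [h, hcoef]
    field_simp
  have hsum := hasSum_integral_of_summable_integral_norm hint
    (by simpa only [hnorm] using summable_one_div_odd_sq)
  rw [intervalIntegral.integral_of_le zero_le_one, integral_Ioc_eq_integral_Ioo]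
  calc ∫ x in Set.Ioo (0 : ℝ) 1, dslope arctan 0 x
      = ∫ x in Set.Ioo (0 : ℝ) 1, ∑' n : ℕ, (-1 : ℝ) ^ n / (2 * (n : ℝ) + 1) * x ^ (2 * n) :=
        setIntegral_congr_fun measurableSet_Ioo fun x hx => by
          simp only [dslope_arctan_of_ne hx.1.ne', (hasSum_div_arctan hx.1 hx.2).tsum_eq]
    _ = ∑' n : ℕ, (-1 : ℝ) ^ n / (2 * (n : ℝ) + 1) ^ 2 := by
        rw [← hsum.tsum_eq]
        refine tsum_congr fun n => ?_
        rw [hcoef, div_div, sq]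

theorem hasDerivAt_inner_antiderivative {x : ℝ} (hx : x ≠ 0) (z : ℝ) :
    HasDerivAt (fun z : ℝ => x * (1 - x) * (arctan (x * z) / (8 * x ^ 3)
        + z * (x ^ 2 * z ^ 2 - 1) / (8 * x ^ 2 * (1 + x ^ 2 * z ^ 2) ^ 2)
        - z ^ 4 / (4 * (1 + x ^ 2 * z ^ 2) ^ 2)))
      (x * z ^ 2 * (1 - x) * (1 - z) / (1 + x ^ 2 * z ^ 2) ^ 3) z := by
  have hp : 1 + x ^ 2 * z ^ 2 ≠ 0 := by positivity
  have hid := hasDerivAt_id' z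
  have hat := ((hid.const_mul x).arctan).div_const (8 * x ^ 3)
  have hden := (((hid.pow 2).const_mul (x ^ 2)).const_add 1).pow 2
  have h₂ := (hid.mul (((hid.pow 2).const_mul (x ^ 2)).sub_const 1)).div
    (hden.const_mul (8 * x ^ 2)) (by simp only [Pi.pow_apply]; positivity)
  have h₃ := (hid.pow 4).div (hden.const_mul 4) (by simp only [Pi.pow_apply]; positivity)
  refine (((hat.add h₂).sub h₃).const_mul (x * (1 - x))).congr_deriv ?_
  have hq : 1 + (x * z) ^ 2 = 1 + x ^ 2 * z ^ 2 := by ring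
  simp only [Pi.pow_apply, Pi.mul_apply, hq]
  field_simp
  ring

theorem integral_inner_eq {x : ℝ} (hx : x ≠ 0) :
    ∫ z in (0 : ℝ)..1, x * z ^ 2 * (1 - x) * (1 - z) / (1 + x ^ 2 * z ^ 2) ^ 3
      = (1 - x) / 8 * (arctan x / x ^ 2 - 1 / (x * (1 + x ^ 2))) := by
  have hc : Continuous fun z : ℝ =>
      x * z ^ 2 * (1 - x) * (1 - z) / (1 + x ^ 2 * z ^ 2) ^ 3 :=
    Continuous.div (by fun_prop) (by fun_prop) fun z => by positivity
  rw [intervalIntegral.integral_eq_sub_of_hasDerivAt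
    (fun z _ => hasDerivAt_inner_antiderivative hx z) (hc.intervalIntegrable 0 1)]
  simp
  field_simp
  ring

theorem continuous_integral_inner : Continuous fun x : ℝ =>
    ∫ z in (0 : ℝ)..1, x * z ^ 2 * (1 - x) * (1 - z) / (1 + x ^ 2 * z ^ 2) ^ 3 := by
  have h : Continuous fun p : ℝ × ℝ =>
      p.1 * p.2 ^ 2 * (1 - p.1) * (1 - p.2) / (1 + p.1 ^ 2 * p.2 ^ 2) ^ 3 :=
    Continuous.div (by fun_prop) (by fun_prop) fun p => by positivity
  exact intervalIntegral.continuous_parametric_intervalIntegral_of_continuous' h 0 1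

theorem hasDerivAt_mul_dslope_arctan {x : ℝ} (hx : x ≠ 0) :
    HasDerivAt (fun x : ℝ => (x - 1) * dslope arctan 0 x)
      (8 * (∫ z in (0 : ℝ)..1, x * z ^ 2 * (1 - x) * (1 - z) / (1 + x ^ 2 * z ^ 2) ^ 3)
        + dslope arctan 0 x) x := by
  have h := ((hasDerivAt_id' x).sub_const 1).mul
    ((hasDerivAt_arctan x).div (hasDerivAt_id' x) hx)
  have heq : (fun x : ℝ => (x - 1) * dslope arctan 0 x) =ᶠ[𝓝 x]
      fun x : ℝ => (x - 1) * (arctan x / x) := by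
    filter_upwards [isOpen_ne.mem_nhds hx] with y hy
    rw [dslope_arctan_of_ne hy]
  refine (h.congr_of_eventuallyEq heq).congr_deriv ?_
  rw [integral_inner_eq hx, dslope_arctan_of_ne hx]
  simp only [Pi.div_apply]
  field_simp
  ring

/-- The double integral giving the second moment of the walker position for m = 1:
∫₀¹∫₀¹ x·z²·(1−x)·(1−z)/(1+x²z²)³ dx dz = (1 − G)/8 with G Catalan's constant. -/
theorem stmt_17 :
    (∫ x in (0 : ℝ)..1, ∫ z in (0 : ℝ)..1,
        x * z ^ 2 * (1 - x) * (1 - z) / (1 + x ^ 2 * z ^ 2) ^ 3)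
      = (1 - ∑' n : ℕ, (-1 : ℝ) ^ n / (2 * (n : ℝ) + 1) ^ 2) / 8 := by
  have hi := (continuous_integral_inner.const_mul 8).intervalIntegrable (μ := volume) 0 1
  have hd := continuous_dslope_arctan.intervalIntegrable (μ := volume) 0 1
  have h := intervalIntegral.integral_eq_sub_of_hasDerivAt_of_le zero_le_one
    ((continuous_id.sub continuous_const).mul continuous_dslope_arctan).continuousOn
    (fun x hx => hasDerivAt_mul_dslope_arctan hx.1.ne') (hi.add hd)
  rw [intervalIntegral.integral_add hi hd, intervalIntegral.integral_const_mul,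
    integral_dslope_arctan] at h
  simp at h
  linarith
end

section
/- As the integer m tends to infinity, (2m+1)² · ∫₀¹ ∫₀¹ (2xz/(1 + x²z²))^{2m+1} · (1−x)(1−z) / (x²·z) dx dz tends to 1/3. (Equivalently: the second moment of the walker position for reinforcement parameter δ = 4m satisfies E_m(y²) ~ (1/3)·t/(2m+1) as m → ∞.) -/
open Real Filter Topology MeasureTheory

/-- The integrand of the second moment, with exponent `n`. -/
noncomputable def momentKernel (n : ℕ) (x z : ℝ) : ℝ :=
  (2 * x * z / (1 + x ^ 2 * z ^ 2)) ^ n * (1 - x) * (1 - z) / (x ^ 2 * z)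

lemma momentKernel_nonneg (n : ℕ) {x z : ℝ} (hx : 0 ≤ x) (hx1 : x ≤ 1) (hz : 0 ≤ z)
    (hz1 : z ≤ 1) : 0 ≤ momentKernel n x z := by
  have h1 : 0 ≤ 1 - x := by linarith
  have h2 : 0 ≤ 1 - z := by linarith
  unfold momentKernel
  positivity

lemma two_mul_div_one_add_sq_le_exp {w : ℝ} (hw : 0 ≤ w) (hw1 : w ≤ 1) :
    2 * w / (1 + w ^ 2) ≤ exp (-((1 - w) ^ 2 / 2)) := by
  refine le_trans ?_ (add_one_le_exp _)
  rw [div_le_iff₀ (by positivity)]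
  nlinarith [mul_nonneg (sq_nonneg (1 - w)) (by nlinarith : 0 ≤ 1 - w ^ 2)]

lemma momentKernel_le {n : ℕ} (hn : 3 ≤ n) {x z : ℝ} (hx : 0 ≤ x) (hx1 : x ≤ 1) (hz : 0 ≤ z)
    (hz1 : z ≤ 1) :
    momentKernel n x z ≤
      4 * ((1 - x) * (1 - z)) * exp (-(n * ((1 - x) ^ 2 + (1 - z) ^ 2) / 12)) := by
  have h1 : 0 ≤ 1 - x := by linarith
  have h2 : 0 ≤ 1 - z := by linarith
  rcases hx.eq_or_lt with rfl | hx
  · simp only [momentKernel]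
    norm_num
    positivity
  rcases hz.eq_or_lt with rfl | hz
  · simp only [momentKernel]
    norm_num
    positivity
  obtain ⟨k, rfl⟩ := Nat.exists_eq_add_of_le' hn
  have hxz : x * z ≤ 1 := mul_le_one₀ hx1 hz.le hz1
  have hpow : (2 * (x * z) / (1 + (x * z) ^ 2)) ^ (k + 1) ≤
      exp (-((k + 3 : ℕ) * ((1 - x) ^ 2 + (1 - z) ^ 2) / 12)) := by
    refine (pow_le_pow_left₀ (by positivity)
      (two_mul_div_one_add_sq_le_exp (by positivity) hxz) _).trans ?_
    rw [← exp_nat_mul, exp_le_exp]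
    push_cast
    have hx' : (1 - x) ^ 2 ≤ (1 - x * z) ^ 2 := pow_le_pow_left₀ h1 (by nlinarith) 2
    have hz' : (1 - z) ^ 2 ≤ (1 - x * z) ^ 2 := pow_le_pow_left₀ h2 (by nlinarith) 2
    have hk : (0 : ℝ) ≤ k := k.cast_nonneg
    nlinarith [mul_le_mul_of_nonneg_left hx' hk, mul_le_mul_of_nonneg_left hz' hk,
      mul_nonneg hk (sq_nonneg (1 - x * z))]
  have hfac : 4 * z / (1 + (x * z) ^ 2) ^ 2 ≤ 4 := by
    rw [div_le_iff₀ (by positivity)]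
    nlinarith [sq_nonneg (x * z), sq_nonneg ((x * z) ^ 2)]
  calc momentKernel (k + 3) x z
      = 4 * z / (1 + (x * z) ^ 2) ^ 2 * ((1 - x) * (1 - z)) *
          (2 * (x * z) / (1 + (x * z) ^ 2)) ^ (k + 1) := by
        unfold momentKernel
        rw [show k + 3 = (k + 1) + 2 by ring, pow_add, ← mul_pow x z 2, mul_assoc 2 x z]
        generalize (2 * (x * z) / (1 + (x * z) ^ 2)) ^ (k + 1) = A
        field_simp
        ring
    _ ≤ _ := by gcongr

/-- The integrand after rescaling both variables around `1` by `√n`. -/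
noncomputable def scaledKernel (n : ℕ) (u v : ℝ) : ℝ :=
  (Set.Iic (√n)).indicator (fun _ => (Set.Iic (√n)).indicator
    (fun v => n * momentKernel n (1 - u / √n) (1 - v / √n)) v) u

lemma measurable_scaledKernel (n : ℕ) : Measurable (fun p : ℝ × ℝ => scaledKernel n p.1 p.2) := by
  have h : (fun p : ℝ × ℝ => scaledKernel n p.1 p.2) =
      (Set.Iic (√n) ×ˢ Set.Iic (√n)).indicator
        (fun p => n * momentKernel n (1 - p.1 / √n) (1 - p.2 / √n)) := by
    ext p
    by_cases h1 : p.1 ≤ √n <;> by_cases h2 : p.2 ≤ √n <;>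
      simp [scaledKernel, Set.indicator, Prod.le_def, h1, h2]
  rw [h]
  refine Measurable.indicator ?_ (measurableSet_Iic.prod measurableSet_Iic)
  unfold momentKernel
  fun_prop

lemma abs_scaledKernel_le {n : ℕ} (hn : 3 ≤ n) {u v : ℝ} (hu : 0 ≤ u) (hv : 0 ≤ v) :
    |scaledKernel n u v| ≤
      4 * ((u * exp (-(1 / 12) * u ^ 2)) * (v * exp (-(1 / 12) * v ^ 2))) := by
  have hn0 : (0 : ℝ) < n := by exact_mod_cast (by omega : 0 < n)
  have hc : 0 < √(n : ℝ) := sqrt_pos.2 hn0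
  by_cases h1 : u ≤ √n
  swap
  · simp only [scaledKernel, Set.indicator, Set.mem_Iic, h1, if_false, abs_zero]
    positivity
  by_cases h2 : v ≤ √n
  swap
  · simp only [scaledKernel, Set.indicator, Set.mem_Iic, h2, if_false, ite_self, abs_zero]
    positivity
  simp only [scaledKernel, Set.indicator, Set.mem_Iic, h1, h2, if_true]
  have hu1 : u / √n ≤ 1 := (div_le_one hc).2 h1
  have hv1 : v / √n ≤ 1 := (div_le_one hc).2 h2
  have hu0 : 0 ≤ u / √n := by positivity
  have hv0 : 0 ≤ v / √n := by positivity
  rw [abs_of_nonneg (mul_nonneg hn0.le (momentKernel_nonneg n (by linarith) (by linarith)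
    (by linarith) (by linarith)))]
  refine (mul_le_mul_of_nonneg_left (momentKernel_le hn (by linarith) (by linarith)
    (by linarith) (by linarith)) hn0.le).trans_eq ?_
  have hsq : √(n : ℝ) ^ 2 = n := sq_sqrt hn0.le
  have hexp : -((n : ℝ) * ((1 - (1 - u / √n)) ^ 2 + (1 - (1 - v / √n)) ^ 2) / 12) =
      -(1 / 12) * u ^ 2 + -(1 / 12) * v ^ 2 := by
    rw [sub_sub_cancel, sub_sub_cancel, div_pow, div_pow, hsq]
    field_simp
    ring
  rw [hexp, exp_add, sub_sub_cancel, sub_sub_cancel]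
  have huv : (n : ℝ) * (u / √n * (v / √n)) = u * v := by
    rw [div_mul_div_comm, ← sq, hsq]
    field_simp
  linear_combination 4 * (exp (-(1 / 12) * u ^ 2) * exp (-(1 / 12) * v ^ 2)) * huv

lemma integrable_gaussian_bound :
    Integrable (fun p : ℝ × ℝ =>
      4 * ((p.1 * exp (-(1 / 12) * p.1 ^ 2)) * (p.2 * exp (-(1 / 12) * p.2 ^ 2))))
      ((volume.restrict (Set.Ioi 0)).prod (volume.restrict (Set.Ioi 0))) := by
  have h : Integrable (fun x : ℝ => x * exp (-(1 / 12) * x ^ 2))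
      (volume.restrict (Set.Ioi 0)) := (integrable_mul_exp_neg_mul_sq (by norm_num)).restrict
  exact (h.mul_prod h).const_mul 4

lemma ae_pos_prod :
    ∀ᵐ p : ℝ × ℝ ∂(volume.restrict (Set.Ioi 0)).prod (volume.restrict (Set.Ioi 0)),
      0 < p.1 ∧ 0 < p.2 := by
  rw [Measure.prod_restrict]
  exact ae_restrict_mem (measurableSet_Ioi.prod measurableSet_Ioi)

lemma integrable_scaledKernel {n : ℕ} (hn : 3 ≤ n) :
    Integrable (fun p : ℝ × ℝ => scaledKernel n p.1 p.2)
      ((volume.restrict (Set.Ioi 0)).prod (volume.restrict (Set.Ioi 0))) :=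
  integrable_gaussian_bound.mono' (measurable_scaledKernel n).aestronglyMeasurable
    (ae_pos_prod.mono fun _ hp => abs_scaledKernel_le hn hp.1.le hp.2.le)

lemma integral_zero_one_eq_scaled (g : ℝ → ℝ) {c : ℝ} (hc : 0 < c) :
    c * ∫ x in (0 : ℝ)..1, g x =
      ∫ u in Set.Ioi 0, (Set.Iic c).indicator (fun u => g (1 - u / c)) u := by
  have h := intervalIntegral.integral_comp_sub_div (a := 0) (b := c) g hc.ne' 1
  rw [div_self hc.ne', zero_div, sub_zero, sub_self, smul_eq_mul] at h
  rw [← h, intervalIntegral.integral_of_le hc.le, setIntegral_indicator measurableSet_Iic,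
    Set.Ioi_inter_Iic]

lemma sq_mul_integral_momentKernel {n : ℕ} (hn : 3 ≤ n) :
    (n : ℝ) ^ 2 * ∫ x in (0 : ℝ)..1, ∫ z in (0 : ℝ)..1, momentKernel n x z =
      ∫ p : ℝ × ℝ, scaledKernel n p.1 p.2
        ∂(volume.restrict (Set.Ioi 0)).prod (volume.restrict (Set.Ioi 0)) := by
  have hn0 : (0 : ℝ) < n := by exact_mod_cast (by omega : 0 < n)
  have hc : 0 < √(n : ℝ) := sqrt_pos.2 hn0
  have hsq : √(n : ℝ) * √n = n := mul_self_sqrt hn0.le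
  rw [integral_prod _ (integrable_scaledKernel hn)]
  calc (n : ℝ) ^ 2 * ∫ x in (0 : ℝ)..1, ∫ z in (0 : ℝ)..1, momentKernel n x z
      = √n * ∫ x in (0 : ℝ)..1, √n * ∫ z in (0 : ℝ)..1, n * momentKernel n x z := by
        simp only [intervalIntegral.integral_const_mul]
        linear_combination -(n * ∫ x in (0 : ℝ)..1, ∫ z in (0 : ℝ)..1, momentKernel n x z) * hsq
    _ = _ := by
        rw [integral_zero_one_eq_scaled _ hc]
        congr 1
        ext u
        by_cases hu : u ≤ √n
        · simp only [scaledKernel, Set.indicator_of_mem (Set.mem_Iic.2 hu)]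
          exact integral_zero_one_eq_scaled _ hc
        · have hu' : u ∉ Set.Iic (√(n : ℝ)) := hu
          simp [scaledKernel, Set.indicator_of_notMem hu']

lemma tendsto_scaledKernel {u v : ℝ} :
    Tendsto (fun n : ℕ => scaledKernel n u v) atTop (𝓝 (u * v * exp (-(u + v) ^ 2 / 2))) := by
  have hsqrt : Tendsto (fun n : ℕ => √(n : ℝ)) atTop atTop :=
    tendsto_sqrt_atTop.comp tendsto_natCast_atTop_atTop
  have hx : Tendsto (fun n : ℕ => 1 - u / √n) atTop (𝓝 1) := by
    simpa using (hsqrt.const_div_atTop u).const_sub 1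
  have hz : Tendsto (fun n : ℕ => 1 - v / √n) atTop (𝓝 1) := by
    simpa using (hsqrt.const_div_atTop v).const_sub 1
  have hd : Tendsto (fun n : ℕ => u + v - u * v / √n) atTop (𝓝 (u + v)) := by
    simpa using (hsqrt.const_div_atTop (u * v)).const_sub (u + v)
  have hw : Tendsto (fun n : ℕ => 1 + ((1 - u / √n) * (1 - v / √n)) ^ 2) atTop (𝓝 2) := by
    have := ((hx.mul hz).pow 2).const_add 1
    norm_num at this
    exact this
  have hpow : Tendsto (fun n : ℕ =>
      (1 + -(u + v - u * v / √n) ^ 2 / n / (1 + ((1 - u / √n) * (1 - v / √n)) ^ 2)) ^ n)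
      atTop (𝓝 (exp (-(u + v) ^ 2 / 2))) := by
    refine tendsto_one_add_pow_exp_of_tendsto (((hd.pow 2).neg.div hw two_ne_zero).congr' ?_)
    filter_upwards [eventually_gt_atTop 0] with n hn
    have hn0 : (n : ℝ) ≠ 0 := by exact_mod_cast hn.ne'
    simp only [Pi.div_apply]
    generalize 1 + ((1 - u / √n) * (1 - v / √n)) ^ 2 = A
    generalize (u + v - u * v / √n) = B
    field_simp
  have hden : Tendsto (fun n : ℕ => (1 - u / √n) ^ 2 * (1 - v / √n)) atTop (𝓝 1) := by
    simpa using (hx.pow 2).mul hz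
  have hlim := (hpow.const_mul (u * v)).div hden one_ne_zero
  rw [div_one] at hlim
  refine hlim.congr' ?_
  filter_upwards [hsqrt.eventually_ge_atTop u, hsqrt.eventually_ge_atTop v,
    eventually_gt_atTop 0] with n hu hv hn
  have hn0 : (0 : ℝ) < n := by exact_mod_cast hn
  have hc : √(n : ℝ) ≠ 0 := (sqrt_pos.2 hn0).ne'
  have hsq : √(n : ℝ) ^ 2 = n := sq_sqrt hn0.le
  have huv : (n : ℝ) * (u / √n * (v / √n)) = u * v := by
    rw [div_mul_div_comm, ← sq, hsq]
    field_simp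
  simp only [scaledKernel, Set.indicator_of_mem (Set.mem_Iic.2 hu),
    Set.indicator_of_mem (Set.mem_Iic.2 hv), momentKernel, Pi.div_apply]
  have hbase : 1 + -(u + v - u * v / √n) ^ 2 / n / (1 + ((1 - u / √n) * (1 - v / √n)) ^ 2) =
      2 * (1 - u / √n) * (1 - v / √n) / (1 + (1 - u / √n) ^ 2 * (1 - v / √n) ^ 2) := by
    have hw0 : 1 + ((1 - u / √n) * (1 - v / √n)) ^ 2 ≠ 0 := by positivity
    have hdiff : (u + v - u * v / √n) ^ 2 / n = (1 - (1 - u / √n) * (1 - v / √n)) ^ 2 := by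
      rw [show (u + v - u * v / √n) ^ 2 / (n : ℝ) = ((u + v - u * v / √n) / √n) ^ 2 by
        rw [div_pow, hsq]]
      congr 1
      field_simp
      ring
    rw [neg_div, hdiff, ← mul_pow, eq_div_iff hw0, add_mul, div_mul_cancel₀ _ hw0]
    ring
  rw [hbase, ← huv]
  ring

lemma integrable_gaussian_limit :
    Integrable (fun p : ℝ × ℝ => p.1 * p.2 * exp (-(p.1 + p.2) ^ 2 / 2))
      ((volume.restrict (Set.Ioi 0)).prod (volume.restrict (Set.Ioi 0))) := by
  refine integrable_gaussian_bound.mono' (by fun_prop) (ae_pos_prod.mono fun p hp => ?_)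
  obtain ⟨h1, h2⟩ := hp
  have hE : exp (-(p.1 + p.2) ^ 2 / 2) ≤
      exp (-(1 / 12) * p.1 ^ 2) * exp (-(1 / 12) * p.2 ^ 2) := by
    rw [← exp_add, exp_le_exp]
    nlinarith [mul_pos h1 h2, sq_nonneg p.1, sq_nonneg p.2]
  rw [norm_of_nonneg (by positivity)]
  calc p.1 * p.2 * exp (-(p.1 + p.2) ^ 2 / 2)
      ≤ p.1 * p.2 * (exp (-(1 / 12) * p.1 ^ 2) * exp (-(1 / 12) * p.2 ^ 2)) := by gcongr
    _ ≤ 4 * (p.1 * p.2 * (exp (-(1 / 12) * p.1 ^ 2) * exp (-(1 / 12) * p.2 ^ 2))) :=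
        le_mul_of_one_le_left (by positivity) (by norm_num)
    _ = _ := by ring

lemma integrableOn_pow_three_mul_exp_neg_mul_sq {b : ℝ} (hb : 0 < b) :
    IntegrableOn (fun u : ℝ => u ^ 3 * exp (-b * u ^ 2)) (Set.Ioi 0) := by
  have h := integrableOn_rpow_mul_exp_neg_mul_sq hb (s := 3) (by norm_num)
  exact_mod_cast h

lemma integral_pow_three_mul_exp_neg_mul_sq {b : ℝ} (hb : 0 < b) :
    ∫ u in Set.Ioi (0 : ℝ), u ^ 3 * exp (-b * u ^ 2) = 1 / (2 * b ^ 2) := by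
  have h := integral_rpow_mul_exp_neg_mul_rpow (p := 2) (q := 3) (b := b)
    (by norm_num) (by norm_num) hb
  norm_num at h
  simp only [neg_mul]
  rw [h]
  field_simp

lemma hasDerivAt_div_one_add_pow_four {r : ℝ} (hr : 0 ≤ r) :
    HasDerivAt (fun r : ℝ => -((1 + r) ^ 2)⁻¹ + 2 / 3 * ((1 + r) ^ 3)⁻¹)
      (r * (2 / (1 + r) ^ 4)) r := by
  have hr' : 1 + r ≠ 0 := by positivity
  have h := (hasDerivAt_id' r).const_add 1
  convert! ((h.pow 2).inv (pow_ne_zero 2 hr')).neg.add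
    (((h.pow 3).inv (pow_ne_zero 3 hr')).const_mul (2 / 3)) using 1
  simp only [Pi.pow_apply]
  field_simp
  ring

lemma tendsto_primitive_div_one_add_pow_four :
    Tendsto (fun r : ℝ => -((1 + r) ^ 2)⁻¹ + 2 / 3 * ((1 + r) ^ 3)⁻¹) atTop (𝓝 0) := by
  have h : Tendsto (fun r : ℝ => (1 + r)⁻¹) atTop (𝓝 0) :=
    tendsto_inv_atTop_zero.comp (tendsto_atTop_add_const_left _ _ tendsto_id)
  simpa [inv_pow] using (h.pow 2).neg.add ((h.pow 3).const_mul (2 / 3))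

lemma integrableOn_div_one_add_pow_four :
    IntegrableOn (fun r : ℝ => r * (2 / (1 + r) ^ 4)) (Set.Ioi 0) :=
  integrableOn_Ioi_deriv_of_nonneg' (fun _ hr => hasDerivAt_div_one_add_pow_four hr)
    (fun r hr => by have : 0 < r := hr; positivity) tendsto_primitive_div_one_add_pow_four

lemma integral_div_one_add_pow_four :
    ∫ r in Set.Ioi (0 : ℝ), r * (2 / (1 + r) ^ 4) = 1 / 3 := by
  rw [integral_Ioi_of_hasDerivAt_of_tendsto' (fun _ hr => hasDerivAt_div_one_add_pow_four hr)
    integrableOn_div_one_add_pow_four tendsto_primitive_div_one_add_pow_four]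
  norm_num

lemma integral_mul_pow_three_mul_exp {r : ℝ} (hr : 0 < r) :
    ∫ u in Set.Ioi (0 : ℝ), r * (u ^ 3 * exp (-((1 + r) ^ 2 / 2) * u ^ 2)) =
      r * (2 / (1 + r) ^ 4) := by
  rw [integral_const_mul, integral_pow_three_mul_exp_neg_mul_sq (by positivity)]
  field_simp

lemma integral_gaussian_limit :
    ∫ p : ℝ × ℝ, p.1 * p.2 * exp (-(p.1 + p.2) ^ 2 / 2)
      ∂(volume.restrict (Set.Ioi 0)).prod (volume.restrict (Set.Ioi 0)) = 1 / 3 := by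
  have hint : Integrable
      (Function.uncurry fun u r : ℝ => r * (u ^ 3 * exp (-((1 + r) ^ 2 / 2) * u ^ 2)))
      ((volume.restrict (Set.Ioi 0)).prod (volume.restrict (Set.Ioi 0))) := by
    rw [integrable_prod_iff' (Continuous.aestronglyMeasurable (by fun_prop))]
    refine ⟨?_, ?_⟩
    · filter_upwards [ae_restrict_mem measurableSet_Ioi] with r (hr : 0 < r)
      have hb : 0 < (1 + r) ^ 2 / 2 := by positivity
      exact (integrableOn_pow_three_mul_exp_neg_mul_sq hb).const_mul r
    · refine integrableOn_div_one_add_pow_four.congr_fun (fun r hr => ?_) measurableSet_Ioi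
      have hr0 : 0 < r := hr
      refine (integral_mul_pow_three_mul_exp hr0).symm.trans ?_
      refine setIntegral_congr_fun measurableSet_Ioi fun u hu => ?_
      have hu0 : 0 < u := hu
      have hnn : 0 ≤ r * (u ^ 3 * exp (-((1 + r) ^ 2 / 2) * u ^ 2)) := by positivity
      exact (norm_of_nonneg hnn).symm
  rw [integral_prod _ integrable_gaussian_limit]
  calc ∫ u in Set.Ioi (0 : ℝ), ∫ v in Set.Ioi (0 : ℝ), u * v * exp (-(u + v) ^ 2 / 2)
      = ∫ u in Set.Ioi (0 : ℝ), ∫ r in Set.Ioi (0 : ℝ),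
          r * (u ^ 3 * exp (-((1 + r) ^ 2 / 2) * u ^ 2)) := by
        refine setIntegral_congr_fun measurableSet_Ioi fun u hu => ?_
        have hu0 : 0 < u := hu
        have h := integral_comp_mul_left_Ioi
          (fun v => u * v * exp (-(u + v) ^ 2 / 2)) 0 hu0
        rw [mul_zero, smul_eq_mul, eq_inv_mul_iff_mul_eq₀ hu0.ne'] at h
        rw [← h, ← integral_const_mul]
        congr 1
        ext r
        rw [show -(u + u * r) ^ 2 / 2 = -((1 + r) ^ 2 / 2) * u ^ 2 by ring]
        ring
    _ = ∫ r in Set.Ioi (0 : ℝ), r * (2 / (1 + r) ^ 4) := by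
        rw [integral_integral_swap hint]
        exact setIntegral_congr_fun measurableSet_Ioi fun r hr =>
          integral_mul_pow_three_mul_exp hr
    _ = 1 / 3 := integral_div_one_add_pow_four

lemma tendsto_sq_mul_integral_momentKernel :
    Tendsto (fun n : ℕ => (n : ℝ) ^ 2 * ∫ x in (0 : ℝ)..1, ∫ z in (0 : ℝ)..1, momentKernel n x z)
      atTop (𝓝 (1 / 3)) := by
  rw [← integral_gaussian_limit]
  refine (tendsto_integral_filter_of_dominated_convergence _
    (.of_forall fun n => (measurable_scaledKernel n).aestronglyMeasurable) ?_
    integrable_gaussian_bound (.of_forall fun _ => tendsto_scaledKernel)).congr' ?_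
  · filter_upwards [eventually_ge_atTop 3] with n hn
    exact ae_pos_prod.mono fun _ hp => abs_scaledKernel_le hn hp.1.le hp.2.le
  · filter_upwards [eventually_ge_atTop 3] with n hn
    exact (sq_mul_integral_momentKernel hn).symm

/-- Asymptotics of the second moment of the walker position:
(2m+1)²·∫₀¹∫₀¹ (2xz/(1+x²z²))^{2m+1}·(1−x)(1−z)/(x²z) dx dz → 1/3 as m → ∞. -/
theorem stmt_18 :
    Tendsto (fun m : ℕ =>
        (2 * (m : ℝ) + 1) ^ 2 * ∫ x in (0 : ℝ)..1, ∫ z in (0 : ℝ)..1,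
          (2 * x * z / (1 + x ^ 2 * z ^ 2)) ^ (2 * m + 1) * (1 - x) * (1 - z) / (x ^ 2 * z))
      atTop (𝓝 (1 / 3)) := by
  have hodd : Tendsto (fun m : ℕ => 2 * m + 1) atTop atTop :=
    tendsto_atTop_mono (fun m => by omega : ∀ m : ℕ, m ≤ 2 * m + 1) tendsto_id
  refine (tendsto_sq_mul_integral_momentKernel.comp hodd).congr fun m => ?_
  simp [momentKernel]
end
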